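/- arXiv:2504.03788 — 5 statements merged into one kernel-verified Lean document; each statement's English description precedes it below -/
import Mathlib

section
/- Let n ≥ 1, T > 0, and let f : ℝ × ℝⁿ × ℝ → ℝⁿ be of class C² and T-periodic in its first variable. Let f₀(x) = (1/T)∫₀^T f(t,x,0) dt, and let y* be a hyperbolic equilibrium of y' = α f₀(y). If every eigenvalue of D f₀(y*) has negative real part, then for all sufficiently small α > 0 the unique T-periodic solution x(·, α) of x' = α f(t, x, α) near y* is asymptotically stable; if some eigenvalue of D f₀(y*) has positive real part, then for all sufficiently small α > 0 this T-periodic solution is unstable. -/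
open Set Filter Topology intervalIntegral

/-- The Jacobian matrix of a map `G : ℝⁿ → ℝⁿ` at a point `x`. -/
noncomputable def jacobianMatrix (n : ℕ) (G : (Fin n → ℝ) → (Fin n → ℝ))
    (x : Fin n → ℝ) : Matrix (Fin n) (Fin n) ℝ :=
  Matrix.of fun i j => fderiv ℝ G x (Pi.single j 1) i

/-- A solution `q` of `x' = G(t,x)` is Lyapunov stable. -/
def IsLyapStableSol (n : ℕ) (G : ℝ → (Fin n → ℝ) → (Fin n → ℝ))
    (q : ℝ → Fin n → ℝ) : Prop :=
  ∀ ε > 0, ∃ δ > 0, ∀ x₀ : Fin n → ℝ, ‖x₀ - q 0‖ < δ →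
    (∃ z : ℝ → Fin n → ℝ, z 0 = x₀ ∧
      (∀ t, 0 ≤ t → HasDerivAt z (G t (z t)) t)) ∧
    (∀ z : ℝ → Fin n → ℝ, z 0 = x₀ →
      (∀ t, 0 ≤ t → HasDerivAt z (G t (z t)) t) →
      ∀ t, 0 ≤ t → ‖z t - q t‖ < ε)

/-- A solution `q` of `x' = G(t,x)` is asymptotically stable. -/
def IsAsympStableSol (n : ℕ) (G : ℝ → (Fin n → ℝ) → (Fin n → ℝ))
    (q : ℝ → Fin n → ℝ) : Prop :=
  ∀ ε > 0, ∃ δ > 0, ∀ x₀ : Fin n → ℝ, ‖x₀ - q 0‖ < δ →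
    (∃ z : ℝ → Fin n → ℝ, z 0 = x₀ ∧
      (∀ t, 0 ≤ t → HasDerivAt z (G t (z t)) t)) ∧
    (∀ z : ℝ → Fin n → ℝ, z 0 = x₀ →
      (∀ t, 0 ≤ t → HasDerivAt z (G t (z t)) t) →
      (∀ t, 0 ≤ t → ‖z t - q t‖ < ε) ∧
      Filter.Tendsto (fun t => ‖z t - q t‖) Filter.atTop (𝓝 0))


/-- Every bilinear form on a finite dimensional space is bounded. -/
lemma bilin_bound {V : Type*} [NormedAddCommGroup V] [NormedSpace ℝ V] [FiniteDimensional ℝ V]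
    (B : V →ₗ[ℝ] V →ₗ[ℝ] ℝ) : ∃ b > 0, ∀ u v, |B u v| ≤ b * ‖u‖ * ‖v‖ := by
  let C : V →L[ℝ] V →L[ℝ] ℝ :=
    LinearMap.toContinuousLinearMap
      ((LinearMap.toContinuousLinearMap : (V →ₗ[ℝ] ℝ) ≃ₗ[ℝ] (V →L[ℝ] ℝ)).toLinearMap ∘ₗ B)
  refine ⟨‖C‖ + 1, by positivity, fun u v => ?_⟩
  have h : |B u v| ≤ ‖C‖ * ‖u‖ * ‖v‖ := by
    have := C.le_opNorm₂ u v
    simpa [C] using this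
  have : 0 ≤ ‖u‖ * ‖v‖ := by positivity
  nlinarith

/-- Lyapunov-type form for a hyperbolic endomorphism of a complex space. -/
lemma exists_form (d : ℕ) : ∀ (V : Type) [NormedAddCommGroup V] [NormedSpace ℂ V]
    [FiniteDimensional ℂ V], Module.finrank ℂ V = d → ∀ A : Module.End ℂ V,
    (∀ μ, A.HasEigenvalue μ → μ.re ≠ 0) →
    ∃ B : V →ₗ[ℝ] V →ₗ[ℝ] ℝ, ∃ c > 0, (∀ u v, B u v = B v u) ∧
      (∀ u v, B (Complex.I • u) (Complex.I • v) = B u v) ∧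
      (∀ u, c * ‖u‖ ^ 2 ≤ B (A u) u) ∧
      ((∀ μ, A.HasEigenvalue μ → μ.re < 0) → ∀ u, B u u ≤ - (c * ‖u‖ ^ 2)) := by
  induction d with
  | zero =>
    intro V _ _ _ hd A hA
    have : Subsingleton V := Module.finrank_zero_iff.1 hd
    refine ⟨0, 1, one_pos, by simp, by simp, fun u => ?_, fun _ u => ?_⟩ <;>
      simp [Subsingleton.elim u 0]
  | succ d ih =>
    intro V _ _ _ hd A hA
    have : Nontrivial V := Module.nontrivial_of_finrank_pos (R := ℂ) (by omega)
    obtain ⟨lam, hlam⟩ := Module.End.exists_eigenvalue (K := ℂ) (V := Module.Dual ℂ V)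
      (LinearMap.dualMap A)
    obtain ⟨φ, hφ⟩ := hlam.exists_hasEigenvector
    have hφ0 : φ ≠ 0 := hφ.2
    have hφA : ∀ u, φ (A u) = lam * φ u := fun u => by
      have := hφ.apply_eq_smul
      have := LinearMap.congr_fun this u
      simpa using this
    have hlamA : A.HasEigenvalue lam := by
      rw [Module.End.hasEigenvalue_iff_mem_spectrum, spectrum.mem_iff]
      intro hu
      rw [Module.End.isUnit_iff] at hu
      apply hφ0
      ext v
      obtain ⟨w, rfl⟩ := hu.2 v
      simp [hφA, Module.algebraMap_end_apply]
    have hre := hA lam hlamA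
    obtain ⟨e, he⟩ : ∃ e, φ e = 1 := by
      obtain ⟨v, hv⟩ : ∃ v, φ v ≠ 0 := by
        by_contra! h
        exact hφ0 (LinearMap.ext h)
      exact ⟨(φ v)⁻¹ • v, by simp [hv]⟩
    let W := LinearMap.ker φ
    have hW : ∀ w ∈ W, A w ∈ W := fun w hw => by
      have : φ w = 0 := hw
      change φ (A w) = 0
      simp [hφA, this]
    have hfr : Module.finrank ℂ W = d := by
      have h1 := LinearMap.finrank_range_add_finrank_ker φ
      have h2 : LinearMap.range φ = ⊤ := by
        rw [LinearMap.range_eq_top]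
        intro z
        exact ⟨z • e, by simp [he]⟩
      rw [h2, finrank_top, Module.finrank_self, hd] at h1
      change Module.finrank ℂ (LinearMap.ker φ) = d
      omega
    let A' : Module.End ℂ W := A.restrict hW
    have heig : ∀ μ, A'.HasEigenvalue μ → A.HasEigenvalue μ := by
      intro μ hμ
      obtain ⟨w, hw⟩ := hμ.exists_hasEigenvector
      have h1 := hw.apply_eq_smul
      have h2 : A w = μ • (w : V) := by
        have := congrArg Subtype.val h1
        simpa [A'] using this
      refine Module.End.hasEigenvalue_of_hasEigenvector (x := (w : V)) ⟨?_, ?_⟩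
      · exact Module.End.mem_eigenspace_iff.2 h2
      · intro h0
        exact hw.2 (Subtype.ext h0)
    obtain ⟨B', c', hc', hsym, hI, hpos, hneg⟩ := ih W hfr A' (fun μ hμ => hA μ (heig μ hμ))
    obtain ⟨b, hb, hbd⟩ := bilin_bound B'
    let π : V →ₗ[ℂ] W := LinearMap.codRestrict W (LinearMap.id - φ.smulRight e) (fun u => by
      change φ _ = 0
      simp [he])
    have hπ : ∀ u, (π u : V) = u - φ u • e := fun u => rfl
    have hπA : ∀ u, π (A u) = A' (π u) + φ u • π (A e) := fun u => by
      apply Subtype.ext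
      simp only [hπ, A', hφA, he, Submodule.coe_add, Submodule.coe_smul, LinearMap.coe_restrict_apply,
        map_sub, map_smul, smul_sub]
      module
    set m : ℝ := b * ‖π (A e)‖ with hm
    have hm0 : 0 ≤ m := by positivity
    set K : ℝ := (c' + m ^ 2 / c') / |lam.re| + c' with hK
    have hrepos : 0 < |lam.re| := abs_pos.2 hre
    have hKpos : 0 < K := by positivity
    set s : ℝ := ((SignType.sign lam.re : SignType) : ℝ) with hs
    have hsre : s * lam.re = |lam.re| := sign_mul_self _
    let B1 : V →ₗ[ℝ] V →ₗ[ℝ] ℝ :=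
      LinearMap.mk₂ ℝ (fun u v => B' (π u) (π v) + K * s * (φ u * (starRingEnd ℂ) (φ v)).re)
        (fun u u' v => by simp; ring)
        (fun r u v => by
          have h1 : π (r • u) = r • π u := LinearMap.map_smul_of_tower π r u
          have h2 : φ (r • u) = r • φ u := LinearMap.map_smul_of_tower φ r u
          rw [h1, h2]; simp; ring)
        (fun u v v' => by simp; ring)
        (fun r u v => by
          have h1 : π (r • v) = r • π v := LinearMap.map_smul_of_tower π r v
          have h2 : φ (r • v) = r • φ v := LinearMap.map_smul_of_tower φ r v
          rw [h1, h2]; simp; ring)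
    have hB1 : ∀ u v, B1 u v = B' (π u) (π v) + K * s * (φ u * (starRingEnd ℂ) (φ v)).re :=
      fun u v => rfl
    set c : ℝ := c' / 2 / (2 * (1 + ‖e‖ ^ 2)) with hc
    have hcpos : 0 < c := by positivity
    have hcu : ∀ u, c * ‖u‖ ^ 2 ≤ c' / 2 * (‖π u‖ ^ 2 + ‖φ u‖ ^ 2) := fun u => by
      have h1 : ‖u‖ ≤ ‖π u‖ + ‖φ u‖ * ‖e‖ := by
        have : u = (π u : V) + φ u • e := by rw [hπ]; simp
        calc ‖u‖ = ‖(π u : V) + φ u • e‖ := by rw [← this]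
          _ ≤ ‖(π u : V)‖ + ‖φ u • e‖ := norm_add_le _ _
          _ = _ := by rw [norm_smul]; rfl
      have h2 : ‖u‖ ^ 2 ≤ (2 * (1 + ‖e‖ ^ 2)) * (‖π u‖ ^ 2 + ‖φ u‖ ^ 2) := by
        have h3 : ‖u‖ ^ 2 ≤ (‖π u‖ + ‖φ u‖ * ‖e‖) ^ 2 := by gcongr
        nlinarith [sq_nonneg (‖π u‖ - ‖φ u‖ * ‖e‖), sq_nonneg (‖π u‖ * ‖e‖), sq_nonneg (‖φ u‖)]
      calc c * ‖u‖ ^ 2 ≤ c * ((2 * (1 + ‖e‖ ^ 2)) * (‖π u‖ ^ 2 + ‖φ u‖ ^ 2)) := by gcongr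
        _ = _ := by rw [hc]; field_simp
    have hmul : ∀ z : ℂ, (z * (starRingEnd ℂ) z).re = ‖z‖ ^ 2 := fun z => by
      rw [Complex.mul_conj, Complex.normSq_eq_norm_sq, Complex.ofReal_re]
    refine ⟨B1, c, hcpos, ?_, ?_, ?_, ?_⟩
    · intro u v
      rw [hB1, hB1, hsym]; simp; ring_nf; simp
    · intro u v
      rw [hB1, hB1]
      simp only [map_smul, hI]
      simp
    · intro u
      rw [hB1, hφA, hπA, map_add, LinearMap.add_apply, mul_assoc lam, Complex.mul_re]
      have him : (φ u * (starRingEnd ℂ) (φ u)).im = 0 := by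
        rw [Complex.mul_conj]; simp
      rw [him, hmul]
      have h1 := hpos (π u)
      have h2 : |B' (φ u • π (A e)) (π u)| ≤ m * ‖φ u‖ * ‖π u‖ := by
        refine (hbd _ _).trans (le_of_eq ?_)
        rw [norm_smul, hm]; ring
      have h3 := (abs_le.1 h2).1
      have h4 := hcu u
      have h5 : K * s * (lam.re * ‖φ u‖ ^ 2 - lam.im * 0) = K * |lam.re| * ‖φ u‖ ^ 2 := by
        rw [← hsre]; ring
      rw [h5]
      have h6 : (c' + m ^ 2 / c') ≤ K * |lam.re| := by
        rw [hK, add_mul, div_mul_cancel₀ _ hrepos.ne']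
        have : 0 ≤ c' * |lam.re| := by positivity
        linarith
      have h7 : (c' + m ^ 2 / c') * ‖φ u‖ ^ 2 ≤ K * |lam.re| * ‖φ u‖ ^ 2 := by gcongr
      have h8 : m * ‖φ u‖ * ‖π u‖ ≤ c' / 4 * ‖π u‖ ^ 2 + m ^ 2 / c' * ‖φ u‖ ^ 2 := by
        have : 0 ≤ (c' / 2 * ‖π u‖ - m * ‖φ u‖) ^ 2 / c' := by positivity
        have h9 : (c' / 2 * ‖π u‖ - m * ‖φ u‖) ^ 2 / c' =
          c' / 4 * ‖π u‖ ^ 2 + m ^ 2 / c' * ‖φ u‖ ^ 2 - m * ‖φ u‖ * ‖π u‖ := by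
          field_simp; ring
        linarith
      nlinarith [sq_nonneg ‖π u‖, sq_nonneg ‖φ u‖]
    · intro hall u
      rw [hB1, hmul]
      have h1 := hneg (fun μ hμ => hall μ (heig μ hμ)) (π u)
      have hs1 : s = -1 := by rw [hs, sign_neg (hall lam hlamA)]; simp
      have h4 := hcu u
      have h6 : c' ≤ K := by
        rw [hK]
        have : 0 ≤ (c' + m ^ 2 / c') / |lam.re| := by positivity
        linarith
      have h7 : c' * ‖φ u‖ ^ 2 ≤ K * ‖φ u‖ ^ 2 := by gcongr
      rw [hs1]
      nlinarith [sq_nonneg ‖π u‖, sq_nonneg ‖φ u‖]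

/-- Real version. -/
lemma exists_real_form (n : ℕ) (M : Matrix (Fin n) (Fin n) ℝ)
    (hhyp : ∀ μ ∈ spectrum ℂ (M.map Complex.ofReal), μ.re ≠ 0) :
    ∃ B : (Fin n → ℝ) →ₗ[ℝ] (Fin n → ℝ) →ₗ[ℝ] ℝ, ∃ c > 0, (∀ u v, B u v = B v u) ∧
      (∀ u, c * ‖u‖ ^ 2 ≤ B (M.mulVec u) u) ∧
      ((∀ μ ∈ spectrum ℂ (M.map Complex.ofReal), μ.re < 0) → ∀ u, B u u ≤ - (c * ‖u‖ ^ 2)) ∧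
      ((∃ μ ∈ spectrum ℂ (M.map Complex.ofReal), 0 < μ.re) → ∃ u, 0 < B u u) := by
  let MC : Matrix (Fin n) (Fin n) ℂ := M.map Complex.ofReal
  let A : Module.End ℂ (Fin n → ℂ) := Matrix.toLin' MC
  have hsp : ∀ μ, A.HasEigenvalue μ ↔ μ ∈ spectrum ℂ (M.map Complex.ofReal) := fun μ => by
    rw [Module.End.hasEigenvalue_iff_mem_spectrum, Matrix.spectrum_toLin']
  obtain ⟨B, c, hc, hsym, hI, hpos, hneg⟩ := exists_form n (Fin n → ℂ) (by simp) A
    (fun μ hμ => hhyp μ ((hsp μ).1 hμ))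
  let ι : (Fin n → ℝ) →ₗ[ℝ] (Fin n → ℂ) := 
    { toFun := fun u i => (u i : ℂ)
      map_add' := fun u v => by ext i; simp
      map_smul' := fun r v => by ext i; simp }
  have hι : ∀ u i, ι u i = (u i : ℂ) := fun _ _ => rfl
  have hιn : ∀ u, ‖ι u‖ = ‖u‖ := fun u => by
    simp only [Pi.norm_def, hι]
    simp
  have hιM : ∀ u, ι (M.mulVec u) = A (ι u) := fun u => by
    ext i
    simp [hι, A, MC, Matrix.mulVec, dotProduct]
  refine ⟨B.compl₁₂ ι ι, c, hc, fun u v => hsym _ _, fun u => ?_, fun h u => ?_, ?_⟩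
  · rw [LinearMap.compl₁₂_apply, hιM, ← hιn]; exact hpos (ι u)
  · rw [LinearMap.compl₁₂_apply, ← hιn]; exact hneg (fun μ hμ => h μ ((hsp μ).1 hμ)) (ι u)
  · rintro ⟨μ, hμ, hμ0⟩
    obtain ⟨v, hv⟩ := ((hsp μ).2 hμ).exists_hasEigenvector
    have key : ∀ (μ : ℂ) (v : Fin n → ℂ), 0 < μ.re → v ≠ 0 → A v = μ • v → 0 < B v v := by
      intro μ v hμ hv0 hv
      have h1 := hpos v
      have h0 : B (Complex.I • v) v = 0 := by
        have h2 := hI (Complex.I • v) v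
        rw [smul_smul, Complex.I_mul_I, neg_one_smul, map_neg, LinearMap.neg_apply, hsym v] at h2
        linarith
      have h3 : A v = μ.re • v + μ.im • (Complex.I • v) := by
        rw [hv]; ext i
        simp only [Pi.smul_apply, Pi.add_apply, smul_eq_mul, Complex.real_smul]
        nth_rewrite 1 [← Complex.re_add_im μ]; ring
      rw [h3] at h1
      simp only [map_add, LinearMap.map_smul_of_tower, LinearMap.add_apply, LinearMap.smul_apply, h0, smul_eq_mul] at h1
      have h4 : 0 < ‖v‖ := norm_pos_iff.2 hv0
      have h5 : 0 < c * ‖v‖ ^ 2 := by positivity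
      have h6 : 0 < μ.re * B v v := by linarith
      exact (mul_pos_iff_of_pos_left hμ).1 h6
    let x : Fin n → ℝ := fun i => (v i).re
    let y : Fin n → ℝ := fun i => (v i).im
    have hv1 : v = ι x + Complex.I • ι y := by
      ext i; simp [hι, x, y]; rw [mul_comm, Complex.re_add_im]
    have hAv : A v = μ • v := hv.apply_eq_smul
    let v' := ι x - Complex.I • ι y
    have hv'i : ∀ i, v' i = (starRingEnd ℂ) (v i) := fun i => by
      apply Complex.ext <;> simp [v', hι, x, y]
    have p1 := key μ v hμ0 hv.2 hAv
    have p2 : 0 < B v' v' := by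
      apply key ((starRingEnd ℂ) μ) v' (by simpa using hμ0)
      · intro h
        apply hv.2
        ext i
        have := congrFun h i
        rw [hv'i] at this
        simpa using this
      · ext i
        have := congrArg (starRingEnd ℂ) (congrFun hAv i)
        simp only [A, Matrix.toLin'_apply, Matrix.mulVec, dotProduct, Pi.smul_apply, smul_eq_mul, map_sum, map_mul] at this ⊢
        rw [hv'i, ← this]
        refine Finset.sum_congr rfl fun j _ => ?_
        rw [hv'i]
        simp [MC]
    rw [hv1] at p1
    simp only [v'] at p2
    simp only [map_add, map_sub, LinearMap.add_apply, LinearMap.sub_apply, hI] at p1 p2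
    by_contra! hcon
    have q1 := hcon x
    have q2 := hcon y
    simp only [LinearMap.compl₁₂_apply] at q1 q2
    linarith

/-- Global existence for bounded, globally Lipschitz time dependent fields. -/
lemma global_ode {E : Type*} [NormedAddCommGroup E] [NormedSpace ℝ E] [CompleteSpace E]
    (G : ℝ → E → E) (K L : NNReal) (hK : ∀ t, LipschitzWith K (G t))
    (hc : ∀ x, Continuous fun t => G t x) (hL : ∀ t x, ‖G t x‖ ≤ L) (x₀ : E) :
    ∃ z : ℝ → E, z 0 = x₀ ∧ ∀ t, HasDerivAt z (G t (z t)) t := by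
  have ex : ∀ k : ℕ, ∃ z : ℝ → E, z 0 = x₀ ∧ ∀ t ∈ Icc (-((k:ℝ) + 1)) (k + 1),
      HasDerivWithinAt z (G t (z t)) (Icc (-((k:ℝ) + 1)) (k + 1)) t := by
    intro k
    have h0 : (0:ℝ) ∈ Icc (-((k:ℝ) + 1)) (k + 1) := ⟨by linarith [k.cast_nonneg (α := ℝ)], by positivity⟩
    have hPL : IsPicardLindelof G (tmin := -((k:ℝ) + 1)) (tmax := k + 1) ⟨0, h0⟩ x₀
        (L * (k + 1)) 0 L K :=
      { lipschitzOnWith := fun t _ => (hK t).lipschitzOnWith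
        continuousOn := fun x _ => (hc x).continuousOn
        norm_le := fun t _ x _ => hL t x
        mul_max_le := by simp }
    exact hPL.exists_eq_forall_mem_Icc_hasDerivWithinAt₀
  choose z hz0 hz using ex
  have hz' : ∀ (k : ℕ), ∀ t ∈ Ioo (-((k:ℝ) + 1)) (k + 1), HasDerivAt (z k) (G t (z k t)) t :=
    fun k t ht => (hz k t (Ioo_subset_Icc_self ht)).hasDerivAt (Icc_mem_nhds ht.1 ht.2)
  have huniq : ∀ k l : ℕ, k ≤ l → EqOn (z k) (z l) (Icc (-((k:ℝ) + 1)) (k + 1)) := by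
    intro k l hkl
    have hkl' : (k:ℝ) ≤ l := by exact_mod_cast hkl
    have hsub : Icc (-((k:ℝ) + 1)) (k + 1) ⊆ Icc (-((l:ℝ) + 1)) (l + 1) :=
      Icc_subset_Icc (by linarith) (by linarith)
    refine ODE_solution_unique_of_mem_Icc (v := G) (K := K) (s := fun _ => univ) (t₀ := 0)
      (fun t _ => (hK t).lipschitzOnWith) ⟨by linarith [k.cast_nonneg (α := ℝ)], by positivity⟩
      (fun t ht => (hz k t ht).continuousWithinAt) (hz' k) (fun _ _ => mem_univ _)
      (fun t ht => ((hz l t (hsub ht)).mono hsub).continuousWithinAt)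
      (fun t ht => hz' l t ⟨by linarith [ht.1], by linarith [ht.2]⟩) (fun _ _ => mem_univ _)
      (by rw [hz0, hz0])
  let y : ℝ → E := fun t => z ⌈|t|⌉₊ t
  have hy : ∀ k : ℕ, ∀ t ∈ Ioo (-((k:ℝ) + 1)) (k + 1), y t = z k t := by
    intro k t ht
    have h1 : |t| ≤ ⌈|t|⌉₊ := Nat.le_ceil _
    have h2 := abs_le.1 h1
    rcases le_total ⌈|t|⌉₊ k with h | h
    · exact huniq _ _ h ⟨by linarith, by linarith⟩
    · exact (huniq _ _ h (Ioo_subset_Icc_self ht)).symm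
  refine ⟨y, by simp [y, hz0], fun t => ?_⟩
  have h1 : |t| ≤ ⌈|t|⌉₊ := Nat.le_ceil _
  have h2 := abs_le.1 h1
  have hmem : t ∈ Ioo (-((⌈|t|⌉₊:ℝ) + 1)) (⌈|t|⌉₊ + 1) := ⟨by linarith, by linarith⟩
  have h3 := hz' _ t hmem
  rw [hy _ t hmem]
  refine h3.congr_of_eventuallyEq ?_
  filter_upwards [Ioo_mem_nhds hmem.1 hmem.2] with s hs using hy _ s hs

/-- Coordinatewise clamp. -/
noncomputable def clampVec (n : ℕ) (ρ : ℝ) (w : Fin n → ℝ) : Fin n → ℝ :=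
  fun i => max (-ρ) (min ρ (w i))

lemma clampVec_lip (n : ℕ) (ρ : ℝ) (v w : Fin n → ℝ) :
    ‖clampVec n ρ v - clampVec n ρ w‖ ≤ ‖v - w‖ := by
  refine (pi_norm_le_iff_of_nonneg (norm_nonneg _)).2 fun i => ?_
  refine le_trans ?_ (norm_le_pi_norm (v - w) i)
  simp only [clampVec, Pi.sub_apply, Real.norm_eq_abs]
  refine (abs_max_sub_max_le_max _ _ _ _).trans ?_
  refine max_le (by simp) ?_
  refine (abs_min_sub_min_le_max _ _ _ _).trans ?_
  exact max_le (by simp) le_rfl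

lemma clampVec_norm (n : ℕ) (ρ : ℝ) (hρ : 0 ≤ ρ) (w : Fin n → ℝ) : ‖clampVec n ρ w‖ ≤ ρ := by
  refine (pi_norm_le_iff_of_nonneg hρ).2 fun i => ?_
  rw [Real.norm_eq_abs, abs_le]
  exact ⟨le_max_left _ _, max_le (by linarith) (min_le_left _ _)⟩

lemma clampVec_eq (n : ℕ) (ρ : ℝ) (w : Fin n → ℝ) (h : ‖w‖ ≤ ρ) : clampVec n ρ w = w := by
  ext i
  have := (norm_le_pi_norm w i).trans h
  rw [Real.norm_eq_abs, abs_le] at this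
  simp [clampVec, this.1, this.2]

/-- Uniformity in a periodic variable. -/
lemma periodic_unif {X F : Type*} [TopologicalSpace X] [NormedAddCommGroup F] {T : ℝ} (hT : 0 < T)
    (g : ℝ → X → F) (hg : Continuous fun p : ℝ × X => g p.1 p.2)
    (hp : ∀ t x, g (t + T) x = g t x) (x₀ : X) {η : ℝ} (hη : 0 < η) :
    ∀ᶠ x in 𝓝 x₀, ∀ t, ‖g t x - g t x₀‖ < η := by
  have h := (isCompact_Icc (a := (0:ℝ)) (b := T)).eventually_forall_of_forall_eventually
    (x₀ := x₀) (P := fun x t => ‖g t x - g t x₀‖ < η) (by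
      intro t _
      have hc : Continuous fun z : X × ℝ => ‖g z.2 z.1 - g z.2 x₀‖ := by
        have h1 : Continuous fun z : X × ℝ => g z.2 z.1 := hg.comp (continuous_snd.prodMk continuous_fst)
        have h2 : Continuous fun z : X × ℝ => g z.2 x₀ := hg.comp (continuous_snd.prodMk continuous_const)
        exact (h1.sub h2).norm
      exact (hc.tendsto (x₀, t)).eventually_lt_const (by simpa using hη))
  filter_upwards [h] with x hx t
  have hper : Function.Periodic (fun t => ‖g t x - g t x₀‖) T := fun t => by simp only [hp]
  obtain ⟨s, hs, hst⟩ := hper.exists_mem_Ico₀ hT t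
  rw [show ‖g t x - g t x₀‖ = ‖g s x - g s x₀‖ from hst]
  exact hx s (Ico_subset_Icc_self hs)

lemma periodic_bdd {F : Type*} [NormedAddCommGroup F] {T : ℝ} (hT : 0 < T)
    (g : ℝ → F) (hg : Continuous g) (hp : ∀ t, g (t + T) = g t) : ∃ p > 0, ∀ t, ‖g t‖ ≤ p := by
  obtain ⟨C, hC⟩ := (isCompact_Icc (a := (0:ℝ)) (b := T)).exists_bound_of_continuousOn hg.continuousOn
  refine ⟨max C 1, by positivity, fun t => ?_⟩
  have hper : Function.Periodic g T := hp
  obtain ⟨s, hs, hst⟩ := hper.exists_mem_Ico₀ hT t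
  rw [hst]
  exact (hC s (Ico_subset_Icc_self hs)).trans (le_max_left _ _)

/-- Partial derivative in the space variable. -/
noncomputable def dX {n : ℕ} (f : ℝ → (Fin n → ℝ) → ℝ → (Fin n → ℝ)) (t : ℝ) (x : Fin n → ℝ) (α : ℝ) :
    (Fin n → ℝ) →L[ℝ] (Fin n → ℝ) :=
  (fderiv ℝ (fun v : ℝ × (Fin n → ℝ) × ℝ => f v.1 v.2.1 v.2.2) (t, x, α)).comp
    ((ContinuousLinearMap.inr ℝ ℝ ((Fin n → ℝ) × ℝ)).comp (ContinuousLinearMap.inl ℝ (Fin n → ℝ) ℝ))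

section
variable {n : ℕ} {T : ℝ} {f : ℝ → (Fin n → ℝ) → ℝ → (Fin n → ℝ)}

lemma hasFDerivAt_dX (hf : ContDiff ℝ 2 (fun v : ℝ × (Fin n → ℝ) × ℝ => f v.1 v.2.1 v.2.2))
    (t : ℝ) (x : Fin n → ℝ) (α : ℝ) : HasFDerivAt (fun v => f t v α) (dX f t x α) x := by
  have h1 : HasFDerivAt (fun v : ℝ × (Fin n → ℝ) × ℝ => f v.1 v.2.1 v.2.2) _ (t, x, α) :=
    (hf.differentiable (by norm_num) (t, x, α)).hasFDerivAt
  have h2 : HasFDerivAt (fun v : Fin n → ℝ => ((t, v, α) : ℝ × (Fin n → ℝ) × ℝ))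
      ((ContinuousLinearMap.inr ℝ ℝ ((Fin n → ℝ) × ℝ)).comp (ContinuousLinearMap.inl ℝ (Fin n → ℝ) ℝ)) x :=
    (hasFDerivAt_prodMk_right t (x, α)).comp x (hasFDerivAt_prodMk_left x α)
  exact h1.comp x h2

lemma continuous_dX (hf : ContDiff ℝ 2 (fun v : ℝ × (Fin n → ℝ) × ℝ => f v.1 v.2.1 v.2.2)) :
    Continuous fun p : ℝ × (Fin n → ℝ) × ℝ => dX f p.1 p.2.1 p.2.2 := by
  have h := hf.continuous_fderiv (by norm_num)
  exact h.clm_comp continuous_const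

lemma dX_periodic (hf : ContDiff ℝ 2 (fun v : ℝ × (Fin n → ℝ) × ℝ => f v.1 v.2.1 v.2.2))
    (hper : ∀ t x α, f (t + T) x α = f t x α) (t : ℝ) (x : Fin n → ℝ) (α : ℝ) :
    dX f (t + T) x α = dX f t x α := by
  have h1 := hasFDerivAt_dX hf (t + T) x α
  simp only [hper] at h1
  exact h1.unique (hasFDerivAt_dX hf t x α)

lemma dX_unif (hT : 0 < T) (hf : ContDiff ℝ 2 (fun v : ℝ × (Fin n → ℝ) × ℝ => f v.1 v.2.1 v.2.2))
    (hper : ∀ t x α, f (t + T) x α = f t x α) (y : Fin n → ℝ) {η : ℝ} (hη : 0 < η) :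
    ∃ r > 0, ∀ α, |α| < r → ∀ t, ∀ v w, ‖v - y‖ < r → ‖w - y‖ < r →
      ‖f t w α - f t v α - dX f t y 0 (w - v)‖ ≤ η * ‖w - v‖ := by
  have h := periodic_unif hT (fun t (q : (Fin n → ℝ) × ℝ) => dX f t q.1 q.2) (continuous_dX hf)
    (fun t q => dX_periodic hf hper t q.1 q.2) (y, 0) hη
  obtain ⟨r, hr, hball⟩ := Metric.eventually_nhds_iff_ball.1 h
  refine ⟨r, hr, fun α hα t v w hv hw => ?_⟩
  refine (convex_ball y r).norm_image_sub_le_of_norm_hasFDerivWithin_le' (f := fun v => f t v α)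
    (f' := fun x => dX f t x α) (fun x _ => (hasFDerivAt_dX hf t x α).hasFDerivWithinAt) ?_
    (by simpa [dist_eq_norm] using hv) (by simpa [dist_eq_norm] using hw)
  intro x hx
  refine (hball (x, α) ?_ t).le
  rw [← ball_prod_same]
  exact ⟨hx, by simpa [dist_eq_norm] using hα⟩

lemma hasFDerivAt_avg (hT : 0 < T) (hf : ContDiff ℝ 2 (fun v : ℝ × (Fin n → ℝ) × ℝ => f v.1 v.2.1 v.2.2))
    (hper : ∀ t x α, f (t + T) x α = f t x α)
    (f₀ : (Fin n → ℝ) → (Fin n → ℝ))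
    (hf₀ : ∀ x, f₀ x = (1 / T) • ∫ t in (0:ℝ)..T, f t x 0) (y : Fin n → ℝ) :
    HasFDerivAt f₀ ((1 / T) • ∫ t in (0:ℝ)..T, dX f t y 0) y := by
  have e : f₀ = fun x => (1 / T) • ∫ t in (0:ℝ)..T, f t x 0 := funext hf₀
  rw [e]
  have hcd : Continuous fun t => dX f t y 0 :=
    (continuous_dX hf).comp (continuous_id.prodMk (continuous_const (y := (y, (0:ℝ)))))
  obtain ⟨p, hp, hpb⟩ := periodic_bdd hT (fun t => dX f t y 0) hcd (fun t => dX_periodic hf hper t y 0)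
  have h := periodic_unif hT (fun t (x : Fin n → ℝ) => dX f t x 0)
    ((continuous_dX hf).comp (continuous_fst.prodMk (continuous_snd.prodMk continuous_const)))
    (fun t x => dX_periodic hf hper t x 0) y one_pos
  have hfc : ∀ x, Continuous fun t => f t x 0 := fun x =>
    hf.continuous.comp (continuous_id.prodMk (continuous_const (y := (x, (0:ℝ)))))
  refine HasFDerivAt.const_smul ?_ (1 / T)
  refine intervalIntegral.hasFDerivAt_integral_of_dominated_of_fderiv_le (bound := fun _ => p + 1)
    (F := fun x t => f t x 0) (F' := fun x t => dX f t x 0) h ?_ ?_ ?_ ?_ ?_ ?_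
  · exact Eventually.of_forall fun x => (hfc x).aestronglyMeasurable
  · exact (hfc y).intervalIntegrable _ _
  · exact hcd.aestronglyMeasurable
  · refine Eventually.of_forall fun t _ x hx => ?_
    have h1 : ‖dX f t x 0 - dX f t y 0‖ < 1 := hx t
    have h2 := hpb t
    have h3 := norm_sub_norm_le (dX f t x 0) (dX f t y 0)
    linarith
  · exact intervalIntegrable_const
  · exact Eventually.of_forall fun t _ x _ => hasFDerivAt_dX hf t x 0

lemma key_estimate (hT : 0 < T)
    (hf : ContDiff ℝ 2 (fun v : ℝ × (Fin n → ℝ) × ℝ => f v.1 v.2.1 v.2.2))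
    (hper : ∀ t x α, f (t + T) x α = f t x α) (y : Fin n → ℝ)
    (A : (Fin n → ℝ) →L[ℝ] (Fin n → ℝ)) (hA : A = (1 / T) • ∫ t in (0:ℝ)..T, dX f t y 0)
    (B : (Fin n → ℝ) →L[ℝ] (Fin n → ℝ) →L[ℝ] ℝ) (hsym : ∀ u v, B u v = B v u)
    (c : ℝ) (hc : 0 < c) (hpos : ∀ u, c * ‖u‖ ^ 2 ≤ B (A u) u) :
    ∃ α₀ > 0, ∃ ρ > 0, ∃ K : NNReal, ∃ P : ℝ → ((Fin n → ℝ) →L[ℝ] (Fin n → ℝ)), P 0 = 0 ∧ Continuous P ∧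
      ∀ α ∈ Ioc 0 α₀,
        (∀ t w, ‖w‖ ≤ 2 * ‖w - α • P t w‖ ∧ ‖w - α • P t w‖ ≤ 2 * ‖w‖) ∧
        (∀ t x v w, ‖x - y‖ < ρ → ‖v‖ ≤ ρ → ‖w‖ ≤ ρ → ‖f t (x + v) α - f t (x + w) α‖ ≤ K * ‖v - w‖) ∧
        ∀ (x : Fin n → ℝ) (w : ℝ → Fin n → ℝ) (t : ℝ), ‖x - y‖ < ρ → ‖w t‖ ≤ ρ →
          HasDerivAt w (α • (f t (x + w t) α - f t x α)) t →
          ∃ d, HasDerivAt (fun s => B (w s - α • P s (w s)) (w s - α • P s (w s))) d t ∧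
            α * c * ‖w t - α • P t (w t)‖ ^ 2 ≤ d := by
  set B₀ : ℝ → ((Fin n → ℝ) →L[ℝ] (Fin n → ℝ)) := fun t => dX f t y 0 with hB₀
  have hcB : Continuous B₀ := (continuous_dX hf).comp (continuous_id.prodMk (continuous_const (y := (y, (0:ℝ)))))
  have hpB : ∀ t, B₀ (t + T) = B₀ t := fun t => dX_periodic hf hper t y 0
  obtain ⟨β, hβ, hβb⟩ := periodic_bdd hT B₀ hcB hpB
  have hcBA : Continuous fun s => B₀ s - A := hcB.sub continuous_const
  let P : ℝ → ((Fin n → ℝ) →L[ℝ] (Fin n → ℝ)) := fun t => ∫ s in (0:ℝ)..t, (B₀ s - A)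
  have hPd : ∀ t, HasDerivAt P (B₀ t - A) t := fun t => hcBA.integral_hasStrictDerivAt 0 t |>.hasDerivAt
  have hPc : Continuous P := continuous_iff_continuousAt.2 fun t => (hPd t).continuousAt
  have hPp : ∀ t, P (t + T) = P t := fun t => by
    have h1 : P (t + T) - P t = ∫ s in t..(t + T), (B₀ s - A) :=
      intervalIntegral.integral_interval_sub_left (hcBA.intervalIntegrable _ _) (hcBA.intervalIntegrable _ _)
    have hp' : Function.Periodic (fun s => B₀ s - A) T := fun s => by simp only [hpB]
    rw [hp'.intervalIntegral_add_eq t 0, zero_add, intervalIntegral.integral_sub (hcB.intervalIntegrable _ _)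
      (continuous_const.intervalIntegrable _ _), intervalIntegral.integral_const, hA, sub_zero, smul_smul,
      mul_one_div_cancel hT.ne', one_smul, sub_self] at h1
    exact sub_eq_zero.1 h1
  obtain ⟨p, hp, hpb⟩ := periodic_bdd hT P hPc hPp
  set b : ℝ := ‖B‖ + 1 with hb
  have hb0 : 0 < b := by positivity
  set η : ℝ := c / (8 * b) with hη
  have hη0 : 0 < η := by positivity
  obtain ⟨r, hr, hrb⟩ := dX_unif hT hf hper y hη0
  set M : ℝ := p * (β + η) + ‖A‖ * p with hM
  have hM0 : 0 < M := by positivity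
  set α₀ : ℝ := min (r / 2) (min (1 / (2 * p)) (η / M)) with hα₀
  refine ⟨α₀, by positivity, r / 3, by positivity, ⟨β + η, by positivity⟩, P, by simp [P], hPc, ?_⟩
  rintro α ⟨hα, hα'⟩
  have hα1 : α ≤ r / 2 := hα'.trans (min_le_left _ _)
  have hα2 : α ≤ 1 / (2 * p) := hα'.trans ((min_le_right _ _).trans (min_le_left _ _))
  have hα3 : α ≤ η / M := hα'.trans ((min_le_right _ _).trans (min_le_right _ _))
  have hαr : |α| < r := by rw [abs_of_pos hα]; linarith
  have hαp : α * p ≤ 1 / 2 := by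
    calc α * p ≤ 1 / (2 * p) * p := by gcongr
      _ = 1 / 2 := by field_simp
  have hαM : α * M ≤ η := by
    calc α * M ≤ η / M * M := by gcongr
      _ = η := by field_simp
  have hPw : ∀ t w, ‖P t w‖ ≤ p * ‖w‖ := fun t w =>
    (P t).le_of_opNorm_le (hpb t) w
  have hαPw : ∀ t w, ‖α • P t w‖ ≤ 1 / 2 * ‖w‖ := fun t w => by
    rw [norm_smul, Real.norm_eq_abs, abs_of_pos hα]
    calc α * ‖P t w‖ ≤ α * (p * ‖w‖) := by gcongr; exact hPw t w
      _ = (α * p) * ‖w‖ := by ring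
      _ ≤ 1 / 2 * ‖w‖ := by gcongr
  have hQ : ∀ t w, ‖w‖ ≤ 2 * ‖w - α • P t w‖ ∧ ‖w - α • P t w‖ ≤ 2 * ‖w‖ := fun t w => by
    have h1 := hαPw t w
    have h2 := norm_sub_norm_le w (α • P t w)
    have h3 := norm_sub_le w (α • P t w)
    have := norm_nonneg w
    constructor <;> linarith
  refine ⟨hQ, ?_, ?_⟩
  · intro t x v w hx hv hw
    have hin : ∀ v, ‖v‖ ≤ r / 3 → ‖x + v - y‖ < r := fun v hv => by
      have : x + v - y = (x - y) + v := by abel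
      rw [this]
      have := norm_add_le (x - y) v
      linarith
    have h1 := hrb α hαr t (x + w) (x + v) (hin w hw) (hin v hv)
    have e : x + v - (x + w) = v - w := by abel
    rw [e] at h1
    have h2 : ‖B₀ t (v - w)‖ ≤ β * ‖v - w‖ := (B₀ t).le_of_opNorm_le (hβb t) _
    have h3 := norm_sub_norm_le (f t (x + v) α - f t (x + w) α) (B₀ t (v - w))
    change _ ≤ (β + η) * ‖v - w‖
    have h4 : ‖f t (x + v) α - f t (x + w) α - B₀ t (v - w)‖ ≤ η * ‖v - w‖ := h1
    linarith
  · intro x w t hx hw hd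
    set F : Fin n → ℝ := f t (x + w t) α - f t x α with hF
    have h1 : ‖F - B₀ t (w t)‖ ≤ η * ‖w t‖ := by
      have h := hrb α hαr t x (x + w t) (by linarith) (by
        have : x + w t - y = (x - y) + w t := by abel
        rw [this]
        have := norm_add_le (x - y) (w t)
        linarith)
      rwa [add_sub_cancel_left] at h
    have h2 : ‖B₀ t (w t)‖ ≤ β * ‖w t‖ := (B₀ t).le_of_opNorm_le (hβb t) _
    have h3 : ‖F‖ ≤ (β + η) * ‖w t‖ := by
      have := norm_sub_norm_le F (B₀ t (w t))
      linarith
    have hPwd : HasDerivAt (fun s => P s (w s)) ((B₀ t - A) (w t) + P t (α • F)) t :=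
      (hPd t).clm_apply hd
    set u : ℝ → Fin n → ℝ := fun s => w s - α • P s (w s) with hu
    have hud : HasDerivAt u (α • F - α • ((B₀ t - A) (w t) + P t (α • F))) t :=
      hd.sub (hPwd.const_smul α)
    set Er : Fin n → ℝ := (F - B₀ t (w t)) - α • P t F + α • A (P t (w t)) with hEr
    have hu' : α • F - α • ((B₀ t - A) (w t) + P t (α • F)) = α • (A (u t) + Er) := by
      simp only [hu, hEr, map_sub, map_smul, sub_apply]
      module
    rw [hu'] at hud
    have hBd : HasDerivAt (fun s => B (u s) (u s)) (B (α • (A (u t) + Er)) (u t) + B (u t) (α • (A (u t) + Er))) t :=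
      ((B.hasFDerivAt.comp_hasDerivAt t hud)).clm_apply hud
    refine ⟨_, hBd, ?_⟩
    rw [hsym (u t), map_smul, smul_apply, map_add, add_apply, smul_eq_mul]
    change α * c * ‖u t‖ ^ 2 ≤ _
    have hE : ‖Er‖ ≤ 2 * η * ‖w t‖ := by
      have e1 : ‖α • P t F‖ ≤ α * (p * ((β + η) * ‖w t‖)) := by
        rw [norm_smul, Real.norm_eq_abs, abs_of_pos hα]
        gcongr
        exact (hPw t F).trans (by gcongr)
      have e2 : ‖α • A (P t (w t))‖ ≤ α * (‖A‖ * (p * ‖w t‖)) := by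
        rw [norm_smul, Real.norm_eq_abs, abs_of_pos hα]
        gcongr
        exact (A.le_opNorm _).trans (by gcongr; exact hPw t _)
      have e3 := norm_add_le ((F - B₀ t (w t)) - α • P t F) (α • A (P t (w t)))
      have e4 := norm_sub_le (F - B₀ t (w t)) (α • P t F)
      have e5 : α * (p * ((β + η) * ‖w t‖)) + α * (‖A‖ * (p * ‖w t‖)) = α * M * ‖w t‖ := by
        rw [hM]; ring
      have e6 : α * M * ‖w t‖ ≤ η * ‖w t‖ := by gcongr
      rw [← hEr] at e3
      linarith
    have hE' : ‖Er‖ ≤ 4 * η * ‖u t‖ := by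
      have := (hQ t (w t)).1
      change ‖w t‖ ≤ 2 * ‖u t‖ at this
      nlinarith
    have hBE : |B Er (u t)| ≤ c / 2 * ‖u t‖ ^ 2 := by
      have g1 : |B Er (u t)| ≤ ‖B‖ * ‖Er‖ * ‖u t‖ := B.le_opNorm₂ Er (u t)
      have g2 : ‖B‖ * ‖Er‖ * ‖u t‖ ≤ b * (4 * η * ‖u t‖) * ‖u t‖ := by
        gcongr
        rw [hb]; linarith
      have g3 : b * (4 * η * ‖u t‖) * ‖u t‖ = c / 2 * ‖u t‖ ^ 2 := by
        rw [hη]; field_simp; ring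
      linarith
    have hAp := hpos (u t)
    have hBE' := (abs_le.1 hBE).1
    have : c / 2 * ‖u t‖ ^ 2 ≤ B (A (u t)) (u t) + B Er (u t) := by linarith
    have := mul_le_mul_of_nonneg_left this hα.le
    linarith
end

lemma growth {V : ℝ → ℝ} {k τ : ℝ} (hτ : 0 ≤ τ) (hc : ContinuousOn V (Icc 0 τ))
    (hd : ∀ t ∈ Ioo 0 τ, ∃ d, HasDerivAt V d t ∧ k * V t ≤ d) :
    V 0 * Real.exp (k * τ) ≤ V τ := by
  have hder : ∀ t ∈ Ioo 0 τ, ∃ d, HasDerivAt (fun t => V t * Real.exp (-(k * t))) d t ∧ 0 ≤ d := by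
    intro t ht
    obtain ⟨d, hd1, hd2⟩ := hd t ht
    have he : HasDerivAt (fun t => Real.exp (-(k * t))) (Real.exp (-(k * t)) * (-(k * 1))) t :=
      (((hasDerivAt_id t).const_mul k).neg).exp
    refine ⟨_, hd1.mul he, ?_⟩
    have h := mul_nonneg (sub_nonneg.2 hd2) (Real.exp_pos (-(k * t))).le
    linarith
  have hmono : MonotoneOn (fun t => V t * Real.exp (-(k * t))) (Icc 0 τ) := by
    refine monotoneOn_of_deriv_nonneg (convex_Icc 0 τ) (hc.mul (by fun_prop)) ?_ ?_
    · rw [interior_Icc]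
      intro t ht
      obtain ⟨d, h1, _⟩ := hder t ht
      exact h1.differentiableAt.differentiableWithinAt
    · rw [interior_Icc]
      intro t ht
      obtain ⟨d, h1, h2⟩ := hder t ht
      rwa [h1.deriv]
  have h := hmono (left_mem_Icc.2 hτ) (right_mem_Icc.2 hτ) hτ
  simp only [mul_zero, neg_zero, Real.exp_zero, mul_one] at h
  calc V 0 * Real.exp (k * τ) ≤ V τ * Real.exp (-(k * τ)) * Real.exp (k * τ) := by gcongr
    _ = V τ := by rw [mul_assoc, ← Real.exp_add]; simp

lemma jac_mulVec (n : ℕ) (G : (Fin n → ℝ) → (Fin n → ℝ)) (x u : Fin n → ℝ) :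
    (jacobianMatrix n G x).mulVec u = fderiv ℝ G x u := by
  have h : jacobianMatrix n G x = LinearMap.toMatrix' (fderiv ℝ G x : (Fin n → ℝ) →ₗ[ℝ] (Fin n → ℝ)) := by
    ext i j
    rw [LinearMap.toMatrix'_apply]
    rfl
  rw [h, LinearMap.toMatrix'_mulVec]
  rfl

/-- A priori estimate in the stable case. -/
lemma decay {E : Type*} [NormedAddCommGroup E] [NormedSpace ℝ E]
    (B : E →L[ℝ] E →L[ℝ] ℝ) (c b α ρ : ℝ) (hc : 0 < c) (hb : 0 < b) (hα : 0 < α) (hρ : 0 < ρ)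
    (hbB : ∀ u, |B u u| ≤ b * ‖u‖ ^ 2)
    (hneg : ∀ u, B u u ≤ -(c * ‖u‖ ^ 2))
    (P : ℝ → (E →L[ℝ] E)) (hP0 : P 0 = 0) (hPc : Continuous P)
    (hQ : ∀ t w, ‖w‖ ≤ 2 * ‖w - α • P t w‖)
    (w : ℝ → E) (hw : ContinuousOn w (Ici 0))
    (hd : ∀ t, 0 ≤ t → ‖w t‖ ≤ ρ →
      ∃ d, HasDerivAt (fun s => B (w s - α • P s (w s)) (w s - α • P s (w s))) d t ∧
            α * c * ‖w t - α • P t (w t)‖ ^ 2 ≤ d)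
    (h0 : (1 + 4 * b / c) * ‖w 0‖ < ρ) :
    ∀ t, 0 ≤ t → ‖w t‖ ≤ ρ ∧ ‖w t‖ ^ 2 ≤ 4 * b / c * ‖w 0‖ ^ 2 * Real.exp (-(α * c / b) * t) := by
  have step : ∀ τ, 0 ≤ τ → (∀ s ∈ Ioo 0 τ, ‖w s‖ ≤ ρ) →
      ‖w τ‖ ^ 2 ≤ 4 * b / c * ‖w 0‖ ^ 2 * Real.exp (-(α * c / b) * τ) := by
    intro τ hτ hs
    have hwc : ContinuousOn w (Icc 0 τ) := hw.mono Icc_subset_Ici_self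
    have huc : ContinuousOn (fun s => w s - α • P s (w s)) (Icc 0 τ) :=
      hwc.sub ((hPc.continuousOn.clm_apply hwc).const_smul α)
    have hg := growth (V := fun s => B (w s - α • P s (w s)) (w s - α • P s (w s)))
      (k := -(α * c / b)) hτ
      ((B.continuous.comp_continuousOn huc).clm_apply huc) (by
        intro t ht
        obtain ⟨d, h1, h2⟩ := hd t ht.1.le (hs t ht)
        refine ⟨d, h1, le_trans ?_ h2⟩
        have h3 := (abs_le.1 (hbB (w t - α • P t (w t)))).1
        have h4 : α * c / b * -(B (w t - α • P t (w t)) (w t - α • P t (w t))) ≤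
          α * c / b * (b * ‖w t - α • P t (w t)‖ ^ 2) := by gcongr; linarith
        have h5 : α * c / b * (b * ‖w t - α • P t (w t)‖ ^ 2) = α * c * ‖w t - α • P t (w t)‖ ^ 2 := by
          field_simp
        linarith)
    simp only [hP0, zero_apply, smul_zero, sub_zero] at hg
    have h1 := hneg (w τ - α • P τ (w τ))
    have h2 := (abs_le.1 (hbB (w 0))).1
    have h3 := hQ τ (w τ)
    set e := Real.exp (-(α * c / b) * τ)
    have he : 0 < e := Real.exp_pos _
    have h4 : -(b * ‖w 0‖ ^ 2) * e ≤ B (w 0) (w 0) * e := by gcongr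
    have h5 : c * ‖w τ - α • P τ (w τ)‖ ^ 2 ≤ b * ‖w 0‖ ^ 2 * e := by linarith
    calc ‖w τ‖ ^ 2 ≤ (2 * ‖w τ - α • P τ (w τ)‖) ^ 2 := by gcongr
      _ = 4 / c * (c * ‖w τ - α • P τ (w τ)‖ ^ 2) := by field_simp; ring
      _ ≤ 4 / c * (b * ‖w 0‖ ^ 2 * e) := by gcongr
      _ = _ := by ring
  have step2 : ∀ τ, 0 ≤ τ → (∀ s ∈ Ioo 0 τ, ‖w s‖ ≤ ρ) → ‖w τ‖ < ρ := by
    intro τ hτ hs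
    have h := step τ hτ hs
    have h1 : Real.exp (-(α * c / b) * τ) ≤ 1 := by
      rw [Real.exp_le_one_iff]
      have : 0 ≤ α * c / b * τ := by positivity
      linarith
    have h2 : 4 * b / c * ‖w 0‖ ^ 2 * Real.exp (-(α * c / b) * τ) ≤ 4 * b / c * ‖w 0‖ ^ 2 * 1 := by gcongr
    have h3 : 0 < 4 * b / c := by positivity
    have h4 : 4 * b / c * ‖w 0‖ ^ 2 ≤ ((1 + 4 * b / c) * ‖w 0‖) ^ 2 := by
      rw [mul_pow]
      gcongr
      nlinarith
    have h5 : ((1 + 4 * b / c) * ‖w 0‖) ^ 2 < ρ ^ 2 := by gcongr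
    have h6 : ‖w τ‖ ^ 2 < ρ ^ 2 := by linarith
    exact lt_of_pow_lt_pow_left₀ 2 hρ.le h6
  have hall : ∀ t, 0 ≤ t → ‖w t‖ < ρ := by
    by_contra! hcon
    obtain ⟨t₁, ht₁, hbad⟩ := hcon
    let S := Icc 0 t₁ ∩ {t | ρ ≤ ‖w t‖}
    have hSc : IsClosed S :=
      ContinuousOn.preimage_isClosed_of_isClosed (hw.mono Icc_subset_Ici_self).norm isClosed_Icc
        (isClosed_Ici (a := ρ))
    have hSn : S.Nonempty := ⟨t₁, ⟨ht₁, le_rfl⟩, hbad⟩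
    have hSb : BddBelow S := ⟨0, fun s hs => hs.1.1⟩
    have hm := hSc.csInf_mem hSn hSb
    refine absurd (step2 _ hm.1.1 fun s hs => ?_) (not_lt.2 hm.2)
    by_contra! hlt
    exact absurd (csInf_le hSb (show s ∈ S from ⟨⟨hs.1.le, hs.2.le.trans hm.1.2⟩, hlt.le⟩)) (not_le.2 hs.2)
  exact fun t ht => ⟨(hall t ht).le, step t ht fun s hs => (hall s hs.1.le).le⟩

/-- Stability of the `T`-periodic solution of `x' = α f(t,x,α)` near a
hyperbolic equilibrium `y*` of the averaged system: if all eigenvalues of `D f₀(y*)`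
have negative real part the periodic solution is asymptotically stable for small
`α > 0`; if some eigenvalue has positive real part it is unstable. -/
theorem averaging_periodic_solution_stability
    (n : ℕ) (hn : 1 ≤ n) (T : ℝ) (hT : 0 < T)
    (f : ℝ → (Fin n → ℝ) → ℝ → (Fin n → ℝ))
    (hf : ContDiff ℝ 2 (fun v : ℝ × (Fin n → ℝ) × ℝ => f v.1 v.2.1 v.2.2))
    (hper : ∀ t x α, f (t + T) x α = f t x α)
    (f₀ : (Fin n → ℝ) → (Fin n → ℝ))
    (hf₀ : ∀ x, f₀ x = (1 / T) • ∫ t in (0:ℝ)..T, f t x 0)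
    (ystar : Fin n → ℝ)
    (heq : f₀ ystar = 0)
    (hhyp : ∀ μ ∈ spectrum ℂ ((jacobianMatrix n f₀ ystar).map Complex.ofReal),
      μ.re ≠ 0) :
    ((∀ μ ∈ spectrum ℂ ((jacobianMatrix n f₀ ystar).map Complex.ofReal), μ.re < 0) →
      ∃ α₀ > (0 : ℝ), ∃ N : Set (Fin n → ℝ), IsOpen N ∧ ystar ∈ N ∧
        ∀ α ∈ Ioc (0:ℝ) α₀, ∀ x : ℝ → Fin n → ℝ,
          (∀ t, HasDerivAt x (α • f t (x t) α) t) →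
          (∀ t, x (t + T) = x t) →
          (∀ t, x t ∈ N) →
          IsAsympStableSol n (fun t v => α • f t v α) x) ∧
    ((∃ μ ∈ spectrum ℂ ((jacobianMatrix n f₀ ystar).map Complex.ofReal), 0 < μ.re) →
      ∃ α₀ > (0 : ℝ), ∃ N : Set (Fin n → ℝ), IsOpen N ∧ ystar ∈ N ∧
        ∀ α ∈ Ioc (0:ℝ) α₀, ∀ x : ℝ → Fin n → ℝ,
          (∀ t, HasDerivAt x (α • f t (x t) α) t) →
          (∀ t, x (t + T) = x t) →
          (∀ t, x t ∈ N) →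
          ¬ IsLyapStableSol n (fun t v => α • f t v α) x) := by
  
  classical
  obtain ⟨B', c, hc, hsym', hpos', hneg', hun'⟩ :=
    exists_real_form n (jacobianMatrix n f₀ ystar) hhyp
  let B : (Fin n → ℝ) →L[ℝ] (Fin n → ℝ) →L[ℝ] ℝ :=
    LinearMap.toContinuousLinearMap
      ((LinearMap.toContinuousLinearMap :
        ((Fin n → ℝ) →ₗ[ℝ] ℝ) ≃ₗ[ℝ] ((Fin n → ℝ) →L[ℝ] ℝ)).toLinearMap ∘ₗ B')
  have hBB : ∀ u v, B u v = B' u v := fun u v => rfl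
  have hder := hasFDerivAt_avg hT hf hper f₀ hf₀ ystar
  obtain ⟨α₀, hα₀, ρ, hρ, K, P, hP0, hPc, key⟩ :=
    key_estimate hT hf hper ystar (fderiv ℝ f₀ ystar) hder.fderiv B
      (fun u v => by rw [hBB, hBB, hsym']) c hc
      (fun u => by rw [hBB, ← jac_mulVec]; exact hpos' u)
  set b : ℝ := ‖B‖ + 1 with hb
  have hb0 : 0 < b := by positivity
  have hbB : ∀ u, |B u u| ≤ b * ‖u‖ ^ 2 := fun u => by
    have h : |B u u| ≤ ‖B‖ * ‖u‖ * ‖u‖ := B.le_opNorm₂ u u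
    have := sq_nonneg ‖u‖
    rw [hb]; linarith
  have hfcont := hf.continuous
  refine ⟨fun hst => ⟨α₀, hα₀, Metric.ball ystar ρ, Metric.isOpen_ball, Metric.mem_ball_self hρ, ?_⟩,
    fun hun => ⟨α₀, hα₀, Metric.ball ystar ρ, Metric.isOpen_ball, Metric.mem_ball_self hρ, ?_⟩⟩
  · intro α hα x hx _ hxN
    obtain ⟨hQ, hLip, hD⟩ := key α hα
    have hα0 : 0 < α := hα.1
    have hxN' : ∀ t, ‖x t - ystar‖ < ρ := fun t => by
      have := hxN t
      rwa [Metric.mem_ball, dist_eq_norm] at this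
    have hxc : Continuous x := continuous_iff_continuousAt.2 fun t => (hx t).continuousAt
    have hneg : ∀ u, B u u ≤ -(c * ‖u‖ ^ 2) := fun u => hneg' hst u
    have hC0 : 0 < 1 + 4 * b / c := by positivity
    -- the general estimate
    have main : ∀ w : ℝ → Fin n → ℝ, ContinuousOn w (Ici 0) →
        (∀ t, 0 ≤ t → ‖w t‖ ≤ ρ → HasDerivAt w (α • (f t (x t + w t) α - f t (x t) α)) t) →
        (1 + 4 * b / c) * ‖w 0‖ < ρ →
        ∀ t, 0 ≤ t → ‖w t‖ ≤ ρ ∧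
          ‖w t‖ ^ 2 ≤ 4 * b / c * ‖w 0‖ ^ 2 * Real.exp (-(α * c / b) * t) := by
      intro w hwc hw h0
      exact decay B c b α ρ hc hb0 hα0 hρ hbB hneg P hP0 hPc (fun t w => (hQ t w).1) w hwc
        (fun t ht htw => hD (x t) w t (hxN' t) htw (hw t ht htw)) h0
    intro ε hε
    refine ⟨min ε ρ / (1 + 4 * b / c), by positivity, fun x₀ hx₀ => ?_⟩
    rw [lt_div_iff₀ hC0, mul_comm] at hx₀
    have hx₀ρ : (1 + 4 * b / c) * ‖x₀ - x 0‖ < ρ := hx₀.trans_le (min_le_right _ _)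
    have hx₀ε : (1 + 4 * b / c) * ‖x₀ - x 0‖ < ε := hx₀.trans_le (min_le_left _ _)
    refine ⟨?_, ?_⟩
    · let G : ℝ → (Fin n → ℝ) → (Fin n → ℝ) :=
        fun t w => α • (f t (x t + clampVec n ρ w) α - f t (x t) α)
      have hG : ∀ t v w, ‖G t v - G t w‖ ≤ α * (K * ‖v - w‖) := fun t v w => by
        have e : G t v - G t w = α • (f t (x t + clampVec n ρ v) α - f t (x t + clampVec n ρ w) α) := by
          simp only [G]; module
        rw [e, norm_smul, Real.norm_eq_abs, abs_of_pos hα0]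
        gcongr
        refine (hLip t (x t) _ _ (hxN' t) (clampVec_norm n ρ hρ.le v) (clampVec_norm n ρ hρ.le w)).trans ?_
        gcongr
        exact clampVec_lip n ρ v w
      obtain ⟨w, hw0, hw⟩ := global_ode G (⟨α, hα0.le⟩ * K) (⟨α, hα0.le⟩ * (K * ⟨ρ, hρ.le⟩))
        (fun t => LipschitzWith.of_dist_le_mul fun v w => by
          rw [dist_eq_norm, dist_eq_norm]
          refine (hG t v w).trans (le_of_eq ?_)
          exact (mul_assoc α (K : ℝ) ‖v - w‖).symm)
        (fun w => by
          have h1 : Continuous fun t => f t (x t + clampVec n ρ w) α :=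
            hfcont.comp (continuous_id.prodMk ((hxc.add continuous_const).prodMk continuous_const))
          have h2 : Continuous fun t => f t (x t) α :=
            hfcont.comp (continuous_id.prodMk (hxc.prodMk continuous_const))
          exact (h1.sub h2).const_smul α)
        (fun t w => by
          have h := hLip t (x t) (clampVec n ρ w) 0 (hxN' t) (clampVec_norm n ρ hρ.le w)
            (by simpa using hρ.le)
          rw [add_zero, sub_zero] at h
          change ‖α • (f t (x t + clampVec n ρ w) α - f t (x t) α)‖ ≤ α * (K * ρ)
          rw [norm_smul, Real.norm_eq_abs, abs_of_pos hα0]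
          gcongr
          refine h.trans ?_
          gcongr
          exact clampVec_norm n ρ hρ.le w)
        (x₀ - x 0)
      have hest := main w (fun t _ => (hw t).continuousAt.continuousWithinAt)
        (fun t _ htw => by
          have := hw t
          simp only [G] at this
          rwa [clampVec_eq n ρ _ htw] at this) (by rwa [hw0])
      refine ⟨fun t => x t + w t, by simp [hw0], fun t ht => ?_⟩
      have h1 := (hx t).add (hw t)
      simp only [G] at h1
      rw [clampVec_eq n ρ _ (hest t ht).1] at h1
      have e : α • f t (x t) α + α • (f t (x t + w t) α - f t (x t) α) = α • f t (x t + w t) α := by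
        module
      rw [e] at h1
      exact h1
    · intro z hz0 hz
      let w : ℝ → Fin n → ℝ := fun t => z t - x t
      have hw : ∀ t, 0 ≤ t → HasDerivAt w (α • (f t (x t + w t) α - f t (x t) α)) t := by
        intro t ht
        have h1 := (hz t ht).sub (hx t)
        have e : x t + w t = z t := by simp [w]
        rw [e, smul_sub]
        exact h1
      have hw0 : w 0 = x₀ - x 0 := by simp [w, hz0]
      have hest := main w (fun t ht => (hw t ht).continuousAt.continuousWithinAt)
        (fun t ht _ => hw t ht) (by rwa [hw0])
      have hk : 0 < α * c / b := by positivity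
      refine ⟨fun t ht => ?_, ?_⟩
      · have h := (hest t ht).2
        rw [hw0] at h
        have h1 : Real.exp (-(α * c / b) * t) ≤ 1 := by
          rw [Real.exp_le_one_iff]
          have : 0 ≤ α * c / b * t := by positivity
          linarith
        have h2 : 4 * b / c * ‖x₀ - x 0‖ ^ 2 * Real.exp (-(α * c / b) * t) ≤
          4 * b / c * ‖x₀ - x 0‖ ^ 2 * 1 := by gcongr
        have h3 : 0 < 4 * b / c := by positivity
        have h4 : 4 * b / c * ‖x₀ - x 0‖ ^ 2 ≤ ((1 + 4 * b / c) * ‖x₀ - x 0‖) ^ 2 := by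
          rw [mul_pow]
          gcongr
          nlinarith
        have h5 : ((1 + 4 * b / c) * ‖x₀ - x 0‖) ^ 2 < ε ^ 2 := by gcongr
        have h6 : ‖w t‖ ^ 2 < ε ^ 2 := by linarith
        exact lt_of_pow_lt_pow_left₀ 2 hε.le h6
      · have ht1 : Tendsto (fun t : ℝ => 4 * b / c * ‖w 0‖ ^ 2 * Real.exp (-(α * c / b) * t)) atTop (𝓝 0) := by
          have h1 : Tendsto (fun t : ℝ => -(α * c / b) * t) atTop atBot :=
            tendsto_id.const_mul_atTop_of_neg (by linarith)
          have h2 := (Real.tendsto_exp_atBot.comp h1).const_mul (4 * b / c * ‖w 0‖ ^ 2)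
          simpa using h2
        have ht2 : Tendsto (fun t => ‖w t‖ ^ 2) atTop (𝓝 0) := by
          refine squeeze_zero' (Eventually.of_forall fun t => by positivity) ?_ ht1
          filter_upwards [eventually_ge_atTop 0] with t ht using (hest t ht).2
        have ht3 := ht2.sqrt
        simpa [Real.sqrt_sq (norm_nonneg _), w] using ht3
  · intro α hα x hx _ hxN hstab
    obtain ⟨hQ, _, hD⟩ := key α hα
    have hα0 : 0 < α := hα.1
    have hxN' : ∀ t, ‖x t - ystar‖ < ρ := fun t => by
      have := hxN t
      rwa [Metric.mem_ball, dist_eq_norm] at this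
    obtain ⟨u, hu⟩ := hun' hun
    obtain ⟨δ, hδ, hs⟩ := hstab ρ hρ
    set r : ℝ := δ / (2 * (‖u‖ + 1)) with hr
    have hr0 : 0 < r := by positivity
    have hru : ‖r • u‖ < δ := by
      rw [norm_smul, Real.norm_eq_abs, abs_of_pos hr0]
      calc r * ‖u‖ ≤ r * (‖u‖ + 1) := by gcongr; linarith
        _ = δ / 2 := by rw [hr]; field_simp
        _ < δ := by linarith
    obtain ⟨⟨z, hz0, hz⟩, hbd⟩ := hs (x 0 + r • u) (by simpa using hru)
    have hzb := hbd z hz0 hz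
    let w : ℝ → Fin n → ℝ := fun t => z t - x t
    have hw : ∀ t, 0 ≤ t → HasDerivAt w (α • (f t (x t + w t) α - f t (x t) α)) t := by
      intro t ht
      have h1 := (hz t ht).sub (hx t)
      have e : x t + w t = z t := by simp [w]
      rw [e, smul_sub]
      exact h1
    have hw0 : w 0 = r • u := by simp [w, hz0]
    have hV0 : 0 < B (w 0) (w 0) := by
      rw [hw0, map_smul, map_smul, smul_apply, smul_eq_mul, smul_eq_mul, hBB]
      positivity
    set k : ℝ := α * c / b with hk
    have hk0 : 0 < k := by positivity
    have hgrow : ∀ τ, 0 ≤ τ → B (w 0) (w 0) * Real.exp (k * τ) ≤ b * (2 * ρ) ^ 2 := by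
      intro τ hτ
      have hwc : ContinuousOn w (Icc 0 τ) := fun t ht => (hw t ht.1).continuousAt.continuousWithinAt
      have huc : ContinuousOn (fun s => w s - α • P s (w s)) (Icc 0 τ) :=
        hwc.sub ((hPc.continuousOn.clm_apply hwc).const_smul α)
      have hg := growth (V := fun s => B (w s - α • P s (w s)) (w s - α • P s (w s)))
        (k := k) hτ ((B.continuous.comp_continuousOn huc).clm_apply huc) (by
          intro t ht
          obtain ⟨d, h1, h2⟩ := hD (x t) w t (hxN' t) (hzb t ht.1.le).le (hw t ht.1.le)
          refine ⟨d, h1, le_trans ?_ h2⟩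
          have h3 := (abs_le.1 (hbB (w t - α • P t (w t)))).2
          have h4 : k * (B (w t - α • P t (w t)) (w t - α • P t (w t))) ≤
            k * (b * ‖w t - α • P t (w t)‖ ^ 2) := by gcongr
          have h5 : k * (b * ‖w t - α • P t (w t)‖ ^ 2) = α * c * ‖w t - α • P t (w t)‖ ^ 2 := by
            rw [hk]; field_simp
          linarith)
      simp only [hP0, zero_apply, smul_zero, sub_zero] at hg
      refine hg.trans ((le_abs_self _).trans ((hbB _).trans ?_))
      gcongr
      refine (hQ τ (w τ)).2.trans ?_
      gcongr
      exact (hzb τ hτ).le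
    have htop : Tendsto (fun τ : ℝ => B (w 0) (w 0) * Real.exp (k * τ)) atTop atTop :=
      (Real.tendsto_exp_atTop.comp (tendsto_id.const_mul_atTop hk0)).const_mul_atTop hV0
    obtain ⟨τ, hτ1, hτ2⟩ := ((htop.eventually_gt_atTop (b * (2 * ρ) ^ 2)).and
      (eventually_ge_atTop 0)).exists
    exact absurd (hgrow τ hτ2) (not_le.2 hτ1)
end

section
/- Consider the two-predator one-prey system S' = γS(1 − S/k) − (x₁ + ρx₂)·m₁S/(a+S), x₁' = β₁x₁(S−λ)/(a+S), x₂' = ρβ₁x₂(S−λ)/(a+S), with constants γ, k, m₁, β₁, a, λ > 0, ρ ≥ 1, c > 0. If (S, x₁, x₂) : I → ℝ³ is a solution on an interval I with S(t) > −a and x₁(t) > 0 for all t ∈ I, and x₂(t₀) = c·x₁(t₀)^ρ for some t₀ ∈ I, then x₂(t) = c·x₁(t)^ρ for all t ∈ I; i.e., the surface { x₂ = c x₁^ρ } is invariant under the flow. -/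
open Set Filter

/-- In the two-predator one-prey model, the surface
`x₂ = c x₁^ρ` is invariant: a solution touching it at one time lies on it for
all time in its interval of definition. -/
theorem invariant_surface_two_predators
    (γ k m₁ β₁ a lam ρ c : ℝ)
    (hγ : 0 < γ) (hk : 0 < k) (hm₁ : 0 < m₁) (hβ₁ : 0 < β₁) (ha : 0 < a)
    (hlam : 0 < lam) (hρ : 1 ≤ ρ) (hc : 0 < c)
    (I : Set ℝ) (hI : I.OrdConnected)
    (S x₁ x₂ : ℝ → ℝ)
    (hS : ∀ t ∈ I, HasDerivAt S
      (γ * S t * (1 - S t / k) - (x₁ t + ρ * x₂ t) * (m₁ * S t / (a + S t))) t)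
    (hx₁ : ∀ t ∈ I, HasDerivAt x₁ (β₁ * x₁ t * ((S t - lam) / (a + S t))) t)
    (hx₂ : ∀ t ∈ I, HasDerivAt x₂ (ρ * β₁ * x₂ t * ((S t - lam) / (a + S t))) t)
    (hSbound : ∀ t ∈ I, -a < S t)
    (hx₁pos : ∀ t ∈ I, 0 < x₁ t)
    (t₀ : ℝ) (ht₀ : t₀ ∈ I)
    (hinit : x₂ t₀ = c * x₁ t₀ ^ ρ) :
    ∀ t ∈ I, x₂ t = c * x₁ t ^ ρ := by
  have key : ∀ t ∈ I, HasDerivWithinAt (fun s => x₂ s * x₁ s ^ (-ρ)) 0 I t := by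
    intro t ht
    have hp := hx₁pos t ht
    have h1 := (hx₁ t ht).rpow_const (p := -ρ) (Or.inl hp.ne')
    have h2 := (hx₂ t ht).mul h1
    have e : x₁ t ^ (-ρ) = x₁ t ^ (-ρ - 1) * x₁ t := by
      rw [Real.rpow_sub_one hp.ne']
      field_simp
    refine HasDerivAt.hasDerivWithinAt ?_
    refine h2.congr_deriv ?_
    rw [e]
    ring
  intro t ht
  have h := hI.convex.norm_image_sub_le_of_norm_hasDerivWithin_le (C := 0) key
    (fun x _ => by simp) ht₀ ht
  rw [zero_mul] at h
  have h3 := sub_eq_zero.mp (norm_le_zero_iff.mp h)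
  have c1 : ∀ s ∈ I, x₁ s ^ ρ * x₁ s ^ (-ρ) = 1 := by
    intro s hs
    rw [← Real.rpow_add (hx₁pos s hs), add_neg_cancel, Real.rpow_zero]
  have c0 := c1 t₀ ht₀
  have c2 := c1 t ht
  simp only [hinit] at h3
  rw [mul_assoc, c0, mul_one] at h3
  calc x₂ t = x₂ t * (x₁ t ^ ρ * x₁ t ^ (-ρ)) := by rw [c2, mul_one]
    _ = (x₂ t * x₁ t ^ (-ρ)) * x₁ t ^ ρ := by ring
    _ = c * x₁ t ^ ρ := by rw [h3]
end

section
/- Consider the planar system S' = γS(1 − S/k) − (x₁ + ρcx₁^ρ)·m₁S/(a+S), x₁' = β₁x₁(S−λ)/(a+S), with constants γ, m₁, β₁, a > 0, ρ ≥ 1, c > 0, 0 < λ < k, and let (λ, ξ₁) be its interior equilibrium, where ξ₁ > 0 satisfies ξ₁ + ρcξ₁^ρ = γ(a+λ)(k−λ)/(m₁k). Then: (i) if λ < k < a + 2λ, both eigenvalues of the Jacobian matrix of the system at (λ, ξ₁) have negative real part, so (λ, ξ₁) is asymptotically stable; (ii) if k > a + 2λ, at least one eigenvalue of the Jacobian at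 (λ, ξ₁) has positive real part, so (λ, ξ₁) is unstable. -/
open Set Filter Topology

/-- The vector field of the reduced planar two-predator one-prey system (6.4). -/
noncomputable def planarField (γ k m₁ β₁ a lam ρ c : ℝ) : ℝ × ℝ → ℝ × ℝ :=
  fun v =>
    (γ * v.1 * (1 - v.1 / k) - (v.2 + ρ * c * v.2 ^ ρ) * (m₁ * v.1 / (a + v.1)),
     β₁ * v.2 * ((v.1 - lam) / (a + v.1)))

/-- The Jacobian matrix of a planar map at a point. -/
noncomputable def planarJacobian (f : ℝ × ℝ → ℝ × ℝ) (v : ℝ × ℝ) :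
    Matrix (Fin 2) (Fin 2) ℝ :=
  !![(fderiv ℝ f v (1, 0)).1, (fderiv ℝ f v (0, 1)).1;
     (fderiv ℝ f v (1, 0)).2, (fderiv ℝ f v (0, 1)).2]

/-- Lyapunov stability of an equilibrium `v₀` of the autonomous system `z' = f(z)`. -/
def IsLyapStableEq (f : ℝ × ℝ → ℝ × ℝ) (v₀ : ℝ × ℝ) : Prop :=
  ∀ ε > 0, ∃ δ > 0, ∀ z : ℝ → ℝ × ℝ,
    (∀ t, 0 ≤ t → HasDerivAt z (f (z t)) t) → ‖z 0 - v₀‖ < δ →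
    ∀ t, 0 ≤ t → ‖z t - v₀‖ < ε

/-- Asymptotic stability of an equilibrium `v₀` of `z' = f(z)`. -/
def IsAsympStableEq (f : ℝ × ℝ → ℝ × ℝ) (v₀ : ℝ × ℝ) : Prop :=
  IsLyapStableEq f v₀ ∧ ∃ δ > 0, ∀ z : ℝ → ℝ × ℝ,
    (∀ t, 0 ≤ t → HasDerivAt z (f (z t)) t) → ‖z 0 - v₀‖ < δ →
    Filter.Tendsto z Filter.atTop (𝓝 v₀)


theorem aux_exists_global {F : ℝ × ℝ → ℝ × ℝ} {K L : NNReal} (hK : LipschitzWith K F)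
    (hL : ∀ v, ‖F v‖ ≤ L) (x₀ : ℝ × ℝ) :
    ∃ z : ℝ → ℝ × ℝ, z 0 = x₀ ∧ ∀ t, HasDerivAt z (F (z t)) t := by
  have h1 : ∀ n : ℕ, ∃ α : ℝ → ℝ × ℝ, α 0 = x₀ ∧
      ∀ t ∈ Ioo (-((n : ℝ) + 1)) ((n : ℝ) + 1), HasDerivAt α (F (α t)) t := by
    intro n
    have hn : (0 : ℝ) ≤ (n : ℝ) + 1 := by positivity
    have h0 : (0 : ℝ) ∈ Icc (-((n : ℝ) + 1)) ((n : ℝ) + 1) := ⟨by linarith, hn⟩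
    have hp : IsPicardLindelof (fun _ ↦ F) (⟨0, h0⟩ : Icc (-((n : ℝ) + 1)) ((n : ℝ) + 1)) x₀
        (L * ((n : NNReal) + 1)) 0 L K := by
      apply IsPicardLindelof.of_time_independent
      · intro x _; exact hL x
      · exact hK.lipschitzOnWith
      · simp
    obtain ⟨α, ha, hb⟩ := hp.exists_eq_forall_mem_Icc_hasDerivWithinAt₀
    exact ⟨α, ha, fun t ht => (hb t (Ioo_subset_Icc_self ht)).hasDerivAt (Icc_mem_nhds ht.1 ht.2)⟩
  choose α hα0 hα using h1
  have h2 : ∀ i j : ℕ, i ≤ j → ∀ s ∈ Ioo (-((i : ℝ) + 1)) ((i : ℝ) + 1), α i s = α j s := by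
    intro i j hij
    have hij' : (i : ℝ) ≤ j := by exact_mod_cast hij
    have hn : (0 : ℝ) < (i : ℝ) + 1 := by positivity
    refine ODE_solution_unique_of_mem_Ioo (v := fun _ => F) (s := fun _ => univ) (K := K)
      (t₀ := 0) (fun t _ => hK.lipschitzOnWith) ⟨by linarith, hn⟩
      (fun t ht => ⟨hα i t ht, trivial⟩) (fun t ht => ⟨hα j t ⟨?_, ?_⟩, trivial⟩) ?_
    · linarith [ht.1]
    · linarith [ht.2]
    · rw [hα0, hα0]
  have h3 : ∀ t : ℝ, t ∈ Ioo (-((⌈|t|⌉₊ : ℝ) + 1)) ((⌈|t|⌉₊ : ℝ) + 1) := by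
    intro t
    have := Nat.le_ceil |t|
    have h := abs_le.1 this
    exact ⟨by linarith, by linarith⟩
  refine ⟨fun t => α ⌈|t|⌉₊ t, by simp [hα0], fun t => ?_⟩
  refine (hα _ t (h3 t)).congr_of_eventuallyEq ?_
  filter_upwards [Ioo_mem_nhds (h3 t).1 (h3 t).2] with s hs
  rcases le_total ⌈|s|⌉₊ ⌈|t|⌉₊ with h | h
  · exact h2 _ _ h s (h3 s)
  · exact (h2 _ _ h s hs).symm

theorem aux_fence {g g' : ℝ → ℝ} {K : ℝ} (hg : ∀ t, 0 ≤ t → HasDerivAt g (g' t) t)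
    (h0 : g 0 ≤ K) (h : ∀ t, 0 ≤ t → K < g t → g' t ≤ 0) : ∀ t, 0 ≤ t → g t ≤ K := by
  intro t ht
  have key : ∀ ε > 0, g t ≤ K + ε * (1 + t) := by
    intro ε hε
    refine image_le_of_deriv_right_lt_deriv_boundary (f := g) (f' := g') (a := 0) (b := t)
      (B := fun t => K + ε * (1 + t)) (B' := fun _ => ε)
      (fun x hx => (hg x hx.1).continuousAt.continuousWithinAt)
      (fun x hx => (hg x hx.1).hasDerivWithinAt) (by simp; linarith) ?_ ?_ ⟨ht, le_rfl⟩
    · intro x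
      simpa using (((hasDerivAt_id x).const_add 1).const_mul ε).const_add K
    · intro x hx he
      have : 0 < ε * (1 + x) := mul_pos hε (by linarith [hx.1])
      have := h x hx.1 (by linarith)
      linarith
  refine le_of_forall_pos_le_add fun δ hδ => ?_
  have := key (δ / (1 + t)) (by positivity)
  rwa [div_mul_cancel₀ _ (by positivity)] at this

theorem aux_exp {g g' : ℝ → ℝ} {κ : ℝ} (hg : ∀ t, 0 ≤ t → HasDerivAt g (g' t) t)
    (h : ∀ t, 0 ≤ t → g' t ≤ -κ * g t) : ∀ t, 0 ≤ t → g t ≤ g 0 * Real.exp (-κ * t) := by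
  intro t ht
  have h1 := aux_fence (g := fun t => g t * Real.exp (κ * t)) (K := g 0)
    (g' := fun t => g' t * Real.exp (κ * t) + g t * (Real.exp (κ * t) * κ))
    (fun t ht => (hg t ht).mul (by
      simpa using ((hasDerivAt_id t).const_mul κ).exp)) (by simp)
    (fun t ht _ => by
      have := h t ht
      have h2 := Real.exp_pos (κ * t)
      have : (g' t + κ * g t) * Real.exp (κ * t) ≤ 0 :=
        mul_nonpos_of_nonpos_of_nonneg (by linarith) h2.le
      linarith) t ht
  have h2 := Real.exp_pos (-κ * t)
  have h3 : Real.exp (κ * t) * Real.exp (-κ * t) = 1 := by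
    rw [← Real.exp_add]; simp
  calc g t = (g t * Real.exp (κ * t)) * Real.exp (-κ * t) := by rw [mul_assoc, h3, mul_one]
    _ ≤ _ := by gcongr

/-- quadratic Lyapunov function -/
noncomputable def auxW (p q s : ℝ) (h : ℝ × ℝ) : ℝ :=
  s * q * h.1 ^ 2 + (s * h.1 - p * h.2) ^ 2 + q * (s + q) * h.2 ^ 2

/-- its derivative -/
noncomputable def auxDW (p q s : ℝ) (h k : ℝ × ℝ) : ℝ :=
  s * q * (2 * h.1 * k.1) + 2 * (s * h.1 - p * h.2) * (s * k.1 - p * k.2)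
    + q * (s + q) * (2 * h.2 * k.2)

theorem auxW_deriv (p q s : ℝ) {z : ℝ → ℝ × ℝ} {z' : ℝ × ℝ} {t : ℝ} (v₀ : ℝ × ℝ)
    (hz : HasDerivAt z z' t) :
    HasDerivAt (fun t => auxW p q s (z t - v₀)) (auxDW p q s (z t - v₀) z') t := by
  have h1 : HasDerivAt (fun t => (z t - v₀).1) z'.1 t :=
    (ContinuousLinearMap.fst ℝ ℝ ℝ).hasFDerivAt.comp_hasDerivAt t (hz.sub_const v₀)
  have h2 : HasDerivAt (fun t => (z t - v₀).2) z'.2 t :=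
    (ContinuousLinearMap.snd ℝ ℝ ℝ).hasFDerivAt.comp_hasDerivAt t (hz.sub_const v₀)
  have := (((h1.pow 2).const_mul (s * q)).add (((h1.const_mul s).sub (h2.const_mul p)).pow 2)).add
    ((h2.pow 2).const_mul (q * (s + q)))
  refine HasDerivAt.congr_deriv (f := fun t => auxW p q s (z t - v₀)) this ?_
  simp [auxDW]

theorem auxW_lower (p : ℝ) {q s : ℝ} (hq : 0 < q) (hs : 0 < s) (h : ℝ × ℝ) :
    s * q * ‖h‖ ^ 2 ≤ auxW p q s h := by
  have h3 : ‖h‖ ^ 2 ≤ h.1 ^ 2 + h.2 ^ 2 := by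
    rw [Prod.norm_def]
    rcases max_choice ‖h.1‖ ‖h.2‖ with e | e <;> rw [e, Real.norm_eq_abs, sq_abs] <;> nlinarith [sq_nonneg h.1, sq_nonneg h.2]
  have := mul_le_mul_of_nonneg_left h3 (mul_pos hs hq).le
  unfold auxW
  nlinarith [sq_nonneg (s * h.1 - p * h.2), mul_nonneg (sq_nonneg q) (sq_nonneg h.2)]

theorem auxW_upper (p : ℝ) {q s : ℝ} (hq : 0 < q) (hs : 0 < s) :
    ∃ C > 0, ∀ h : ℝ × ℝ, auxW p q s h ≤ C * ‖h‖ ^ 2 ∧ auxW p q s h ≤ C * (h.1 ^ 2 + h.2 ^ 2) := by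
  have key : ∀ h : ℝ × ℝ, auxW p q s h ≤
      (s * q + 2 * s ^ 2 + 2 * p ^ 2 + q * (s + q)) * (h.1 ^ 2 + h.2 ^ 2) := by
    intro h
    unfold auxW
    have h1 := sq_nonneg (s * h.1 + p * h.2)
    have e1 := sq_nonneg h.1
    have e2 := sq_nonneg h.2
    have : 0 ≤ (s * q + 2 * s ^ 2) * h.2 ^ 2 := by positivity
    have : 0 ≤ (2 * p ^ 2 + q * (s + q)) * h.1 ^ 2 := by positivity
    nlinarith
  have hC : 0 < s * q + 2 * s ^ 2 + 2 * p ^ 2 + q * (s + q) := by positivity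
  refine ⟨2 * (s * q + 2 * s ^ 2 + 2 * p ^ 2 + q * (s + q)), by positivity, fun h => ⟨?_, ?_⟩⟩
  · have a1 : h.1 ^ 2 ≤ ‖h‖ ^ 2 := by
      rw [← sq_abs]; exact pow_le_pow_left₀ (abs_nonneg _) (norm_fst_le h) 2
    have a2 : h.2 ^ 2 ≤ ‖h‖ ^ 2 := by
      rw [← sq_abs]; exact pow_le_pow_left₀ (abs_nonneg _) (norm_snd_le h) 2
    have := mul_le_mul_of_nonneg_left (add_le_add a1 a2) hC.le
    linarith [key h]
  · have : 0 ≤ (s * q + 2 * s ^ 2 + 2 * p ^ 2 + q * (s + q)) * (h.1 ^ 2 + h.2 ^ 2) := by positivity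
    linarith [key h]

theorem aux_DW_bound (p q s : ℝ) (hq : 0 < q) (hs : 0 < s) (h R : ℝ × ℝ) {ε : ℝ}
    (hR : ‖R‖ ≤ ε * ‖h‖) :
    |auxDW p q s h R| ≤ 2 * (s * q + (s + |p|) ^ 2 + q * (s + q)) * ε * ‖h‖ ^ 2 := by
  have hE : ∀ x y : ℝ, |x| ≤ ‖h‖ → |y| ≤ ‖R‖ → |x * y| ≤ ε * ‖h‖ ^ 2 := by
    intro x y hx hy
    rw [abs_mul]
    calc |x| * |y| ≤ ‖h‖ * (ε * ‖h‖) := by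
          gcongr
          exact hy.trans hR
      _ = _ := by ring
  have a11 := hE _ _ (norm_fst_le h) (norm_fst_le R)
  have a12 := hE _ _ (norm_fst_le h) (norm_snd_le R)
  have a21 := hE _ _ (norm_snd_le h) (norm_fst_le R)
  have a22 := hE _ _ (norm_snd_le h) (norm_snd_le R)
  set E := ε * ‖h‖ ^ 2
  have e : auxDW p q s h R = (2 * s * q + 2 * s ^ 2) * (h.1 * R.1) + (-(2 * s * p)) * (h.1 * R.2)
      + (-(2 * s * p)) * (h.2 * R.1) + (2 * p ^ 2 + 2 * q * (s + q)) * (h.2 * R.2) := by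
    unfold auxDW; ring
  have b1 : |(2 * s * q + 2 * s ^ 2) * (h.1 * R.1)| ≤ (2 * s * q + 2 * s ^ 2) * E := by
    rw [abs_mul, abs_of_pos (by positivity : 0 < 2 * s * q + 2 * s ^ 2)]; gcongr
  have b2 : |(-(2 * s * p)) * (h.1 * R.2)| ≤ (2 * s * |p|) * E := by
    rw [abs_mul, abs_neg, abs_mul, abs_of_pos (by positivity : 0 < 2 * s)]; gcongr
  have b3 : |(-(2 * s * p)) * (h.2 * R.1)| ≤ (2 * s * |p|) * E := by
    rw [abs_mul, abs_neg, abs_mul, abs_of_pos (by positivity : 0 < 2 * s)]; gcongr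
  have b4 : |(2 * p ^ 2 + 2 * q * (s + q)) * (h.2 * R.2)| ≤ (2 * p ^ 2 + 2 * q * (s + q)) * E := by
    rw [abs_mul, abs_of_pos (by positivity : 0 < 2 * p ^ 2 + 2 * q * (s + q))]; gcongr
  have hp : |p| ^ 2 = p ^ 2 := sq_abs p
  rw [e]
  have e2 : 2 * (s * q + (s + |p|) ^ 2 + q * (s + q)) * ε * ‖h‖ ^ 2 =
      (2 * s * q + 2 * s ^ 2) * E + (2 * s * |p|) * E + (2 * s * |p|) * E
      + (2 * p ^ 2 + 2 * q * (s + q)) * E := by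
    rw [← hp]; simp only [E]; ring
  rw [e2]
  obtain ⟨c1, d1⟩ := abs_le.1 b1
  obtain ⟨c2, d2⟩ := abs_le.1 b2
  obtain ⟨c3, d3⟩ := abs_le.1 b3
  obtain ⟨c4, d4⟩ := abs_le.1 b4
  exact abs_le.2 ⟨by linarith, by linarith⟩

theorem aux_local {f : ℝ × ℝ → ℝ × ℝ} {v₀ : ℝ × ℝ} {A : ℝ × ℝ →L[ℝ] ℝ × ℝ}
    (hf : HasFDerivAt f A v₀) (h0 : f v₀ = 0) {p q s : ℝ} (hp : p ≠ 0) (hq : 0 < q) (hs : 0 < s)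
    (h1 : A (1, 0) = (p, s)) (h2 : A (0, 1) = (-q, 0)) :
    ∃ r > 0, ∀ v, ‖v - v₀‖ < r →
      |auxDW p q s (v - v₀) (f v) - 2 * p * q * s * ((v - v₀).1 ^ 2 + (v - v₀).2 ^ 2)| ≤
        |p| * q * s * ((v - v₀).1 ^ 2 + (v - v₀).2 ^ 2) := by
  have hp' : 0 < |p| := abs_pos.2 hp
  set C := 2 * (s * q + (s + |p|) ^ 2 + q * (s + q)) with hC
  have hCpos : 0 < C := by positivity
  have hε : 0 < |p| * q * s / C := by positivity
  have hlo := hf.isLittleO.def hε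
  obtain ⟨r, hr, hball⟩ := Metric.eventually_nhds_iff.1 hlo
  refine ⟨r, hr, fun v hv => ?_⟩
  have hR := hball (y := v) (by rwa [dist_eq_norm])
  rw [h0, sub_zero] at hR
  set h := v - v₀
  have hA : A h = (p * h.1 - q * h.2, s * h.1) := by
    have : h = h.1 • ((1 : ℝ), (0 : ℝ)) + h.2 • ((0 : ℝ), (1 : ℝ)) := by
      ext <;> simp
    rw [this, map_add, map_smul, map_smul, h1, h2]
    ext <;> simp <;> ring
  have hb := aux_DW_bound p q s hq hs h _ hR
  have e : auxDW p q s h (f v) - 2 * p * q * s * (h.1 ^ 2 + h.2 ^ 2)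
      = auxDW p q s h (f v - A h) := by
    rw [hA]; unfold auxDW; simp; ring
  rw [e]
  refine hb.trans ?_
  have h3 : ‖h‖ ^ 2 ≤ h.1 ^ 2 + h.2 ^ 2 := by
    rw [Prod.norm_def]
    rcases max_choice ‖h.1‖ ‖h.2‖ with e | e <;> rw [e, Real.norm_eq_abs, sq_abs] <;>
      nlinarith [sq_nonneg h.1, sq_nonneg h.2]
  rw [← hC, mul_div_cancel₀ _ hCpos.ne']
  gcongr

theorem aux_stable {f : ℝ × ℝ → ℝ × ℝ} {v₀ : ℝ × ℝ} {p q s r : ℝ} (hp : p < 0) (hq : 0 < q)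
    (hs : 0 < s) (hr : 0 < r)
    (hloc : ∀ v, ‖v - v₀‖ < r →
      |auxDW p q s (v - v₀) (f v) - 2 * p * q * s * ((v - v₀).1 ^ 2 + (v - v₀).2 ^ 2)| ≤
        |p| * q * s * ((v - v₀).1 ^ 2 + (v - v₀).2 ^ 2)) : IsAsympStableEq f v₀ := by
  obtain ⟨C, hC, hW⟩ := auxW_upper p hq hs
  have hp' : 0 < -p := by linarith
  have hκ : 0 < -p * q * s / C := by positivity
  set κ := -p * q * s / C with hκe
  have hD : ∀ v, ‖v - v₀‖ < r → auxDW p q s (v - v₀) (f v) ≤ -κ * auxW p q s (v - v₀) := by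
    intro v hv
    have h1 := (abs_le.1 (hloc v hv)).2
    rw [abs_of_neg hp] at h1
    have h2 := mul_le_mul_of_nonneg_left (hW (v - v₀)).2 hκ.le
    have h3 : κ * (C * ((v - v₀).1 ^ 2 + (v - v₀).2 ^ 2)) =
      -p * q * s * ((v - v₀).1 ^ 2 + (v - v₀).2 ^ 2) := by
      rw [hκe]; field_simp
    linarith
  have hnorm : ∀ (ε : ℝ) (h : ℝ × ℝ), 0 < ε → auxW p q s h ≤ s * q * ε ^ 2 → ‖h‖ ≤ ε := by
    intro ε h hε hh
    have h1 := (auxW_lower p hq hs h).trans hh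
    have h2 := le_of_mul_le_mul_left h1 (mul_pos hs hq)
    exact (sq_le_sq₀ (norm_nonneg _) hε.le).1 h2
  have claim : ∀ ε > 0, ε < r → ∃ δ > 0, ∀ z : ℝ → ℝ × ℝ,
      (∀ t, 0 ≤ t → HasDerivAt z (f (z t)) t) → ‖z 0 - v₀‖ < δ →
      ∀ t, 0 ≤ t → ‖z t - v₀‖ ≤ ε := by
    intro ε hε hεr
    refine ⟨ε * Real.sqrt (s * q / C), by positivity, fun z hz hz0 t ht => ?_⟩
    apply hnorm ε _ hε
    have hLpos : 0 < s * q * ε ^ 2 := by positivity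
    refine image_le_of_deriv_right_lt_deriv_boundary (f := fun t => auxW p q s (z t - v₀))
      (f' := fun t => auxDW p q s (z t - v₀) (f (z t))) (a := 0) (b := t)
      (B := fun _ => s * q * ε ^ 2) (B' := fun _ => 0)
      (fun x hx => (auxW_deriv p q s v₀ (hz x hx.1)).continuousAt.continuousWithinAt)
      (fun x hx => (auxW_deriv p q s v₀ (hz x hx.1)).hasDerivWithinAt) ?_ ?_ ?_ ⟨ht, le_rfl⟩
    · refine ((hW _).1).trans ?_
      have h1 : ‖z 0 - v₀‖ ^ 2 ≤ (ε * Real.sqrt (s * q / C)) ^ 2 :=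
        pow_le_pow_left₀ (norm_nonneg _) hz0.le 2
      rw [mul_pow, Real.sq_sqrt (by positivity)] at h1
      calc C * ‖z 0 - v₀‖ ^ 2 ≤ C * (ε ^ 2 * (s * q / C)) := by gcongr
        _ = s * q * ε ^ 2 := by field_simp
    · intro x; exact hasDerivAt_const x _
    · intro x hx he
      have h1 := hnorm ε (z x - v₀) hε he.le
      have h2 := hD (z x) (by linarith)
      have h3 : auxW p q s (z x - v₀) = s * q * ε ^ 2 := he
      rw [h3] at h2
      have := mul_pos hκ hLpos
      show auxDW p q s (z x - v₀) (f (z x)) < 0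
      linarith
  refine ⟨fun ε hε => ?_, ?_⟩
  · have hm : 0 < min ε r := lt_min hε hr
    obtain ⟨δ, hδ, H⟩ := claim (min ε r / 2) (by linarith) (by linarith [min_le_right ε r])
    exact ⟨δ, hδ, fun z hz hz0 t ht =>
      (H z hz hz0 t ht).trans_lt (by linarith [min_le_left ε r])⟩
  · obtain ⟨δ, hδ, H⟩ := claim (r / 2) (by linarith) (by linarith)
    refine ⟨δ, hδ, fun z hz hz0 => ?_⟩
    have h1 := aux_exp (g := fun t => auxW p q s (z t - v₀))
      (g' := fun t => auxDW p q s (z t - v₀) (f (z t))) (κ := κ)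
      (fun t ht => auxW_deriv p q s v₀ (hz t ht))
      (fun t ht => hD (z t) (by linarith [H z hz hz0 t ht]))
    rw [tendsto_iff_norm_sub_tendsto_zero]
    have hlim : Tendsto (fun t : ℝ =>
        Real.sqrt (auxW p q s (z 0 - v₀) * Real.exp (-κ * t) / (s * q))) atTop (𝓝 0) := by
      have a1 : Tendsto (fun t : ℝ => -κ * t) atTop atBot :=
        tendsto_id.const_mul_atTop_of_neg (by linarith)
      have a2 := (((Real.tendsto_exp_atBot.comp a1).const_mul
        (auxW p q s (z 0 - v₀))).div_const (s * q)).sqrt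
      simpa using a2
    refine squeeze_zero' (Eventually.of_forall fun _ => norm_nonneg _) ?_ hlim
    filter_upwards [eventually_ge_atTop 0] with t ht
    apply Real.le_sqrt_of_sq_le
    rw [le_div_iff₀ (mul_pos hs hq), mul_comm]
    exact (auxW_lower p hq hs _).trans (h1 t ht)

theorem aux_unstable {f : ℝ × ℝ → ℝ × ℝ} {v₀ : ℝ × ℝ} {p q s r : ℝ} (hp : 0 < p) (hq : 0 < q)
    (hs : 0 < s) (hr : 0 < r)
    (hloc : ∀ v, ‖v - v₀‖ < r →
      |auxDW p q s (v - v₀) (f v) - 2 * p * q * s * ((v - v₀).1 ^ 2 + (v - v₀).2 ^ 2)| ≤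
        |p| * q * s * ((v - v₀).1 ^ 2 + (v - v₀).2 ^ 2))
    (hex : ∀ δ > 0, ∃ z : ℝ → ℝ × ℝ, (∀ t, 0 ≤ t → HasDerivAt z (f (z t)) t) ∧
      ‖z 0 - v₀‖ < δ ∧ z 0 ≠ v₀) : ¬ IsLyapStableEq f v₀ := by
  intro hst
  obtain ⟨C, hC, hW⟩ := auxW_upper p hq hs
  have hκ : 0 < p * q * s / C := by positivity
  set κ := p * q * s / C with hκe
  have hD : ∀ v, ‖v - v₀‖ < r → κ * auxW p q s (v - v₀) ≤ auxDW p q s (v - v₀) (f v) := by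
    intro v hv
    have h1 := (abs_le.1 (hloc v hv)).1
    rw [abs_of_pos hp] at h1
    have h2 := mul_le_mul_of_nonneg_left (hW (v - v₀)).2 hκ.le
    have h3 : κ * (C * ((v - v₀).1 ^ 2 + (v - v₀).2 ^ 2)) =
      p * q * s * ((v - v₀).1 ^ 2 + (v - v₀).2 ^ 2) := by
      rw [hκe]; field_simp
    linarith
  obtain ⟨δ, hδ, H⟩ := hst r hr
  obtain ⟨z, hz, hz0, hne⟩ := hex δ hδ
  have hin := H z hz hz0
  have h1 := aux_exp (g := fun t => -auxW p q s (z t - v₀))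
      (g' := fun t => -auxDW p q s (z t - v₀) (f (z t))) (κ := -κ)
      (fun t ht => (auxW_deriv p q s v₀ (hz t ht)).neg)
      (fun t ht => by linarith [hD (z t) (hin t ht)])
  have hW0 : 0 < auxW p q s (z 0 - v₀) := by
    refine lt_of_lt_of_le ?_ (auxW_lower p hq hs _)
    have : 0 < ‖z 0 - v₀‖ := norm_pos_iff.2 (sub_ne_zero.2 hne)
    positivity
  have hlim : Tendsto (fun t : ℝ => auxW p q s (z 0 - v₀) * Real.exp (κ * t)) atTop atTop :=
    (Real.tendsto_exp_atTop.comp (tendsto_id.const_mul_atTop hκ)).const_mul_atTop hW0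
  obtain ⟨t, ht1, ht0⟩ :=
    ((hlim.eventually_gt_atTop (C * r ^ 2)).and (eventually_ge_atTop 0)).exists
  have h2 := h1 t ht0
  simp only [neg_neg] at h2
  have h3 := (hW (z t - v₀)).1
  have h4 : C * ‖z t - v₀‖ ^ 2 ≤ C * r ^ 2 := by
    have := (hin t ht0).le
    gcongr
  linarith

theorem aux_spec {p q s : ℝ} (hqs : 0 < q * s) {μ : ℂ}
    (hμ : μ ∈ spectrum ℂ ((!![p, -q; s, 0] : Matrix (Fin 2) (Fin 2) ℝ).map Complex.ofReal)) :
    (p < 0 → μ.re < 0) ∧ (0 < p → 0 < μ.re) := by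
  rw [Matrix.mem_spectrum_iff_isRoot_charpoly, Matrix.charpoly_fin_two] at hμ
  simp [Matrix.trace_fin_two, Matrix.det_fin_two] at hμ
  have hr := congrArg Complex.re hμ
  have hi := congrArg Complex.im hμ
  simp [pow_two] at hr hi
  have hi' : μ.im * (2 * μ.re - p) = 0 := by linarith
  rcases mul_eq_zero.1 hi' with h | h
  · rw [h] at hr
    constructor
    · intro hp; by_contra hc; push Not at hc; nlinarith
    · intro hp; by_contra hc; push Not at hc; nlinarith
  · constructor <;> intro hp <;> linarith

theorem aux_contDiffAt {γ k m₁ β₁ a lam ρ c : ℝ} (hρ : 1 ≤ ρ) {v : ℝ × ℝ} (hv : a + v.1 ≠ 0) :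
    ContDiffAt ℝ 1 (planarField γ k m₁ β₁ a lam ρ c) v := by
  have hr : ContDiffAt ℝ 1 (fun v : ℝ × ℝ => v.2 ^ ρ) v :=
    (Real.contDiff_rpow_const_of_le (n := 1) (by simpa using hρ)).contDiffAt.comp v contDiffAt_snd
  have h1 : ContDiffAt ℝ 1 (fun v : ℝ × ℝ => v.1) v := contDiffAt_fst
  have h2 : ContDiffAt ℝ 1 (fun v : ℝ × ℝ => v.2) v := contDiffAt_snd
  have h3 : ContDiffAt ℝ 1 (fun v : ℝ × ℝ => a + v.1) v := contDiffAt_const.add h1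
  unfold planarField
  refine ContDiffAt.prodMk ?_ ?_
  · exact ((contDiffAt_const.mul h1).mul (contDiffAt_const.sub (h1.div_const k))).sub
      ((h2.add (contDiffAt_const.mul hr)).mul ((contDiffAt_const.mul h1).div h3 hv))
  · exact (contDiffAt_const.mul h2).mul ((h1.sub contDiffAt_const).div h3 hv)

theorem aux_fderiv (γ k m₁ β₁ a lam ρ c : ℝ)
    (hm₁ : 0 < m₁) (ha : 0 < a)
    (hρ : 1 ≤ ρ) (hlam : 0 < lam) (hlamk : lam < k)
    (ξ₁ : ℝ) (hξ₁pos : 0 < ξ₁)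
    (hξ₁ : ξ₁ + ρ * c * ξ₁ ^ ρ = γ * (a + lam) * (k - lam) / (m₁ * k)) :
    fderiv ℝ (planarField γ k m₁ β₁ a lam ρ c) (lam, ξ₁) (1, 0) =
      (γ * lam * (k - a - 2 * lam) / (k * (a + lam)), β₁ * ξ₁ / (a + lam)) ∧
    fderiv ℝ (planarField γ k m₁ β₁ a lam ρ c) (lam, ξ₁) (0, 1) =
      (-((1 + ρ * c * (ρ * ξ₁ ^ (ρ - 1))) * (m₁ * lam / (a + lam))), 0) ∧
    planarField γ k m₁ β₁ a lam ρ c (lam, ξ₁) = 0 := by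
  have hal : a + lam ≠ 0 := by positivity
  have hk : k ≠ 0 := by linarith
  have hA := ((aux_contDiffAt (γ := γ) (k := k) (m₁ := m₁) (β₁ := β₁) (lam := lam) (c := c)
    hρ (v := (lam, ξ₁)) hal).differentiableAt (by simp)).hasFDerivAt
  refine ⟨?_, ?_, ?_⟩
  · have h1 := hA.comp_hasDerivAt lam ((hasDerivAt_id lam).prodMk (hasDerivAt_const lam ξ₁))
    refine h1.unique ?_
    have i := hasDerivAt_id lam
    have d3 := i.const_add a
    have := ((((i.const_mul γ).mul ((i.div_const k).const_sub 1)).sub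
      (((i.const_mul m₁).div d3 hal).const_mul (ξ₁ + ρ * c * ξ₁ ^ ρ)))).prodMk
      (((i.sub_const lam).div d3 hal).const_mul (β₁ * ξ₁))
    refine HasDerivAt.congr_deriv this ?_
    ext
    · simp
      rw [hξ₁]
      field_simp
      ring
    · simp
      field_simp
  · have h1 := hA.comp_hasDerivAt ξ₁ ((hasDerivAt_const ξ₁ lam).prodMk (hasDerivAt_id ξ₁))
    refine h1.unique ?_
    have i := hasDerivAt_id ξ₁
    have r := Real.hasDerivAt_rpow_const (x := ξ₁) (p := ρ) (Or.inl hξ₁pos.ne')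
    have := ((((i.add (r.const_mul (ρ * c))).mul_const (m₁ * lam / (a + lam))).const_sub
        (γ * lam * (1 - lam / k)))).prodMk
      ((i.const_mul β₁).mul_const ((lam - lam) / (a + lam)))
    refine HasDerivAt.congr_deriv this ?_
    ext <;> simp
  · unfold planarField
    ext
    · simp only [hξ₁]
      simp
      field_simp
      ring
    · simp

theorem aux_global (γ k m₁ β₁ a lam ρ c : ℝ)
    (hγ : 0 < γ) (hm₁ : 0 < m₁) (hβ₁ : 0 < β₁) (ha : 0 < a)
    (hρ : 1 ≤ ρ) (hc : 0 < c) (hlam : 0 < lam) (hlamk : lam < k) (x₀ : ℝ) (hx₀ : 0 < x₀) :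
    ∃ z : ℝ → ℝ × ℝ, z 0 = (lam, x₀) ∧
      ∀ t, 0 ≤ t → HasDerivAt z (planarField γ k m₁ β₁ a lam ρ c (z t)) t := by
  have hk : 0 < k := hlam.trans hlamk
  set f := planarField γ k m₁ β₁ a lam ρ c with hf
  set θ := m₁ / β₁ with hθ
  have hθpos : 0 < θ := by positivity
  set X := γ * k * (a + k) / (m₁ * lam) with hX
  have hXpos : 0 < X := by positivity
  set L := k + θ * (X + x₀) with hL
  set M := L / θ with hM
  have hLpos : 0 < L := by positivity
  have hMpos : 0 < M := by positivity
  have hMX : X ≤ M := by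
    rw [hM, le_div_iff₀ hθpos]; nlinarith [mul_pos hθpos hx₀]
  set cl : ℝ × ℝ → ℝ × ℝ := fun v => (max 0 (min v.1 k), max 0 (min v.2 M)) with hcl
  set box : Set (ℝ × ℝ) := Icc 0 k ×ˢ Icc 0 M with hbox
  have hclbox : ∀ v, cl v ∈ box := fun v =>
    ⟨⟨le_max_left _ _, max_le hk.le (min_le_right _ _)⟩,
      ⟨le_max_left _ _, max_le hMpos.le (min_le_right _ _)⟩⟩
  have hboxc : IsCompact box := isCompact_Icc.prod isCompact_Icc
  have hboxconv : Convex ℝ box := (convex_Icc 0 k).prod (convex_Icc 0 M)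
  have hfC : ContDiffOn ℝ 1 f box := fun v hv =>
    (aux_contDiffAt hρ (by have : 0 ≤ v.1 := hv.1.1
                           positivity)).contDiffWithinAt
  obtain ⟨K, hK⟩ := hfC.exists_lipschitzOnWith (by simp) hboxconv hboxc
  obtain ⟨B, hB⟩ := hboxc.exists_bound_of_continuousOn hfC.continuousOn
  have hcl1 : LipschitzWith 1 cl := by
    have := ((LipschitzWith.prod_fst (α := ℝ) (β := ℝ)).min_const k |>.const_max 0).prodMk
      ((LipschitzWith.prod_snd (α := ℝ) (β := ℝ)).min_const M |>.const_max 0)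
    simpa using this
  have hF : LipschitzWith K (f ∘ cl) := by
    have := hK.comp (hcl1.lipschitzOnWith (s := univ)) (fun v _ => hclbox v)
    rw [mul_one, lipschitzOnWith_univ] at this
    exact this
  obtain ⟨z, hz0, hz⟩ := aux_exists_global (L := B.toNNReal) hF
    (fun v => (hB _ (hclbox v)).trans (Real.le_coe_toNNReal B)) (lam, x₀)
  have hd1 : ∀ t, 0 ≤ t → HasDerivAt (fun t => (z t).1) (f (cl (z t))).1 t := fun t _ =>
    (ContinuousLinearMap.fst ℝ ℝ ℝ).hasFDerivAt.comp_hasDerivAt t (hz t)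
  have hd2 : ∀ t, 0 ≤ t → HasDerivAt (fun t => (z t).2) (f (cl (z t))).2 t := fun t _ =>
    (ContinuousLinearMap.snd ℝ ℝ ℝ).hasFDerivAt.comp_hasDerivAt t (hz t)
  have hS0 : ∀ t, 0 ≤ t → 0 ≤ (z t).1 := by
    intro t ht
    have := aux_fence (g := fun t => -(z t).1) (K := 0) (fun t ht => (hd1 t ht).neg)
      (by simp [hz0, hlam.le]) (fun t ht hlt => by
        have h1 : (z t).1 < 0 := by linarith
        have : max 0 (min (z t).1 k) = 0 := max_eq_left ((min_le_left _ _).trans h1.le)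
        simp [hf, planarField, hcl, this]) t ht
    linarith
  have hx0 : ∀ t, 0 ≤ t → 0 ≤ (z t).2 := by
    intro t ht
    have := aux_fence (g := fun t => -(z t).2) (K := 0) (fun t ht => (hd2 t ht).neg)
      (by simp [hz0, hx₀.le]) (fun t ht hlt => by
        have h1 : (z t).2 < 0 := by linarith
        have : max 0 (min (z t).2 M) = 0 := max_eq_left ((min_le_left _ _).trans h1.le)
        simp [hf, planarField, hcl, this]) t ht
    linarith
  have hSk : ∀ t, 0 ≤ t → (z t).1 ≤ k := by
    refine aux_fence (g := fun t => (z t).1) hd1 (by simp [hz0, hlamk.le]) (fun t ht hlt => ?_)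
    have h1 : max 0 (min (z t).1 k) = k := by rw [min_eq_right hlt.le, max_eq_right hk.le]
    have h2 : 0 ≤ max 0 (min (z t).2 M) := le_max_left _ _
    simp only [hf, planarField, hcl, h1]
    rw [div_self hk.ne', sub_self, mul_zero, zero_sub]
    have := Real.rpow_nonneg h2 ρ
    rw [neg_nonpos]
    positivity
  have hV : ∀ t, 0 ≤ t → (z t).1 + θ * (z t).2 ≤ L := by
    refine aux_fence (g := fun t => (z t).1 + θ * (z t).2)
      (fun t ht => (hd1 t ht).add ((hd2 t ht).const_mul θ)) ?_ (fun t ht hlt => ?_)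
    · simp only [hz0, hL]
      nlinarith [mul_pos hθpos hXpos]
    · have hS := hS0 t ht
      have hS' := hSk t ht
      have h1 : max 0 (min (z t).1 k) = (z t).1 := by rw [min_eq_left hS', max_eq_right hS]
      have hy : X ≤ max 0 (min (z t).2 M) := by
        refine le_max_of_le_right (le_min ?_ hMX)
        have : θ * (X + x₀) ≤ θ * (z t).2 := by
          simp only [hL] at hlt; linarith
        have := le_of_mul_le_mul_left this hθpos
        linarith
      simp only [hf, planarField, hcl, h1]
      set y := max 0 (min (z t).2 M)
      set S := (z t).1
      have hy0 : 0 ≤ y := hXpos.le.trans hy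
      have hr := Real.rpow_nonneg hy0 ρ
      have haS : 0 < a + S := by positivity
      have e : γ * S * (1 - S / k) - (y + ρ * c * y ^ ρ) * (m₁ * S / (a + S)) +
          θ * (β₁ * y * ((S - lam) / (a + S))) =
          γ * S - γ * S * S / k - ρ * c * y ^ ρ * (m₁ * S / (a + S)) - m₁ * lam * y / (a + S) := by
        rw [hθ]; field_simp; ring
      rw [e]
      have e1 : 0 ≤ γ * S * S / k := by positivity
      have e2 : 0 ≤ ρ * c * y ^ ρ * (m₁ * S / (a + S)) := by positivity
      have e3 : γ * S ≤ γ * k := by gcongr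
      have e4 : γ * k ≤ m₁ * lam * y / (a + S) := by
        calc γ * k = m₁ * lam * X / (a + k) := by rw [hX]; field_simp
          _ ≤ _ := by gcongr
      linarith
  refine ⟨z, hz0, fun t ht => ?_⟩
  have h1 : cl (z t) = z t := by
    have hxM : (z t).2 ≤ M := by
      rw [hM, le_div_iff₀ hθpos]
      linarith [hV t ht, hS0 t ht]
    ext
    · simp only [hcl]
      rw [min_eq_left (hSk t ht), max_eq_right (hS0 t ht)]
    · simp only [hcl]
      rw [min_eq_left hxM, max_eq_right (hx0 t ht)]
  have := hz t
  rwa [Function.comp_apply, h1] at this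

/-- Stability of the interior equilibrium `(λ, ξ₁)` of the reduced
system: for `λ < k < a + 2λ` both Jacobian eigenvalues have negative real part and
the equilibrium is asymptotically stable; for `k > a + 2λ` some eigenvalue has
positive real part and the equilibrium is unstable. -/
theorem interior_equilibrium_stability
    (γ k m₁ β₁ a lam ρ c : ℝ)
    (hγ : 0 < γ) (hm₁ : 0 < m₁) (hβ₁ : 0 < β₁) (ha : 0 < a)
    (hρ : 1 ≤ ρ) (hc : 0 < c) (hlam : 0 < lam) (hlamk : lam < k)
    (ξ₁ : ℝ) (hξ₁pos : 0 < ξ₁)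
    (hξ₁ : ξ₁ + ρ * c * ξ₁ ^ ρ = γ * (a + lam) * (k - lam) / (m₁ * k)) :
    (k < a + 2 * lam →
      (∀ μ ∈ spectrum ℂ
          ((planarJacobian (planarField γ k m₁ β₁ a lam ρ c) (lam, ξ₁)).map
            Complex.ofReal),
        μ.re < 0) ∧
      IsAsympStableEq (planarField γ k m₁ β₁ a lam ρ c) (lam, ξ₁)) ∧
    (a + 2 * lam < k →
      (∃ μ ∈ spectrum ℂ
          ((planarJacobian (planarField γ k m₁ β₁ a lam ρ c) (lam, ξ₁)).map
            Complex.ofReal),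
        0 < μ.re) ∧
      ¬ IsLyapStableEq (planarField γ k m₁ β₁ a lam ρ c) (lam, ξ₁)) := by
  have hk : 0 < k := hlam.trans hlamk
  obtain ⟨h1, h2, h0⟩ := aux_fderiv γ k m₁ β₁ a lam ρ c hm₁ ha hρ hlam hlamk ξ₁ hξ₁pos hξ₁
  have hdiff := ((aux_contDiffAt (γ := γ) (k := k) (m₁ := m₁) (β₁ := β₁) (a := a) (lam := lam)
    (c := c) hρ (v := (lam, ξ₁))
    (by positivity)).differentiableAt (by simp)).hasFDerivAt
  set p := γ * lam * (k - a - 2 * lam) / (k * (a + lam)) with hp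
  set s := β₁ * ξ₁ / (a + lam) with hs
  set q := (1 + ρ * c * (ρ * ξ₁ ^ (ρ - 1))) * (m₁ * lam / (a + lam)) with hq
  have hspos : 0 < s := by positivity
  have hqpos : 0 < q := by
    have := Real.rpow_pos_of_pos hξ₁pos (ρ - 1)
    positivity
  have hJ : planarJacobian (planarField γ k m₁ β₁ a lam ρ c) (lam, ξ₁) = !![p, -q; s, 0] := by
    unfold planarJacobian
    rw [h1, h2]
  rw [hJ]
  refine ⟨fun hlt => ?_, fun hlt => ?_⟩
  · have hpneg : p < 0 :=
      div_neg_of_neg_of_pos (mul_neg_of_pos_of_neg (by positivity) (by linarith)) (by positivity)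
    refine ⟨fun μ hμ => (aux_spec (mul_pos hqpos hspos) hμ).1 hpneg, ?_⟩
    obtain ⟨r, hr, hloc⟩ := aux_local hdiff h0 hpneg.ne hqpos hspos h1 h2
    exact aux_stable hpneg hqpos hspos hr hloc
  · have hppos : 0 < p :=
      div_pos (mul_pos (by positivity) (by linarith)) (by positivity)
    refine ⟨?_, ?_⟩
    · obtain ⟨μ, hμ⟩ := spectrum.nonempty_of_isAlgClosed_of_finiteDimensional ℂ
        ((!![p, -q; s, 0] : Matrix (Fin 2) (Fin 2) ℝ).map Complex.ofReal)
      exact ⟨μ, hμ, (aux_spec (mul_pos hqpos hspos) hμ).2 hppos⟩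
    · obtain ⟨r, hr, hloc⟩ := aux_local hdiff h0 hppos.ne' hqpos hspos h1 h2
      refine aux_unstable hppos hqpos hspos hr hloc (fun δ hδ => ?_)
      obtain ⟨z, hz0, hz⟩ := aux_global γ k m₁ β₁ a lam ρ c hγ hm₁ hβ₁ ha hρ hc hlam hlamk
        (ξ₁ + δ / 2) (by positivity)
      refine ⟨z, hz, ?_, ?_⟩
      · rw [hz0, Prod.norm_def]
        simp [abs_of_pos hδ, hδ]
      · rw [hz0]
        intro h
        have := congrArg Prod.snd h
        simp at this
        linarith
end

section
/- Consider the planar system S' = γS(1 − S/k) − (x₁ + ρcx₁^ρ)·m₁S/(a+S), x₁' = β₁x₁(S−λ)/(a+S), with constants γ, m₁, β₁, a > 0, ρ ≥ 1, c > 0, 0 < λ, and let k = a + 2λ. Let (λ, ξ₁) be the interior equilibrium, with ξ₁ > 0 satisfying ξ₁ + ρcξ₁^ρ = γ(a+λ)(k−λ)/(m₁k). Assume h₁ := 1 − ρ + ργ(a+λ)²/(m₁ξ₁(a+2λ)) > 0. Then the Jacobian matrix of the system at (λ, ξ₁) has trace zero and positive determinant, and its eigenvalues are the purely imaginary pair ±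 i w, where w = (1/(a+λ)) · √( λ m₁ β₁ ξ₁ h₁ ) > 0. -/
open Set

lemma planarJacobian_eq
    (γ k m₁ β₁ a lam ρ c : ℝ) (ha : 0 < a) (hlam : 0 < lam) (ξ₁ : ℝ) (hξ : 0 < ξ₁) :
    planarJacobian (planarField γ k m₁ β₁ a lam ρ c) (lam, ξ₁) =
      !![γ * (1 - lam / k) - γ * lam / k - (ξ₁ + ρ * c * ξ₁ ^ ρ) * (m₁ * a / (a + lam) ^ 2),
          -((1 + ρ * c * (ρ * ξ₁ ^ (ρ - 1))) * (m₁ * lam / (a + lam)));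
         β₁ * ξ₁ / (a + lam), 0] := by
  have hne : a + lam ≠ 0 := by positivity
  have hd : DifferentiableAt ℝ (planarField γ k m₁ β₁ a lam ρ c) (lam, ξ₁) := by
    unfold planarField
    have h2 : DifferentiableAt ℝ (fun v : ℝ × ℝ => v.2 ^ ρ) (lam, ξ₁) :=
      DifferentiableAt.rpow_const differentiableAt_snd (Or.inl hξ.ne')
    have h3 : DifferentiableAt ℝ (fun v : ℝ × ℝ => (a + v.1)⁻¹) (lam, ξ₁) :=
      DifferentiableAt.inv (by fun_prop) hne
    simp only [div_eq_mul_inv]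
    fun_prop
  have h1 : HasDerivAt (fun t : ℝ => (t, ξ₁)) ((1 : ℝ), (0 : ℝ)) lam :=
    (hasDerivAt_id lam).prodMk (hasDerivAt_const lam ξ₁)
  have h2 : HasDerivAt (fun t : ℝ => (lam, t)) ((0 : ℝ), (1 : ℝ)) ξ₁ :=
    (hasDerivAt_const ξ₁ lam).prodMk (hasDerivAt_id ξ₁)
  have e1 := HasFDerivAt.comp_hasDerivAt (f := fun t : ℝ => (t, ξ₁)) lam hd.hasFDerivAt h1
  have e2 := HasFDerivAt.comp_hasDerivAt (f := fun t : ℝ => (lam, t)) ξ₁ hd.hasFDerivAt h2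
  have ha' : HasDerivAt (fun t : ℝ => a + t) 1 lam := (hasDerivAt_id lam).const_add a
  have hid := hasDerivAt_id lam
  have hid2 := hasDerivAt_id ξ₁
  have f1 := ((((hid.const_mul γ).mul ((hid.div_const k).const_sub 1)).sub
    (((hid.const_mul m₁).div ha' hne).const_mul (ξ₁ + ρ * c * ξ₁ ^ ρ))).prodMk
    (((hid.sub_const lam).div ha' hne).const_mul (β₁ * ξ₁)))
  have f2 := (((hid2.add ((Real.hasDerivAt_rpow_const (p := ρ) (Or.inl hξ.ne')).const_mul
    (ρ * c))).mul_const (m₁ * lam / (a + lam))).const_sub (γ * lam * (1 - lam / k))).prodMk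
    ((hid2.const_mul β₁).mul_const ((lam - lam) / (a + lam)))
  have g1 := e1.unique f1
  have g2 := e2.unique f2
  unfold planarJacobian
  rw [g1, g2]
  ext i j
  fin_cases i <;> fin_cases j <;> simp <;> field_simp <;> ring

lemma spectrum_aux (A : Matrix (Fin 2) (Fin 2) ℝ) (w : ℝ) (ht : A.trace = 0)
    (hd : A.det = w ^ 2) :
    spectrum ℂ (A.map Complex.ofReal) = {Complex.I * (w : ℂ), -(Complex.I * (w : ℂ))} := by
  ext z
  rw [spectrum.mem_iff, Matrix.isUnit_iff_isUnit_det, isUnit_iff_ne_zero, not_not]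
  have key : (algebraMap ℂ (Matrix (Fin 2) (Fin 2) ℂ) z - A.map Complex.ofReal).det
      = (z - Complex.I * w) * (z + Complex.I * w) := by
    rw [Matrix.trace_fin_two] at ht
    rw [Matrix.det_fin_two] at hd
    have ht' : (A 0 0 : ℂ) + A 1 1 = 0 := by exact_mod_cast ht
    have hd' : (A 0 0 : ℂ) * A 1 1 - A 0 1 * A 1 0 = w ^ 2 := by exact_mod_cast hd
    rw [Matrix.det_fin_two]
    simp [Matrix.algebraMap_matrix_apply]
    linear_combination -z * ht' + hd' + (w : ℂ) ^ 2 * Complex.I_sq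
  rw [key, mul_eq_zero, sub_eq_zero, add_eq_zero_iff_eq_neg]
  simp

/-- At the critical parameter value `k = a + 2λ`, the Jacobian of the
reduced system at the interior equilibrium `(λ, ξ₁)` has trace zero, positive
determinant, and purely imaginary eigenvalues `± i w` with
`w = √(λ m₁ β₁ ξ₁ h₁)/(a+λ) > 0`. -/
theorem jacobian_purely_imaginary_at_critical_k
    (γ k m₁ β₁ a lam ρ c : ℝ)
    (hγ : 0 < γ) (hm₁ : 0 < m₁) (hβ₁ : 0 < β₁) (ha : 0 < a)
    (hρ : 1 ≤ ρ) (hc : 0 < c) (hlam : 0 < lam)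
    (hk : k = a + 2 * lam)
    (ξ₁ : ℝ) (hξ₁pos : 0 < ξ₁)
    (hξ₁ : ξ₁ + ρ * c * ξ₁ ^ ρ = γ * (a + lam) * (k - lam) / (m₁ * k))
    (h₁ : ℝ)
    (hh₁ : h₁ = 1 - ρ + ρ * γ * (a + lam) ^ 2 / (m₁ * ξ₁ * (a + 2 * lam)))
    (hh₁pos : 0 < h₁)
    (w : ℝ)
    (hw : w = Real.sqrt (lam * m₁ * β₁ * ξ₁ * h₁) / (a + lam)) :
    0 < w ∧
    Matrix.trace (planarJacobian (planarField γ k m₁ β₁ a lam ρ c) (lam, ξ₁)) = 0 ∧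
    0 < Matrix.det (planarJacobian (planarField γ k m₁ β₁ a lam ρ c) (lam, ξ₁)) ∧
    spectrum ℂ
        ((planarJacobian (planarField γ k m₁ β₁ a lam ρ c) (lam, ξ₁)).map
          Complex.ofReal)
      = {Complex.I * (w : ℂ), -(Complex.I * (w : ℂ))} := by
  have hrp : ξ₁ ^ ρ = ξ₁ * ξ₁ ^ (ρ - 1) := by
    rw [Real.rpow_sub_one hξ₁pos.ne']; field_simp
  have hJ := planarJacobian_eq γ k m₁ β₁ a lam ρ c ha hlam ξ₁ hξ₁pos
  have hpos : 0 < a + lam := by positivity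
  have hk0 : 0 < a + 2 * lam := by positivity
  have hw0 : 0 < w := by rw [hw]; positivity
  have hw2 : w ^ 2 = lam * m₁ * β₁ * ξ₁ * h₁ / (a + lam) ^ 2 := by
    rw [hw, div_pow, Real.sq_sqrt (by positivity)]
  have hX : ξ₁ + ρ * c * ξ₁ ^ ρ = γ * (a + lam) ^ 2 / (m₁ * (a + 2 * lam)) := by
    rw [hξ₁, hk]; ring
  have ht : Matrix.trace (planarJacobian (planarField γ k m₁ β₁ a lam ρ c) (lam, ξ₁)) = 0 := by
    rw [hJ, Matrix.trace_fin_two_of, hX, hk]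
    field_simp
    ring
  have hh : ξ₁ * h₁ = ξ₁ * (1 + ρ * c * (ρ * ξ₁ ^ (ρ - 1))) := by
    have : ξ₁ * h₁ = ξ₁ - ρ * ξ₁ + ρ * (γ * (a + lam) ^ 2 / (m₁ * (a + 2 * lam))) := by
      rw [hh₁]; field_simp
    rw [this, ← hX, hrp]; ring
  have hd : Matrix.det (planarJacobian (planarField γ k m₁ β₁ a lam ρ c) (lam, ξ₁)) = w ^ 2 := by
    rw [hJ, Matrix.det_fin_two_of, hw2, mul_assoc _ ξ₁ h₁, hh]
    field_simp
    ring
  exact ⟨hw0, ht, by rw [hd]; positivity, spectrum_aux _ w ht hd⟩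
end

section
/- Consider the planar system S' = γS(1 − S/k) − (x₁ + ρcx₁^ρ)·m₁S/(a+S), x₁' = β₁x₁(S−λ)/(a+S), with fixed constants γ, m₁, β₁, a > 0, ρ ≥ 1, c > 0, λ > 0, where k > λ is a bifurcation parameter, and for each such k let (λ, ξ₁(k)) denote the interior equilibrium, ξ₁(k) > 0 satisfying ξ₁ + ρcξ₁^ρ = γ(a+λ)(k−λ)/(m₁k). Assume 1 − ρ + ργ(a+λ)²/(m₁ξ₁(a+2λ)) > 0 at k = a+2λ. Then for every ε > 0 there exists k with 0 < |k − (a + 2λ)| < ε such that the system has a nonconstant periodic solution whose orbit is contained in the ball of radius ε centered at (λ, ξ₁(a+2λ)); i.e., the equilibrium (λ, ξ₁) undergoes a Hopf bifurcation at k = a + 2λ, producing periodic orbits arbitrarily close to it for parameter values arbitrarily close to a + 2λ. -/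
open Set Filter Topology

lemma ode_unique {f : ℝ → ℝ → ℝ} {K : NNReal} (hK : ∀ t, LipschitzWith K (f t))
    {x y : ℝ → ℝ} (hx : ∀ t, HasDerivAt x (f t (x t)) t) (hy : ∀ t, HasDerivAt y (f t (y t)) t)
    {t₀ : ℝ} (h : x t₀ = y t₀) : x = y :=
  ODE_solution_unique_univ (s := fun _ => univ) (fun t => (hK t).lipschitzOnWith)
    (fun t => ⟨hx t, trivial⟩) (fun t => ⟨hy t, trivial⟩) h

/-- Global solutions of bounded, Lipschitz scalar equations. -/
lemma ode_global {f : ℝ → ℝ → ℝ} {K C : NNReal} (hK : ∀ t, LipschitzWith K (f t))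
    (hC : ∀ t x, |f t x| ≤ C) (hf : ∀ x, Continuous fun t => f t x) (x₀ : ℝ) :
    ∃ x : ℝ → ℝ, x 0 = x₀ ∧ ∀ t, HasDerivAt x (f t (x t)) t := by
  have loc : ∀ n : ℕ, ∃ α : ℝ → ℝ, α 0 = x₀ ∧
      ∀ t ∈ Ioo (-((n : ℝ) + 1)) (n + 1), HasDerivAt α (f t (α t)) t := by
    intro n
    have hn : (0 : ℝ) ≤ n := Nat.cast_nonneg n
    have h0 : (0 : ℝ) ∈ Icc (-((n : ℝ) + 1)) (n + 1) := ⟨by linarith, by linarith⟩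
    have hp : IsPicardLindelof f (⟨0, h0⟩ : Icc (-((n : ℝ) + 1)) (n + 1)) x₀
        (C * ((n : NNReal) + 1)) 0 C K :=
      { lipschitzOnWith := fun t _ => (hK t).lipschitzOnWith
        continuousOn := fun x _ => (hf x).continuousOn
        norm_le := fun t _ x _ => hC t x
        mul_max_le := by simp }
    obtain ⟨α, h1, h2⟩ := hp.exists_eq_forall_mem_Icc_hasDerivWithinAt₀
    exact ⟨α, h1, fun t ht => (h2 t (Ioo_subset_Icc_self ht)).hasDerivAt (Icc_mem_nhds ht.1 ht.2)⟩
  choose α hα0 hα using loc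
  have agree : ∀ m n : ℕ, m ≤ n → ∀ t ∈ Ioo (-((m : ℝ) + 1)) (m + 1), α m t = α n t := by
    intro m n hmn
    have hm : (0 : ℝ) ≤ m := Nat.cast_nonneg m
    have hmn' : (m : ℝ) ≤ n := Nat.cast_le.mpr hmn
    have := ODE_solution_unique_of_mem_Ioo (s := fun _ => univ) (v := f) (K := K)
      (a := -((m : ℝ) + 1)) (b := m + 1) (t₀ := 0) (f := α m) (g := α n)
      (fun t _ => (hK t).lipschitzOnWith) ⟨by linarith, by linarith⟩
      (fun t ht => ⟨hα m t ht, trivial⟩)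
      (fun t ht => ⟨hα n t ⟨by linarith [ht.1], by linarith [ht.2]⟩, trivial⟩)
      (by rw [hα0, hα0])
    exact this
  refine ⟨fun t => α ⌈|t|⌉₊ t, by simp [hα0], fun t => ?_⟩
  set n := ⌈|t|⌉₊ + 1 with hn
  have key : ∀ s ∈ Ioo (-(n : ℝ)) n, α ⌈|s|⌉₊ s = α n s := by
    intro s hs
    apply agree
    · exact Nat.ceil_le.mpr (abs_le.mpr ⟨hs.1.le, hs.2.le⟩)
    · have := Nat.le_ceil |s|
      exact abs_lt.mp (by linarith)
  have ht : t ∈ Ioo (-(n : ℝ)) n := by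
    have := Nat.le_ceil |t|
    apply abs_lt.mp
    rw [hn]; push_cast; linarith
  have h1 := hα n t ⟨by linarith [ht.1], by linarith [ht.2]⟩
  show HasDerivAt _ (f t (α ⌈|t|⌉₊ t)) t
  rw [key t ht]
  refine h1.congr_of_eventuallyEq ?_
  filter_upwards [Ioo_mem_nhds ht.1 ht.2] with s hs using key s hs

/-- Periodic solutions of a periodic scalar equation via the intermediate value theorem. -/
lemma ode_periodic {f : ℝ → ℝ → ℝ} {K C : NNReal} (hK : ∀ t, LipschitzWith K (f t))
    (hC : ∀ t x, |f t x| ≤ C) (hf : ∀ x, Continuous fun t => f t x)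
    {T : ℝ} (hT : 0 ≤ T) (hper : ∀ t x, f (t + T) x = f t x)
    {A B : ℝ → ℝ} (hA : ∀ t, HasDerivAt A (f t (A t)) t) (hB : ∀ t, HasDerivAt B (f t (B t)) t)
    (hAB : A 0 ≤ B 0) (hA' : A 0 ≤ A T) (hB' : B T ≤ B 0) :
    ∃ x : ℝ → ℝ, x 0 ∈ Icc (A 0) (B 0) ∧ (∀ t, HasDerivAt x (f t (x t)) t) ∧
      ∀ t, x (t + T) = x t := by
  choose Φ hΦ0 hΦ using ode_global hK hC hf
  have hcont : Continuous fun x₀ => Φ x₀ T := by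
    have : LipschitzWith (Real.toNNReal (Real.exp (K * (T - 0)))) fun x₀ => Φ x₀ T := by
      refine LipschitzWith.of_dist_le_mul fun x y => ?_
      have := dist_le_of_trajectories_ODE (a := 0) (b := T) (δ := dist x y) hK
        (f := Φ x) (g := Φ y)
        (fun t _ => (hΦ x t).continuousAt.continuousWithinAt) (fun t _ => (hΦ x t).hasDerivWithinAt)
        (fun t _ => (hΦ y t).continuousAt.continuousWithinAt) (fun t _ => (hΦ y t).hasDerivWithinAt)
        (by rw [hΦ0, hΦ0]) T ⟨hT, le_rfl⟩
      rw [Real.coe_toNNReal _ (Real.exp_pos _).le, mul_comm]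
      exact this
    exact this.continuous
  have eA : Φ (A 0) = A := ode_unique hK (hΦ _) hA (hΦ0 _)
  have eB : Φ (B 0) = B := ode_unique hK (hΦ _) hB (hΦ0 _)
  have ivt := intermediate_value_Icc' hAB (f := fun x₀ => Φ x₀ T - x₀)
    ((hcont.sub continuous_id).continuousOn)
  obtain ⟨x₀, hx₀, hx⟩ := ivt (show (0 : ℝ) ∈ _ from ⟨by simp only [eB]; linarith, by simp only [eA]; linarith⟩)
  refine ⟨Φ x₀, by rwa [hΦ0], hΦ x₀, fun t => ?_⟩
  have : (fun t => Φ x₀ (t + T)) = Φ x₀ := by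
    refine ode_unique hK (fun t => ?_) (hΦ x₀) (t₀ := 0) ?_
    · have := (hΦ x₀ (t + T)).comp_add_const t T
      rwa [hper] at this
    · simp only [zero_add, hΦ0]
      simp only at hx
      linarith
  exact congrFun this t

/-- Time change. -/
lemma time_change {V : ℝ × ℝ → ℝ × ℝ} {w : ℝ → ℝ × ℝ} {σ : ℝ → ℝ} {T : ℝ} (hT : 0 < T)
    (hσ : Continuous σ) (hσ0 : ∀ φ, 0 < σ φ) (hσT : ∀ φ, σ (φ + T) = σ φ)
    (hw : ∀ φ, HasDerivAt w (σ φ • V (w φ)) φ) (hwT : ∀ φ, w (φ + T) = w φ) :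
    ∃ (τ : ℝ → ℝ) (P : ℝ), 0 < P ∧ Function.Surjective τ ∧
      (∀ t, HasDerivAt (fun t => w (τ t)) (V (w (τ t))) t) ∧ ∀ t, w (τ (t + P)) = w (τ t) := by
  let G : ℝ → ℝ := fun φ => ∫ x in (0:ℝ)..φ, σ x
  have hG : ∀ φ, HasDerivAt G (σ φ) φ := fun φ =>
    intervalIntegral.integral_hasDerivAt_right (hσ.intervalIntegrable _ _)
      (hσ.stronglyMeasurableAtFilter _ _) hσ.continuousAt
  have hGc : Continuous G := continuous_iff_continuousAt.mpr fun φ => (hG φ).continuousAt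
  have hmono : StrictMono G := strictMono_of_deriv_pos fun φ => by rw [(hG φ).deriv]; exact hσ0 φ
  have hG0 : G 0 = 0 := by simp [G]
  set P := G T with hP
  have hPpos : 0 < P := by rw [hP, ← hG0]; exact hmono hT
  have hGT : ∀ φ, G (φ + T) = G φ + P := by
    have h : ∀ φ, HasDerivAt (fun φ => G (φ + T) - G φ) 0 φ := fun φ => by
      have := ((hG (φ + T)).comp_add_const φ T).sub (hG φ)
      rwa [hσT, sub_self] at this
    have hc := is_const_of_deriv_eq_zero (fun φ => (h φ).differentiableAt) (fun φ => (h φ).deriv)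
    intro φ
    have := hc φ 0
    simp only [zero_add, hG0] at this
    linarith
  have hGn : ∀ n : ℕ, G (n * T) = n * P ∧ G (-(n * T)) = -(n * P) := by
    intro n
    induction n with
    | zero => simp [hG0]
    | succ n ih =>
      constructor
      · have := hGT (n * T)
        rw [ih.1] at this
        push_cast
        rw [add_mul, one_mul, this]; ring
      · have := hGT (-((n + 1 : ℕ) * T))
        have e : -(((n + 1 : ℕ) : ℝ) * T) + T = -(n * T) := by push_cast; ring
        rw [e, ih.2] at this
        push_cast at this ⊢
        linarith
  have hsurj : Function.Surjective G := by
    intro y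
    obtain ⟨n, hn⟩ := exists_nat_ge (|y| / P)
    have hn' : |y| ≤ n * P := by rwa [div_le_iff₀ hPpos] at hn
    have hnT : -(n * T) ≤ n * T := by have : 0 ≤ n * T := by positivity
                                      linarith
    obtain ⟨x, -, hx⟩ := intermediate_value_Icc hnT hGc.continuousOn
      (show y ∈ Icc _ _ by rw [(hGn n).1, (hGn n).2]; exact abs_le.mp hn')
    exact ⟨x, hx⟩
  let e : ℝ ≃o ℝ := hmono.orderIsoOfSurjective G hsurj
  have he : ∀ φ, e φ = G φ := fun φ => rfl
  have hd : ∀ t, HasDerivAt e.symm (σ (e.symm t))⁻¹ t := fun t =>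
    HasDerivAt.of_local_left_inverse (f := G) (e.symm.continuous.continuousAt) (hG _) (hσ0 _).ne'
      (Eventually.of_forall fun y => e.apply_symm_apply y)
  refine ⟨e.symm, P, hPpos, e.symm.surjective, fun t => ?_, fun t => ?_⟩
  · have := (hw (e.symm t)).scomp t (hd t)
    rwa [smul_smul, inv_mul_cancel₀ (hσ0 _).ne', one_smul] at this
  · rw [← hwT (e.symm t)]
    congr 1
    apply e.injective
    rw [e.apply_symm_apply, he, hGT, ← he, e.apply_symm_apply]

lemma exists_primitive {f : ℝ → ℝ} {R : ℝ} (hR : 0 ≤ R) (hf : ContinuousOn f (Icc (-R) R)) :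
    ∃ F : ℝ → ℝ, ∀ x ∈ Ioo (-R) R, HasDerivAt F (f x) x := by
  have h : -R ≤ R := by linarith
  have hc : Continuous (IccExtend h ((Icc (-R) R).domRestrict f)) :=
    (continuousOn_iff_continuous_domRestrict.mp hf).Icc_extend'
  refine ⟨fun y => ∫ x in (0:ℝ)..y, IccExtend h ((Icc (-R) R).domRestrict f) x, fun x hx => ?_⟩
  have := intervalIntegral.integral_hasDerivAt_right (hc.intervalIntegrable 0 x)
      (hc.stronglyMeasurableAtFilter _ _) hc.continuousAt
  rwa [IccExtend_of_mem _ _ (Ioo_subset_Icc_self hx)] at this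

/-- radial part of the field in polar coordinates -/
noncomputable def pN (lam k d ψ r φ : ℝ) : ℝ :=
  Real.cos φ * (k * (d * Real.cos φ - r * Real.cos φ ^ 2) - Real.sin φ) +
    ψ * Real.sin φ * Real.cos φ / (lam + r * Real.cos φ)

/-- angular part of the field in polar coordinates -/
noncomputable def pD (lam k d ψ r φ : ℝ) : ℝ :=
  ψ * Real.cos φ ^ 2 / (lam + r * Real.cos φ) + Real.sin φ ^ 2 -
    k * Real.sin φ * Real.cos φ * (d - r * Real.cos φ)

lemma polar_alg1 {lam k d ψ r φ : ℝ} :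
    pN lam k d ψ r φ * Real.cos φ - pD lam k d ψ r φ * Real.sin φ
      = k * (d * Real.cos φ - r * Real.cos φ ^ 2) - Real.sin φ := by
  have h : Real.sin φ ^ 2 = 1 - Real.cos φ ^ 2 := Real.sin_sq φ
  unfold pN pD
  linear_combination (k * (d * Real.cos φ - r * Real.cos φ ^ 2) - Real.sin φ) * h

lemma polar_alg2 {lam k d ψ r φ : ℝ} :
    pN lam k d ψ r φ * Real.sin φ + pD lam k d ψ r φ * Real.cos φ
      = ψ * Real.cos φ / (lam + r * Real.cos φ) := by
  have h : Real.sin φ ^ 2 = 1 - Real.cos φ ^ 2 := Real.sin_sq φ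
  unfold pN pD
  linear_combination (ψ * Real.cos φ / (lam + r * Real.cos φ)) * h

lemma polar_deriv {lam k d ψ φ : ℝ} {s : ℝ → ℝ}
    (hD : pD lam k d ψ (Real.exp (s φ)) φ ≠ 0)
    (hs : HasDerivAt s (pN lam k d ψ (Real.exp (s φ)) φ / pD lam k d ψ (Real.exp (s φ)) φ) φ) :
    HasDerivAt (fun φ => Real.exp (s φ) * Real.cos φ)
      ((k * (d * (Real.exp (s φ) * Real.cos φ) - (Real.exp (s φ) * Real.cos φ) ^ 2)
        - Real.exp (s φ) * Real.sin φ) / pD lam k d ψ (Real.exp (s φ)) φ) φ ∧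
    HasDerivAt (fun φ => Real.exp (s φ) * Real.sin φ)
      (ψ * (Real.exp (s φ) * Real.cos φ) / (lam + Real.exp (s φ) * Real.cos φ)
        / pD lam k d ψ (Real.exp (s φ)) φ) φ := by
  constructor
  · refine (hs.exp.mul (Real.hasDerivAt_cos φ)).congr_deriv ?_
    symm
    rw [div_eq_iff hD]
    have := polar_alg1 (lam := lam) (k := k) (d := d) (ψ := ψ) (r := Real.exp (s φ)) (φ := φ)
    have e : pN lam k d ψ (Real.exp (s φ)) φ / pD lam k d ψ (Real.exp (s φ)) φ
      * pD lam k d ψ (Real.exp (s φ)) φ = pN lam k d ψ (Real.exp (s φ)) φ := div_mul_cancel₀ _ hD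
    linear_combination - Real.exp (s φ) * this - Real.exp (s φ) * Real.cos φ * e
  · refine (hs.exp.mul (Real.hasDerivAt_sin φ)).congr_deriv ?_
    symm
    rw [div_eq_iff hD]
    have := polar_alg2 (lam := lam) (k := k) (d := d) (ψ := ψ) (r := Real.exp (s φ)) (φ := φ)
    have e : pN lam k d ψ (Real.exp (s φ)) φ / pD lam k d ψ (Real.exp (s φ)) φ
      * pD lam k d ψ (Real.exp (s φ)) φ = pN lam k d ψ (Real.exp (s φ)) φ := div_mul_cancel₀ _ hD
    linear_combination - Real.exp (s φ) * this - Real.exp (s φ) * Real.sin φ * e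

/-- the potential in the prey variable -/
noncomputable def potA (lam u : ℝ) : ℝ := u - lam * Real.log (lam + u)

lemma potA_deriv {lam u : ℝ} (h : 0 < lam + u) :
    HasDerivAt (potA lam) (u / (lam + u)) u := by
  have h1 : HasDerivAt (fun u => lam + u) 1 u := (hasDerivAt_id u).const_add lam
  refine ((hasDerivAt_id u).sub ((h1.log h.ne').const_mul lam)).congr_deriv ?_
  field_simp
  ring

lemma potA_mono {lam : ℝ} (hl : 0 < lam) : StrictMonoOn (potA lam) (Ici 0) := by
  apply strictMonoOn_of_deriv_pos (convex_Ici 0)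
  · intro u hu
    have hu : 0 ≤ u := hu
    exact (potA_deriv (by linarith)).continuousAt.continuousWithinAt
  · intro u hu
    rw [interior_Ici] at hu
    have hu : 0 < u := hu
    rw [(potA_deriv (by linarith)).deriv]
    positivity

lemma potB_anti {lam : ℝ} (hl : 0 < lam) :
    StrictAntiOn (fun u => 2 * lam * (potA lam u - potA lam 0) - u ^ 2) (Ioi (-lam)) := by
  have hd : ∀ u, -lam < u → HasDerivAt (fun u => 2 * lam * (potA lam u - potA lam 0) - u ^ 2)
      (-(2 * u ^ 2 / (lam + u))) u := by
    intro u hu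
    have hp : 0 < lam + u := by linarith
    refine ((((potA_deriv hp).sub_const _).const_mul (2 * lam)).sub
      (hasDerivAt_pow 2 u)).congr_deriv ?_
    field_simp
    ring
  have hcont : ContinuousOn (fun u => 2 * lam * (potA lam u - potA lam 0) - u ^ 2) (Ioi (-lam)) :=
    fun u hu => (hd u hu).continuousAt.continuousWithinAt
  have h1 : StrictAntiOn (fun u => 2 * lam * (potA lam u - potA lam 0) - u ^ 2) (Ioc (-lam) 0) := by
    apply strictAntiOn_of_deriv_neg (convex_Ioc _ _) (hcont.mono fun x hx => hx.1)
    intro u hu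
    rw [interior_Ioc] at hu
    rw [(hd u hu.1).deriv]
    have : 0 < lam + u := by linarith [hu.1]
    have : 0 < u ^ 2 := by have := hu.2.ne; positivity
    rw [neg_lt_zero]; positivity
  have h2 : StrictAntiOn (fun u => 2 * lam * (potA lam u - potA lam 0) - u ^ 2) (Ici 0) := by
    apply strictAntiOn_of_deriv_neg (convex_Ici _) (hcont.mono fun x hx => lt_of_lt_of_le (neg_lt_zero.mpr hl) hx)
    intro u hu
    rw [interior_Ici] at hu
    have hu : 0 < u := hu
    rw [(hd u (by linarith)).deriv]
    rw [neg_lt_zero]; positivity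
  have e : Ioi (-lam) = Ioc (-lam) 0 ∪ Ici 0 := (Ioc_union_Ici_eq_Ioi (by linarith)).symm
  rw [e]
  exact StrictAntiOn.union h1 h2 ⟨⟨by linarith, le_rfl⟩, fun x hx => hx.2⟩ ⟨self_mem_Ici, fun x hx => hx⟩

/-- sign of the derivative of the Lyapunov function at criticality -/
lemma potB_sign {lam u : ℝ} (hl : 0 < lam) (hu : -lam < u) :
    u * (2 * lam * (potA lam u - potA lam 0) - u ^ 2) ≤ 0 ∧
    (u ≠ 0 → u * (2 * lam * (potA lam u - potA lam 0) - u ^ 2) < 0) := by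
  have key : u ≠ 0 → u * (2 * lam * (potA lam u - potA lam 0) - u ^ 2) < 0 := by
    intro h0
    have hz : (0 : ℝ) ∈ Ioi (-lam) := by simp [hl]
    rcases lt_or_gt_of_ne h0 with h | h
    · have := potB_anti hl (show u ∈ Ioi (-lam) from hu) hz h
      simp only [sub_self, mul_zero, ne_eq, OfNat.ofNat_ne_zero, not_false_eq_true, zero_pow] at this
      exact mul_neg_of_neg_of_pos h this
    · have := potB_anti hl hz (show u ∈ Ioi (-lam) from hu) h
      simp only [sub_self, mul_zero, ne_eq, OfNat.ofNat_ne_zero, not_false_eq_true, zero_pow] at this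
      exact mul_neg_of_pos_of_neg h this
  refine ⟨?_, key⟩
  by_cases h : u = 0
  · simp [h]
  · exact (key h).le

lemma exists_EG (θ : ℝ) {ψ : ℝ → ℝ} {R R' : ℝ} (hR : 0 < R) (hRR : R < R')
    (hc : ContinuousOn ψ (Icc (-R') R')) (hpos : ∀ p ∈ Icc (-R') R', 0 < ψ p) :
    ∃ E G : ℝ → ℝ, (∀ p, 0 < E p) ∧ ∀ p ∈ Ioo (-R) R,
      HasDerivAt E (θ * E p / ψ p) p ∧ HasDerivAt G (E p * p / ψ p) p := by
  obtain ⟨L, hL⟩ := exists_primitive (hR.trans hRR).le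
    (f := fun p => θ / ψ p) (continuousOn_const.div hc fun p hp => (hpos p hp).ne')
  have hsub : Icc (-R) R ⊆ Ioo (-R') R' := fun p hp => ⟨by linarith [hp.1], by linarith [hp.2]⟩
  have hLc : ContinuousOn L (Icc (-R) R) := fun p hp =>
    (hL p (hsub hp)).continuousAt.continuousWithinAt
  have hsub' := hsub.trans Ioo_subset_Icc_self
  obtain ⟨G, hG⟩ := exists_primitive hR.le
    (f := fun p => Real.exp (L p) * p / ψ p)
    ((hLc.rexp.mul continuousOn_id).div (hc.mono hsub') fun p hp => (hpos p (hsub' hp)).ne')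
  refine ⟨fun p => Real.exp (L p), G, fun p => Real.exp_pos _, fun p hp => ⟨?_, hG p hp⟩⟩
  refine (hL p (hsub (Ioo_subset_Icc_self hp))).exp.congr_deriv ?_
  ring

/-- Derivative of the Lyapunov function along solutions. -/
lemma energy_deriv {lam k d θ R φ : ℝ} {ψ E G s : ℝ → ℝ}
    (hEG : ∀ p ∈ Ioo (-R) R, HasDerivAt E (θ * E p / ψ p) p ∧ HasDerivAt G (E p * p / ψ p) p)
    (hψ : ψ (Real.exp (s φ) * Real.sin φ) ≠ 0)
    (hR : Real.exp (s φ) < R) (hRl : R ≤ lam)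
    (hD : pD lam k d (ψ (Real.exp (s φ) * Real.sin φ)) (Real.exp (s φ)) φ ≠ 0)
    (hs : HasDerivAt s (pN lam k d (ψ (Real.exp (s φ) * Real.sin φ)) (Real.exp (s φ)) φ /
      pD lam k d (ψ (Real.exp (s φ) * Real.sin φ)) (Real.exp (s φ)) φ) φ) :
    HasDerivAt (fun φ => E (Real.exp (s φ) * Real.sin φ) *
        (potA lam (Real.exp (s φ) * Real.cos φ) - potA lam 0) + G (Real.exp (s φ) * Real.sin φ))
      (E (Real.exp (s φ) * Real.sin φ) *
        (Real.exp (s φ) * Real.cos φ * (θ * (potA lam (Real.exp (s φ) * Real.cos φ) - potA lam 0)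
          + k * (d * (Real.exp (s φ) * Real.cos φ) - (Real.exp (s φ) * Real.cos φ) ^ 2))) /
        (lam + Real.exp (s φ) * Real.cos φ) /
        pD lam k d (ψ (Real.exp (s φ) * Real.sin φ)) (Real.exp (s φ)) φ) φ := by
  obtain ⟨hu, hp⟩ := polar_deriv hD hs
  have hr := Real.exp_pos (s φ)
  have c1 := Real.neg_one_le_cos φ
  have c2 := Real.cos_le_one φ
  have s1 := Real.neg_one_le_sin φ
  have s2 := Real.sin_le_one φ
  have hpm : Real.exp (s φ) * Real.sin φ ∈ Ioo (-R) R := ⟨by nlinarith, by nlinarith⟩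
  have hum : 0 < lam + Real.exp (s φ) * Real.cos φ := by nlinarith
  obtain ⟨hE, hG⟩ := hEG _ hpm
  have h1 := hE.comp φ hp
  have h2 := hG.comp φ hp
  have h3 := (potA_deriv hum).comp φ hu
  refine ((h1.mul (h3.sub_const (potA lam 0))).add h2).congr_deriv ?_
  simp only [Function.comp]
  generalize pD lam k d (ψ (Real.exp (s φ) * Real.sin φ)) (Real.exp (s φ)) φ = D at *
  field_simp
  ring

lemma energy_up {lam k d R R' : ℝ} {ψ s : ℝ → ℝ} (hR0 : 0 < R) (hRR : R < R') (hRl : R ≤ lam)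
    (hc : ContinuousOn ψ (Icc (-R') R')) (hpos : ∀ p ∈ Icc (-R') R', 0 < ψ p) (hk : 0 ≤ k)
    (hs : ∀ φ ∈ Icc 0 (2 * Real.pi), Real.exp (s φ) < R ∧ Real.exp (s φ) ≤ d ∧
      0 < pD lam k d (ψ (Real.exp (s φ) * Real.sin φ)) (Real.exp (s φ)) φ ∧
      HasDerivAt s (pN lam k d (ψ (Real.exp (s φ) * Real.sin φ)) (Real.exp (s φ)) φ /
        pD lam k d (ψ (Real.exp (s φ) * Real.sin φ)) (Real.exp (s φ)) φ) φ) :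
    s 0 ≤ s (2 * Real.pi) := by
  obtain ⟨E, G, hE, hEG⟩ := exists_EG 0 hR0 hRR hc hpos
  have hpi : 0 ≤ 2 * Real.pi := by positivity
  have hd := fun φ (hφ : φ ∈ Icc 0 (2 * Real.pi)) => by
    obtain ⟨h1, h2, h3, h4⟩ := hs φ hφ
    have hr := Real.exp_pos (s φ)
    have s1 := Real.neg_one_le_sin φ
    have s2 := Real.sin_le_one φ
    exact energy_deriv (θ := 0) hEG (hpos _ ⟨by nlinarith, by nlinarith⟩).ne' h1 hRl h3.ne' h4
  have hmono := monotoneOn_of_deriv_nonneg (convex_Icc 0 (2 * Real.pi))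
    (fun φ hφ => (hd φ hφ).continuousAt.continuousWithinAt)
    (fun φ hφ => (hd φ (interior_subset hφ)).differentiableAt.differentiableWithinAt)
    (fun φ hφ => by
      rw [(hd φ (interior_subset hφ)).deriv]
      obtain ⟨h1, h2, h3, h4⟩ := hs φ (interior_subset hφ)
      have hr := Real.exp_pos (s φ)
      have c1 := Real.neg_one_le_cos φ
      have c2 := Real.cos_le_one φ
      have hu : 0 < lam + Real.exp (s φ) * Real.cos φ := by nlinarith
      have hud : 0 ≤ d - Real.exp (s φ) * Real.cos φ := by nlinarith
      refine div_nonneg (div_nonneg (mul_nonneg (hE _).le ?_) hu.le) h3.le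
      have := mul_nonneg (mul_nonneg hk (sq_nonneg (Real.exp (s φ) * Real.cos φ))) hud
      nlinarith)
  have h := hmono ⟨le_rfl, hpi⟩ ⟨hpi, le_rfl⟩ hpi
  simp only [Real.sin_zero, Real.cos_zero, Real.sin_two_pi, Real.cos_two_pi, mul_zero, mul_one] at h
  have h' : potA lam (Real.exp (s 0)) ≤ potA lam (Real.exp (s (2 * Real.pi))) := by
    have := hE 0
    have h2 : E 0 * (potA lam (Real.exp (s 0)) - potA lam 0) ≤
      E 0 * (potA lam (Real.exp (s (2 * Real.pi))) - potA lam 0) := by linarith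
    have := le_of_mul_le_mul_left h2 this
    linarith
  rw [(potA_mono (hR0.trans_le hRl)).le_iff_le (Real.exp_pos _).le (Real.exp_pos _).le] at h'
  exact Real.exp_le_exp.mp h'

lemma energy_down {lam k R R' : ℝ} {ψ s : ℝ → ℝ} (hR0 : 0 < R) (hRR : R < R') (hRl : R ≤ lam)
    (hc : ContinuousOn ψ (Icc (-R') R')) (hpos : ∀ p ∈ Icc (-R') R', 0 < ψ p) (hk : 0 < k)
    (hs : ∀ φ ∈ Icc 0 (2 * Real.pi), Real.exp (s φ) < R ∧
      0 < pD lam k 0 (ψ (Real.exp (s φ) * Real.sin φ)) (Real.exp (s φ)) φ ∧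
      HasDerivAt s (pN lam k 0 (ψ (Real.exp (s φ) * Real.sin φ)) (Real.exp (s φ)) φ /
        pD lam k 0 (ψ (Real.exp (s φ) * Real.sin φ)) (Real.exp (s φ)) φ) φ) :
    s (2 * Real.pi) < s 0 := by
  obtain ⟨E, G, hE, hEG⟩ := exists_EG (2 * lam * k) hR0 hRR hc hpos
  have hpi : 3 ≤ Real.pi := Real.pi_gt_three.le
  have hl : 0 < lam := hR0.trans_le hRl
  have hd := fun φ (hφ : φ ∈ Icc 0 (2 * Real.pi)) => by
    obtain ⟨h1, h3, h4⟩ := hs φ hφ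
    have hr := Real.exp_pos (s φ)
    have s1 := Real.neg_one_le_sin φ
    have s2 := Real.sin_le_one φ
    exact energy_deriv (θ := 2 * lam * k) hEG (hpos _ ⟨by nlinarith, by nlinarith⟩).ne' h1 hRl h3.ne' h4
  have hanti := antitoneOn_of_deriv_nonpos (convex_Icc 0 (2 * Real.pi))
    (fun φ hφ => (hd φ hφ).continuousAt.continuousWithinAt)
    (fun φ hφ => (hd φ (interior_subset hφ)).differentiableAt.differentiableWithinAt)
    (fun φ hφ => by
      rw [(hd φ (interior_subset hφ)).deriv]
      obtain ⟨h1, h3, h4⟩ := hs φ (interior_subset hφ)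
      have hr := Real.exp_pos (s φ)
      have c1 := Real.neg_one_le_cos φ
      have hu : 0 < lam + Real.exp (s φ) * Real.cos φ := by nlinarith
      refine div_nonpos_of_nonpos_of_nonneg (div_nonpos_of_nonpos_of_nonneg
        (mul_nonpos_of_nonneg_of_nonpos (hE _).le ?_) hu.le) h3.le
      have := mul_nonpos_of_nonneg_of_nonpos hk.le
        (potB_sign hl (show -lam < Real.exp (s φ) * Real.cos φ by linarith)).1
      refine le_trans (le_of_eq ?_) this
      ring)
  have hsub : Icc 0 1 ⊆ Icc 0 (2 * Real.pi) := Icc_subset_Icc le_rfl (by linarith)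
  have hstrict := strictAntiOn_of_deriv_neg (convex_Icc (0 : ℝ) 1)
    (fun φ hφ => (hd φ (hsub hφ)).continuousAt.continuousWithinAt)
    (fun φ hφ => by
      have hφ' := hsub (interior_subset hφ)
      rw [(hd φ hφ').deriv]
      obtain ⟨h1, h3, h4⟩ := hs φ hφ'
      have hr := Real.exp_pos (s φ)
      have c1 := Real.neg_one_le_cos φ
      have hu : 0 < lam + Real.exp (s φ) * Real.cos φ := by nlinarith
      have hφ2 := interior_subset hφ
      have hcos : 0 < Real.cos φ := Real.cos_pos_of_mem_Ioo ⟨by linarith [hφ2.1], by linarith [hφ2.2]⟩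
      refine div_neg_of_neg_of_pos (div_neg_of_neg_of_pos
        (mul_neg_of_pos_of_neg (hE _) ?_) hu) h3
      have := mul_neg_of_pos_of_neg hk
        ((potB_sign hl (show -lam < Real.exp (s φ) * Real.cos φ by linarith)).2 (by positivity))
      refine lt_of_le_of_lt (le_of_eq ?_) this
      ring)
  have hA := hanti (show (1 : ℝ) ∈ Icc 0 (2 * Real.pi) from ⟨zero_le_one, by linarith⟩)
    (show 2 * Real.pi ∈ Icc 0 (2 * Real.pi) from ⟨by linarith, le_rfl⟩) (by linarith)
  have hB := hstrict (show (0 : ℝ) ∈ Icc 0 1 from ⟨le_rfl, zero_le_one⟩)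
    (show (1 : ℝ) ∈ Icc 0 1 from ⟨zero_le_one, le_rfl⟩) zero_lt_one
  have h := lt_of_le_of_lt hA hB
  simp only [Real.sin_zero, Real.cos_zero, Real.sin_two_pi, Real.cos_two_pi, mul_zero, mul_one] at h
  have h' : potA lam (Real.exp (s (2 * Real.pi))) < potA lam (Real.exp (s 0)) := by
    have := hE 0
    have h2 : E 0 * (potA lam (Real.exp (s (2 * Real.pi))) - potA lam 0) <
      E 0 * (potA lam (Real.exp (s 0)) - potA lam 0) := by linarith
    have := lt_of_mul_lt_mul_left h2 this.le
    linarith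
  rw [(potA_mono hl).lt_iff_lt (Real.exp_pos _).le (Real.exp_pos _).le] at h'
  exact Real.exp_lt_exp.mp h'

/-- right hand side of the scalar equation -/
noncomputable def pM (lam : ℝ) (Ψ κ q : ℝ → ℝ) (δ r φ : ℝ) : ℝ :=
  pN lam (κ δ) δ (Ψ (q δ + r * Real.sin φ)) r φ / pD lam (κ δ) δ (Ψ (q δ + r * Real.sin φ)) r φ

lemma reduce_angle (φ : ℝ) : ∃ φ' ∈ Icc 0 (2 * Real.pi),
    Real.cos φ = Real.cos φ' ∧ Real.sin φ = Real.sin φ' := by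
  have hp : Function.Periodic (fun φ => (Real.cos φ, Real.sin φ)) (2 * Real.pi) := fun φ => by simp
  obtain ⟨y, hy, h⟩ := hp.exists_mem_Ico₀ (by positivity) φ
  exact ⟨y, Ico_subset_Icc_self hy, congrArg Prod.fst h, congrArg Prod.snd h⟩

lemma box {lam : ℝ} (hl : 0 < lam) {Ψ κ q : ℝ → ℝ} (hΨ : ContDiffAt ℝ 1 Ψ (q 0))
    (hΨ0 : 0 < Ψ (q 0)) (hκ : ContDiffAt ℝ 1 κ 0) (hκ0 : 0 < κ 0) (hq : ContDiffAt ℝ 1 q 0)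
    {ε : ℝ} (hε : 0 < ε) :
    ∃ R : ℝ, 0 < R ∧ R < ε ∧ R < lam ∧
      (∀ δ ∈ Icc 0 R, 0 < κ δ) ∧
      (∀ δ ∈ Icc 0 R, ∀ p ∈ Icc (-(2 * R)) (2 * R), ContinuousAt Ψ (q δ + p) ∧ 0 < Ψ (q δ + p)) ∧
      (∀ δ ∈ Icc 0 R, ∀ r ∈ Icc 0 R, ∀ φ, 0 < pD lam (κ δ) δ (Ψ (q δ + r * Real.sin φ)) r φ) ∧
      (∃ C : NNReal, ∀ δ ∈ Icc 0 R, ∀ r ∈ Icc 0 R, ∀ φ, |pM lam Ψ κ q δ r φ| ≤ C) ∧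
      (∃ K : NNReal, ∀ δ ∈ Icc 0 R, ∀ r ∈ Icc 0 R, ∀ δ' ∈ Icc 0 R, ∀ r' ∈ Icc 0 R, ∀ φ,
        |pM lam Ψ κ q δ r φ - pM lam Ψ κ q δ' r' φ| ≤ K * max |δ - δ'| |r - r'|) := by
  let F : (ℝ × ℝ) × ℝ → ℝ := fun z => pM lam Ψ κ q z.1.1 z.1.2 z.2
  let Dn : (ℝ × ℝ) × ℝ → ℝ := fun z =>
    pD lam (κ z.1.1) z.1.1 (Ψ (q z.1.1 + z.1.2 * Real.sin z.2)) z.1.2 z.2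
  let Nn : (ℝ × ℝ) × ℝ → ℝ := fun z =>
    pN lam (κ z.1.1) z.1.1 (Ψ (q z.1.1 + z.1.2 * Real.sin z.2)) z.1.2 z.2
  have hev1 : ∀ᶠ x : ℝ × ℝ in 𝓝 (0, 0), ∀ φ ∈ Icc 0 (2 * Real.pi),
      ContDiffAt ℝ 1 F (x, φ) ∧ 0 < Dn (x, φ) := by
    apply isCompact_Icc.eventually_forall_of_forall_eventually
    intro φ _
    have cδ : ContDiffAt ℝ 1 (fun z : (ℝ × ℝ) × ℝ => z.1.1) ((0, 0), φ) := by fun_prop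
    have cr : ContDiffAt ℝ 1 (fun z : (ℝ × ℝ) × ℝ => z.1.2) ((0, 0), φ) := by fun_prop
    have cs : ContDiffAt ℝ 1 (fun z : (ℝ × ℝ) × ℝ => Real.sin z.2) ((0, 0), φ) := by fun_prop
    have cc : ContDiffAt ℝ 1 (fun z : (ℝ × ℝ) × ℝ => Real.cos z.2) ((0, 0), φ) := by fun_prop
    have cκ : ContDiffAt ℝ 1 (fun z : (ℝ × ℝ) × ℝ => κ z.1.1) ((0, 0), φ) :=
      ContDiffAt.comp (g := κ) ((0, 0), φ) hκ cδ
    have cq : ContDiffAt ℝ 1 (fun z : (ℝ × ℝ) × ℝ => q z.1.1) ((0, 0), φ) :=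
      ContDiffAt.comp (g := q) ((0, 0), φ) hq cδ
    have cΨ : ContDiffAt ℝ 1 (fun z : (ℝ × ℝ) × ℝ => Ψ (q z.1.1 + z.1.2 * Real.sin z.2))
        ((0, 0), φ) :=
      ContDiffAt.comp (g := Ψ) ((0, 0), φ) (by simpa using hΨ) (cq.add (cr.mul cs))
    have hne : lam + (((0 : ℝ), (0 : ℝ)), φ).1.2 * Real.cos φ ≠ 0 := by simpa using hl.ne'
    have cD : ContDiffAt ℝ 1 Dn ((0, 0), φ) := by
      simp only [Dn, pD]
      exact (((cΨ.mul (cc.pow 2)).div (contDiffAt_const.add (cr.mul cc)) hne).add (cs.pow 2)).sub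
        (((cκ.mul cs).mul cc).mul (cδ.sub (cr.mul cc)))
    have cN : ContDiffAt ℝ 1 Nn ((0, 0), φ) := by
      simp only [Nn, pN]
      exact (cc.mul ((cκ.mul ((cδ.mul cc).sub (cr.mul (cc.pow 2)))).sub cs)).add
        (((cΨ.mul cs).mul cc).div (contDiffAt_const.add (cr.mul cc)) hne)
    have hD0 : 0 < Dn ((0, 0), φ) := by
      simp only [Dn, pD, zero_mul, add_zero, sub_zero, mul_zero]
      by_cases hc : Real.cos φ = 0
      · have : Real.sin φ ^ 2 = 1 := by rw [Real.sin_sq, hc]; norm_num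
        rw [this, hc]; norm_num
      · positivity
    have cF : ContDiffAt ℝ 1 F ((0, 0), φ) := cN.div cD hD0.ne'
    exact (cF.eventually (by simp)).and (cD.continuousAt.eventually (lt_mem_nhds hD0))
  have hev2 : ∀ᶠ x : ℝ × ℝ in 𝓝 (0, 0), 0 < κ x.1 := by
    have : ContinuousAt (fun x : ℝ × ℝ => κ x.1) (0, 0) :=
      ContinuousAt.comp (g := κ) hκ.continuousAt continuousAt_fst
    exact this.eventually (lt_mem_nhds hκ0)
  have hev3 : ∀ᶠ x : ℝ × ℝ in 𝓝 (0, 0), ContinuousAt Ψ (q x.1 + x.2) ∧ 0 < Ψ (q x.1 + x.2) := by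
    have h1 : ContinuousAt (fun x : ℝ × ℝ => q x.1 + x.2) (0, 0) :=
      (ContinuousAt.comp (g := q) (f := Prod.fst) (x := ((0 : ℝ), (0 : ℝ))) hq.continuousAt
        continuousAt_fst).add continuousAt_snd
    have h2 : ∀ᶠ y in 𝓝 (q 0), ContinuousAt Ψ y ∧ 0 < Ψ y :=
      ((hΨ.eventually (by simp)).mono fun y hy => hy.continuousAt).and
        (hΨ.continuousAt.eventually (lt_mem_nhds hΨ0))
    have h3 : Tendsto (fun x : ℝ × ℝ => q x.1 + x.2) (𝓝 (0, 0)) (𝓝 (q 0)) := by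
      have := h1.tendsto
      simpa using this
    exact h3.eventually h2
  obtain ⟨η, hη, hball⟩ := Metric.eventually_nhds_iff.mp (hev1.and (hev2.and hev3))
  have hball' : ∀ x y : ℝ, |x| < η → |y| < η → _ := fun x y hx hy => @hball (x, y) (by
    rw [Prod.dist_eq]; simpa using ⟨hx, hy⟩)
  set R := min (η / 3) (min (ε / 2) (lam / 2)) with hRdef
  have hR : 0 < R := by positivity
  have hR1 : R ≤ η / 3 := min_le_left _ _
  have hR2 : R ≤ ε / 2 := (min_le_right _ _).trans (min_le_left _ _)
  have hR3 : R ≤ lam / 2 := (min_le_right _ _).trans (min_le_right _ _)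
  have habs : ∀ δ ∈ Icc 0 R, |δ| < η := fun δ hδ => by
    rw [abs_of_nonneg hδ.1]; linarith [hδ.2]
  set S : Set ((ℝ × ℝ) × ℝ) := (Icc 0 R ×ˢ Icc 0 R) ×ˢ Icc 0 (2 * Real.pi) with hS
  have hSc : IsCompact S := (isCompact_Icc.prod isCompact_Icc).prod isCompact_Icc
  have hSd : ∀ z ∈ S, ContDiffAt ℝ 1 F z := fun z hz =>
    ((hball' z.1.1 z.1.2 (habs _ hz.1.1) (habs _ hz.1.2)).1 z.2 hz.2).1
  have hMred : ∀ δ r φ φ', Real.cos φ = Real.cos φ' → Real.sin φ = Real.sin φ' →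
      pM lam Ψ κ q δ r φ = pM lam Ψ κ q δ r φ' := by
    intro δ r φ φ' h1 h2
    simp only [pM, pN, pD, h1, h2]
  refine ⟨R, hR, by linarith, by linarith, ?_, ?_, ?_, ?_, ?_⟩
  · intro δ hδ
    exact (hball' δ 0 (habs _ hδ) (by simpa using hη)).2.1
  · intro δ hδ p hp
    exact (hball' δ p (habs _ hδ) (abs_lt.mpr ⟨by linarith [hp.1], by linarith [hp.2]⟩)).2.2
  · intro δ hδ r hr φ
    obtain ⟨φ', hφ', h1, h2⟩ := reduce_angle φ
    have := ((hball' δ r (habs _ hδ) (habs _ hr)).1 φ' hφ').2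
    simp only [Dn, pD] at this
    simpa only [pD, h1, h2] using this
  · obtain ⟨C, hC⟩ := hSc.exists_bound_of_continuousOn (f := F)
      (fun z hz => (hSd z hz).continuousAt.continuousWithinAt)
    refine ⟨C.toNNReal, fun δ hδ r hr φ => ?_⟩
    obtain ⟨φ', hφ', h1, h2⟩ := reduce_angle φ
    rw [hMred _ _ _ _ h1 h2]
    exact (hC ((δ, r), φ') ⟨⟨hδ, hr⟩, hφ'⟩).trans (Real.le_coe_toNNReal C)
  · have hloc : LocallyLipschitzOn S F := by
      intro z hz
      obtain ⟨K, t, ht, hK⟩ := (hSd z hz).exists_lipschitzOnWith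
      exact ⟨K, t, mem_nhdsWithin_of_mem_nhds ht, hK⟩
    obtain ⟨K, hK⟩ := hloc.exists_lipschitzOnWith_of_compact hSc
    refine ⟨K, fun δ hδ r hr δ' hδ' r' hr' φ => ?_⟩
    obtain ⟨φ', hφ', h1, h2⟩ := reduce_angle φ
    rw [hMred _ _ _ _ h1 h2, hMred _ _ _ _ h1 h2]
    have := hK.dist_le_mul ((δ, r), φ') ⟨⟨hδ, hr⟩, hφ'⟩ ((δ', r'), φ') ⟨⟨hδ', hr'⟩, hφ'⟩
    simpa [Prod.dist_eq, Real.dist_eq, F] using this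

lemma exp_min_lip (l x y : ℝ) :
    |Real.exp (min x l) - Real.exp (min y l)| ≤ Real.exp l * |x - y| := by
  wlog h : x ≤ y generalizing x y
  · rw [abs_sub_comm, abs_sub_comm x y]
    exact this y x (le_of_not_ge h)
  have h1 : min x l ≤ min y l := min_le_min_right l h
  have h2 : min y l - min x l ≤ y - x := by
    rcases le_total y l with hy | hy <;> rcases le_total x l with hx | hx <;>
      simp only [hx, hy, min_eq_left, min_eq_right] <;> linarith
  have h3 := Real.exp_le_exp.mpr h1
  rw [abs_sub_comm, abs_sub_comm x y, abs_of_nonneg (by linarith), abs_of_nonneg (by linarith)]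
  have h4 := Real.add_one_le_exp (min x l - min y l)
  have h5 : Real.exp (min x l) = Real.exp (min y l) * Real.exp (min x l - min y l) := by
    rw [← Real.exp_add]; congr 1; ring
  have h6 : Real.exp (min y l) ≤ Real.exp l := Real.exp_le_exp.mpr (min_le_right _ _)
  have h7 := Real.exp_pos (min y l)
  rw [h5]
  calc Real.exp (min y l) - Real.exp (min y l) * Real.exp (min x l - min y l)
      ≤ Real.exp (min y l) * (min y l - min x l) := by nlinarith
    _ ≤ Real.exp l * (y - x) := by
      apply mul_le_mul h6 h2 (by linarith) (Real.exp_pos _).le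

theorem hopf_core {lam : ℝ} (hl : 0 < lam) {Ψ κ q : ℝ → ℝ} (hΨ : ContDiffAt ℝ 1 Ψ (q 0))
    (hΨ0 : 0 < Ψ (q 0)) (hκ : ContDiffAt ℝ 1 κ 0) (hκ0 : 0 < κ 0) (hq : ContDiffAt ℝ 1 q 0)
    {ε : ℝ} (hε : 0 < ε) :
    ∃ δ : ℝ, 0 < δ ∧ δ < ε ∧ ∃ s : ℝ → ℝ, (∀ φ, s (φ + 2 * Real.pi) = s φ) ∧
      ∀ φ, Real.exp (s φ) < ε ∧ Real.exp (s φ) < lam ∧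
        0 < pD lam (κ δ) δ (Ψ (q δ + Real.exp (s φ) * Real.sin φ)) (Real.exp (s φ)) φ ∧
        HasDerivAt s (pM lam Ψ κ q δ (Real.exp (s φ)) φ) φ := by
  obtain ⟨R, hR, hRε, hRl, bκ, bΨ, bD, ⟨C, bC⟩, ⟨K, bK⟩⟩ := box hl hΨ hΨ0 hκ hκ0 hq hε
  have hpi : 0 < 2 * Real.pi := by positivity
  set l := Real.log R with hl_def
  have hel : Real.exp l = R := Real.exp_log hR
  have hmem : ∀ x, Real.exp (min x l) ∈ Icc 0 R := fun x =>
    ⟨(Real.exp_pos _).le, hel ▸ Real.exp_le_exp.mpr (min_le_right _ _)⟩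
  let f : ℝ → ℝ → ℝ → ℝ := fun δ φ x => pM lam Ψ κ q δ (Real.exp (min x l)) φ
  have fLip : ∀ δ ∈ Icc 0 R, ∀ φ, LipschitzWith (K * R.toNNReal) (f δ φ) := by
    intro δ hδ φ
    refine LipschitzWith.of_dist_le_mul fun x y => ?_
    have h1 := bK δ hδ _ (hmem x) δ hδ _ (hmem y) φ
    have h2 := exp_min_lip l x y
    rw [hel] at h2
    simp only [Real.dist_eq, NNReal.coe_mul, Real.coe_toNNReal _ hR.le]
    rw [sub_self, abs_zero, max_eq_right (abs_nonneg _)] at h1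
    refine h1.trans ?_
    rw [mul_assoc]
    exact mul_le_mul_of_nonneg_left h2 K.2
  have fC : ∀ δ ∈ Icc 0 R, ∀ φ x, |f δ φ x| ≤ C := fun δ hδ φ x => bC δ hδ _ (hmem x) φ
  have fcont : ∀ δ ∈ Icc 0 R, ∀ x, Continuous fun φ => f δ φ x := by
    intro δ hδ x
    have hr := hmem x
    set r := Real.exp (min x l) with hrdef
    have c1 : Continuous fun φ => Ψ (q δ + r * Real.sin φ) := by
      refine continuous_iff_continuousAt.mpr fun φ => ?_
      have s1 := Real.neg_one_le_sin φ
      have s2 := Real.sin_le_one φ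
      have := (bΨ δ hδ (r * Real.sin φ) ⟨by nlinarith [hr.1, hr.2], by nlinarith [hr.1, hr.2]⟩).1
      exact ContinuousAt.comp (g := Ψ) (f := fun φ => q δ + r * Real.sin φ) this (by fun_prop)
    have c2 : ∀ φ, lam + r * Real.cos φ ≠ 0 := fun φ => by
      have s1 := Real.neg_one_le_cos φ
      have : 0 < lam + r * Real.cos φ := by nlinarith [hr.1, hr.2]
      exact this.ne'
    have cc := Real.continuous_cos
    have cs := Real.continuous_sin
    show Continuous fun φ => pM lam Ψ κ q δ r φ
    unfold pM
    refine Continuous.div ?_ ?_ fun φ => (bD δ hδ r hr φ).ne'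
    · unfold pN
      refine Continuous.add (by fun_prop) (Continuous.div ((c1.mul cs).mul cc) (by fun_prop) c2)
    · unfold pD
      refine Continuous.sub (Continuous.add (Continuous.div (c1.mul (cc.pow 2)) (by fun_prop) c2)
        (by fun_prop)) (by fun_prop)
  have fper : ∀ δ φ x, f δ (φ + 2 * Real.pi) x = f δ φ x := by
    intro δ φ x
    simp only [f, pM, pN, pD, Real.cos_add_two_pi, Real.sin_add_two_pi]
  have growth : ∀ δ ∈ Icc 0 R, ∀ s : ℝ → ℝ, (∀ φ, HasDerivAt s (f δ φ (s φ)) φ) →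
      ∀ φ ∈ Icc 0 (2 * Real.pi), s φ ≤ s 0 + C * (2 * Real.pi) := by
    intro δ hδ s hs φ hφ
    have := convex_univ.norm_image_sub_le_of_norm_hasDerivWithin_le (f := s) (C := C)
      (fun x _ => (hs x).hasDerivWithinAt) (fun x _ => fC δ hδ x (s x)) (mem_univ 0) (mem_univ φ)
    rw [Real.norm_eq_abs, Real.norm_eq_abs, sub_zero, abs_of_nonneg hφ.1] at this
    have h2 := (abs_le.mp this).2
    have h3 : (C : ℝ) * φ ≤ C * (2 * Real.pi) := mul_le_mul_of_nonneg_left hφ.2 C.2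
    linarith
  have inside : ∀ δ ∈ Icc 0 R, ∀ s : ℝ → ℝ, (∀ φ, HasDerivAt s (f δ φ (s φ)) φ) → ∀ φ,
      s φ < l → Real.exp (s φ) < R ∧
        0 < pD lam (κ δ) δ (Ψ (q δ + Real.exp (s φ) * Real.sin φ)) (Real.exp (s φ)) φ ∧
        HasDerivAt s (pM lam Ψ κ q δ (Real.exp (s φ)) φ) φ := by
    intro δ hδ s hs φ h
    have h1 : Real.exp (s φ) < R := hel ▸ Real.exp_lt_exp.mpr h
    refine ⟨h1, bD δ hδ _ ⟨(Real.exp_pos _).le, h1.le⟩ φ, ?_⟩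
    have := hs φ
    simp only [f, min_eq_left h.le] at this
    exact this
  have ψc : ∀ δ ∈ Icc 0 R, ContinuousOn (fun p => Ψ (q δ + p)) (Icc (-(2 * R)) (2 * R)) := by
    intro δ hδ p hp
    exact (ContinuousAt.comp (g := Ψ) (f := fun p => q δ + p) (bΨ δ hδ p hp).1
      (by fun_prop)).continuousWithinAt
  have h0R : (0 : ℝ) ∈ Icc 0 R := ⟨le_rfl, hR.le⟩
  -- the outer orbit
  set b := l - C * (2 * Real.pi) - 1 with hb
  have hsol : ∀ δ ∈ Icc 0 R, ∀ x₀, ∃ s : ℝ → ℝ, s 0 = x₀ ∧ ∀ φ, HasDerivAt s (f δ φ (s φ)) φ :=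
    fun δ hδ x₀ => ode_global (fLip δ hδ) (fC δ hδ) (fcont δ hδ) x₀
  obtain ⟨B₀, hB₀0, hB₀⟩ := hsol 0 h0R b
  have hB₀dec : B₀ (2 * Real.pi) < B₀ 0 := by
    refine energy_down (lam := lam) (k := κ 0) (ψ := fun p => Ψ (q 0 + p)) hR (by linarith) hRl.le
      (ψc 0 h0R) (fun p hp => (bΨ 0 h0R p hp).2) hκ0 fun φ hφ => ?_
    have := growth 0 h0R B₀ hB₀ φ hφ
    exact inside 0 h0R B₀ hB₀ φ (by linarith)
  -- choose δ
  have hsmall : ∀ᶠ δ in 𝓝 (0 : ℝ), gronwallBound 0 (K * R.toNNReal : NNReal) (K * δ) (2 * Real.pi)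
      < B₀ 0 - B₀ (2 * Real.pi) := by
    have hc : Continuous fun δ : ℝ =>
        gronwallBound 0 (K * R.toNNReal : NNReal) (K * δ) (2 * Real.pi) :=
      (gronwallBound_continuous_ε _ _ _).comp (continuous_const.mul continuous_id)
    refine hc.continuousAt.eventually (gt_mem_nhds ?_)
    simp only [mul_zero, gronwallBound_ε0_δ0]
    linarith
  obtain ⟨η, hη, hη'⟩ := Metric.eventually_nhds_iff.mp hsmall
  set δ := min (η / 2) R with hδdef
  have hδ0 : 0 < δ := by positivity
  have hδR : δ ∈ Icc 0 R := ⟨hδ0.le, min_le_right _ _⟩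
  have hδη : dist δ 0 < η := by
    rw [Real.dist_eq, sub_zero, abs_of_pos hδ0]
    have : δ ≤ η / 2 := min_le_left _ _
    linarith
  have hgr := hη' hδη
  obtain ⟨B, hB0, hB⟩ := hsol δ hδR b
  have hBdec : B (2 * Real.pi) ≤ B 0 := by
    have := dist_le_of_approx_trajectories_ODE (v := f 0) (K := K * R.toNNReal) (a := 0)
      (b := 2 * Real.pi) (f := B) (g := B₀) (f' := fun φ => f δ φ (B φ))
      (g' := fun φ => f 0 φ (B₀ φ)) (εf := K * δ) (εg := 0) (δ := 0) (fLip 0 h0R)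
      (fun φ _ => (hB φ).continuousAt.continuousWithinAt) (fun φ _ => (hB φ).hasDerivWithinAt)
      (fun φ _ => by
        have h1 := bK δ hδR _ (hmem (B φ)) 0 h0R _ (hmem (B φ)) φ
        rw [sub_self, abs_zero, sub_zero, abs_of_pos hδ0, max_eq_left hδ0.le] at h1
        exact h1)
      (fun φ _ => (hB₀ φ).continuousAt.continuousWithinAt) (fun φ _ => (hB₀ φ).hasDerivWithinAt)
      (fun φ _ => by simp) (by rw [hB0, hB₀0, dist_self]) (2 * Real.pi) ⟨hpi.le, le_rfl⟩
    rw [add_zero, sub_zero, Real.dist_eq] at this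
    have h2 := (abs_le.mp (this.trans hgr.le)).2
    linarith
  -- the inner orbit
  set a := min b (Real.log δ - C * (2 * Real.pi)) with ha
  obtain ⟨A, hA0, hA⟩ := hsol δ hδR a
  have hAinc : A 0 ≤ A (2 * Real.pi) := by
    refine energy_up (lam := lam) (k := κ δ) (d := δ) (ψ := fun p => Ψ (q δ + p)) hR (by linarith)
      hRl.le (ψc δ hδR) (fun p hp => (bΨ δ hδR p hp).2) (bκ δ hδR).le fun φ hφ => ?_
    have h1 := growth δ hδR A hA φ hφ
    have h2 : a ≤ b := min_le_left _ _
    have h3 : a ≤ Real.log δ - C * (2 * Real.pi) := min_le_right _ _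
    obtain ⟨i1, i2, i3⟩ := inside δ hδR A hA φ (by linarith)
    refine ⟨i1, ?_, i2, i3⟩
    rw [← Real.exp_log hδ0]
    exact Real.exp_le_exp.mpr (by linarith)
  obtain ⟨s, hs0, hs, hsper⟩ := ode_periodic (fLip δ hδR) (fC δ hδR) (fcont δ hδR) hpi.le
    (fper δ) hA hB (by rw [hA0, hB0]; exact min_le_left _ _) hAinc hBdec
  refine ⟨δ, hδ0, by linarith [hδR.2], s, hsper, fun φ => ?_⟩
  have hlt : s φ < l := by
    obtain ⟨y, hy, h⟩ := (show Function.Periodic s (2 * Real.pi) from hsper).exists_mem_Ico₀ hpi φ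
    rw [h]
    have := growth δ hδR s hs y (Ico_subset_Icc_self hy)
    have h2 := hs0.2
    rw [hB0] at h2
    linarith
  obtain ⟨i1, i2, i3⟩ := inside δ hδR s hs φ hlt
  exact ⟨by linarith, by linarith, i2, i3⟩

lemma local_inv {h : ℝ → ℝ} {x₀ d : ℝ} (hh : ContDiffAt ℝ 1 h x₀) (hd : HasDerivAt h d x₀)
    (hd0 : d ≠ 0) : ∃ X : ℝ → ℝ, X (h x₀) = x₀ ∧ ContDiffAt ℝ 1 X (h x₀) ∧
      ∀ᶠ y in 𝓝 (h x₀), h (X y) = y := by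
  let e : ℝ ≃L[ℝ] ℝ := ContinuousLinearEquiv.unitsEquivAut ℝ (Units.mk0 d hd0)
  have he : HasFDerivAt h (e : ℝ →L[ℝ] ℝ) x₀ := by
    have : (e : ℝ →L[ℝ] ℝ) = ContinuousLinearMap.toSpanSingleton ℝ d := by
      ext; simp [e]
    rw [this]
    exact hd.hasFDerivAt
  refine ⟨hh.localInverse he one_ne_zero, hh.localInverse_apply_image he one_ne_zero,
    hh.to_localInverse he one_ne_zero, ?_⟩
  exact (hh.hasStrictFDerivAt' he one_ne_zero).eventually_right_inverse

/-- Hopf bifurcation in the reduced two-predator one-prey system: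
for every `ε > 0` there is a parameter value `k` with `0 < |k − (a+2λ)| < ε` for
which the system has a nonconstant periodic solution whose orbit lies in the
`ε`-ball centered at the critical equilibrium `(λ, ξ₁(a+2λ))`. -/
theorem hopf_bifurcation_two_predator_one_prey
    (γ m₁ β₁ a lam ρ c : ℝ)
    (hγ : 0 < γ) (hm₁ : 0 < m₁) (hβ₁ : 0 < β₁) (ha : 0 < a)
    (hρ : 1 ≤ ρ) (hc : 0 < c) (hlam : 0 < lam)
    (ξ₁ : ℝ → ℝ)
    (hξ₁ : ∀ k : ℝ, lam < k → 0 < ξ₁ k ∧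
      ξ₁ k + ρ * c * (ξ₁ k) ^ ρ = γ * (a + lam) * (k - lam) / (m₁ * k))
    (hh₁ : 0 < 1 - ρ + ρ * γ * (a + lam) ^ 2 /
      (m₁ * ξ₁ (a + 2 * lam) * (a + 2 * lam))) :
    ∀ ε > (0 : ℝ), ∃ k : ℝ, lam < k ∧
      0 < |k - (a + 2 * lam)| ∧ |k - (a + 2 * lam)| < ε ∧
      ∃ (z : ℝ → ℝ × ℝ) (P : ℝ), 0 < P ∧
        (∀ t, HasDerivAt z (planarField γ k m₁ β₁ a lam ρ c (z t)) t) ∧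
        (∀ t, z (t + P) = z t) ∧
        ¬ (∀ t, z t = z 0) ∧
        (∀ t, ‖z t - (lam, ξ₁ (a + 2 * lam))‖ < ε) := by
  intro ε hε
  set k₀ := a + 2 * lam with hk₀
  set ξ := ξ₁ k₀ with hξ
  have hk₀pos : 0 < k₀ := by positivity
  obtain ⟨hξpos, hξeq⟩ := hξ₁ k₀ (by linarith)
  rw [← hξ] at hξpos hξeq
  let h : ℝ → ℝ := fun x => x + ρ * c * x ^ ρ
  have hderiv : ∀ x, 0 < x → HasDerivAt h (1 + ρ * c * (ρ * x ^ (ρ - 1))) x := fun x hx =>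
    (hasDerivAt_id x).add ((Real.hasDerivAt_rpow_const (Or.inl hx.ne')).const_mul (ρ * c))
  have hρ0 : 0 < ρ := by linarith
  have hdpos : ∀ x : ℝ, 0 < x → 0 < 1 + ρ * c * (ρ * x ^ (ρ - 1)) := fun x hx => by positivity
  have hsmooth : ContDiffAt ℝ 1 h ξ :=
    contDiffAt_id.add (contDiffAt_const.mul (Real.contDiffAt_rpow_const_of_ne hξpos.ne'))
  obtain ⟨X, hX0, hXs, hXinv⟩ := local_inv hsmooth (hderiv ξ hξpos) (hdpos ξ hξpos).ne'
  let κ : ℝ → ℝ := fun δ => γ / (m₁ * (k₀ + δ))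
  let q : ℝ → ℝ := fun δ => κ δ * (k₀ + δ - lam) * (a + lam)
  let Ψ : ℝ → ℝ := fun y => β₁ / m₁ * (ρ * y - (ρ - 1) * X y)
  have hq0 : q 0 = h ξ := by
    show γ / (m₁ * (k₀ + 0)) * (k₀ + 0 - lam) * (a + lam) = ξ + ρ * c * ξ ^ ρ
    rw [hξeq, add_zero]
    field_simp
  have hκ0 : 0 < κ 0 := by simp only [κ]; positivity
  have hκs : ContDiffAt ℝ 1 κ 0 :=
    contDiffAt_const.div (contDiffAt_const.mul (contDiffAt_const.add contDiffAt_id))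
      (by simp only [id, add_zero]; positivity)
  have hqs : ContDiffAt ℝ 1 q 0 :=
    (hκs.mul ((contDiffAt_const.add contDiffAt_id).sub contDiffAt_const)).mul contDiffAt_const
  have hΨs : ContDiffAt ℝ 1 Ψ (q 0) := by
    rw [hq0]
    exact contDiffAt_const.mul ((contDiffAt_const.mul contDiffAt_id).sub (contDiffAt_const.mul hXs))
  have hΨval : ∀ y, h (X y) = y → Ψ y = β₁ / m₁ * (X y + ρ * c * ρ * X y ^ ρ) := by
    intro y hy
    have hy' : X y + ρ * c * X y ^ ρ = y := hy
    show β₁ / m₁ * (ρ * y - (ρ - 1) * X y) = _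
    linear_combination (-(β₁ / m₁ * ρ)) * hy'
  have hΨ0 : 0 < Ψ (q 0) := by
    rw [hq0, hΨval _ (by rw [hX0]), hX0]
    positivity
  -- good neighbourhood
  have hev : ∀ᶠ y in 𝓝 (h ξ), (∀ᶠ y' in 𝓝 y, h (X y') = y') ∧ DifferentiableAt ℝ X y ∧
      0 < X y ∧ |X y - ξ| < ε := by
    have hXc : Tendsto X (𝓝 (h ξ)) (𝓝 ξ) := by
      have := hXs.continuousAt.tendsto
      rwa [hX0] at this
    refine hXinv.eventually_nhds.and (((hXs.eventually (by simp)).mono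
      fun y hy => hy.differentiableAt one_ne_zero).and ((hXc.eventually (lt_mem_nhds hξpos)).and ?_))
    have := hXc.eventually (Metric.ball_mem_nhds ξ hε)
    exact this
  have hev2 : ∀ᶠ x : ℝ × ℝ in 𝓝 (0, 0), (∀ᶠ y' in 𝓝 (q x.1 + x.2), h (X y') = y') ∧
      DifferentiableAt ℝ X (q x.1 + x.2) ∧ 0 < X (q x.1 + x.2) ∧ |X (q x.1 + x.2) - ξ| < ε := by
    have h1 : ContinuousAt (fun x : ℝ × ℝ => q x.1 + x.2) (0, 0) :=
      (ContinuousAt.comp (g := q) (f := Prod.fst) (x := ((0 : ℝ), (0 : ℝ))) hqs.continuousAt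
        continuousAt_fst).add continuousAt_snd
    have h3 : Tendsto (fun x : ℝ × ℝ => q x.1 + x.2) (𝓝 (0, 0)) (𝓝 (h ξ)) := by
      have := h1.tendsto
      simp only [add_zero, hq0] at this
      exact this
    exact h3.eventually hev
  obtain ⟨η, hη, hball⟩ := Metric.eventually_nhds_iff.mp hev2
  obtain ⟨δ, hδ0, hδε, s, hsper, hs⟩ := hopf_core hlam hΨs hΨ0 hκs hκ0 hqs (lt_min hε hη)
  have hδε' : δ < ε := hδε.trans_le (min_le_left _ _)
  have hδη : δ < η := hδε.trans_le (min_le_right _ _)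
  have hgood := fun φ => @hball (δ, Real.exp (s φ) * Real.sin φ) (by
    have h1 := (hs φ).1.trans_le (min_le_right _ _)
    have h2 := Real.exp_pos (s φ)
    have s1 := Real.neg_one_le_sin φ
    have s2 := Real.sin_le_one φ
    rw [Prod.dist_eq, max_lt_iff]
    simp only [Real.dist_eq, sub_zero]
    exact ⟨by rwa [abs_of_pos hδ0], abs_lt.mpr ⟨by nlinarith, by nlinarith⟩⟩)
  simp only at hgood
  have hSpos : ∀ φ, 0 < lam + Real.exp (s φ) * Real.cos φ := fun φ => by
    have h1 := (hs φ).2.1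
    have h2 := Real.exp_pos (s φ)
    have s1 := Real.neg_one_le_cos φ
    nlinarith
  let D : ℝ → ℝ := fun φ =>
    pD lam (κ δ) δ (Ψ (q δ + Real.exp (s φ) * Real.sin φ)) (Real.exp (s φ)) φ
  have hD : ∀ φ, 0 < D φ := fun φ => (hs φ).2.2.1
  let w : ℝ → ℝ × ℝ := fun φ =>
    (lam + Real.exp (s φ) * Real.cos φ, X (q δ + Real.exp (s φ) * Real.sin φ))
  let σ : ℝ → ℝ := fun φ => (a + (lam + Real.exp (s φ) * Real.cos φ)) /
    (m₁ * (lam + Real.exp (s φ) * Real.cos φ) * D φ)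
  have hscont : Continuous s := continuous_iff_continuousAt.mpr fun φ => (hs φ).2.2.2.continuousAt
  have hXcont : Continuous fun φ => X (q δ + Real.exp (s φ) * Real.sin φ) :=
    continuous_iff_continuousAt.mpr fun φ =>
      ContinuousAt.comp (g := X) (f := fun φ => q δ + Real.exp (s φ) * Real.sin φ)
        (hgood φ).2.1.continuousAt (by fun_prop)
  have hDcont : Continuous D := by
    simp only [D, pD, Ψ]
    refine Continuous.sub (Continuous.add (Continuous.div (Continuous.mul (Continuous.mul
      continuous_const (Continuous.sub (by fun_prop) (continuous_const.mul hXcont)))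
      (by fun_prop)) (by fun_prop) fun φ => (hSpos φ).ne') (by fun_prop)) (by fun_prop)
  have hσcont : Continuous σ := by
    refine Continuous.div (by fun_prop) (Continuous.mul (by fun_prop) hDcont) fun φ => ?_
    have := hSpos φ
    have := hD φ
    positivity
  have hσpos : ∀ φ, 0 < σ φ := fun φ => by
    have := hSpos φ
    have := hD φ
    simp only [σ]
    positivity
  have hσper : ∀ φ, σ (φ + 2 * Real.pi) = σ φ := fun φ => by
    simp only [σ, D, pD, hsper, Real.cos_add_two_pi, Real.sin_add_two_pi]
  have hwper : ∀ φ, w (φ + 2 * Real.pi) = w φ := fun φ => by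
    simp only [w, hsper, Real.cos_add_two_pi, Real.sin_add_two_pi]
  have hkpos : 0 < k₀ + δ := by positivity
  have hw : ∀ φ, HasDerivAt w (σ φ • planarField γ (k₀ + δ) m₁ β₁ a lam ρ c (w φ)) φ := by
    intro φ
    obtain ⟨hu, hp⟩ := polar_deriv (hD φ).ne' (hs φ).2.2.2
    obtain ⟨g1, g2, g3, g4⟩ := hgood φ
    have hinv : h (X (q δ + Real.exp (s φ) * Real.sin φ)) = q δ + Real.exp (s φ) * Real.sin φ :=
      g1.self_of_nhds
    have hΨv := hΨval _ hinv
    have hchain := ((hderiv _ g3).comp _ g2.hasDerivAt).unique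
      ((hasDerivAt_id _).congr_of_eventuallyEq g1)
    have h1 := hu.const_add lam
    have h2 := g2.hasDerivAt.comp φ (hp.const_add (q δ))
    refine (h1.prodMk h2).congr_deriv ?_
    have hDφ := hD φ
    have hSφ := hSpos φ
    have hinv' : X (q δ + Real.exp (s φ) * Real.sin φ) +
        ρ * c * X (q δ + Real.exp (s φ) * Real.sin φ) ^ ρ = q δ + Real.exp (s φ) * Real.sin φ := hinv
    have hDeq : pD lam (κ δ) δ (Ψ (q δ + Real.exp (s φ) * Real.sin φ)) (Real.exp (s φ)) φ = D φ := rfl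
    have hpow : X (q δ + Real.exp (s φ) * Real.sin φ) ^ ρ =
        X (q δ + Real.exp (s φ) * Real.sin φ) ^ (ρ - 1) * X (q δ + Real.exp (s φ) * Real.sin φ) := by
      rw [Real.rpow_sub_one g3.ne', div_mul_cancel₀ _ g3.ne']
    have hXΨ : deriv X (q δ + Real.exp (s φ) * Real.sin φ) * Ψ (q δ + Real.exp (s φ) * Real.sin φ)
        = β₁ / m₁ * X (q δ + Real.exp (s φ) * Real.sin φ) := by
      rw [hΨv, hpow]
      linear_combination (β₁ / m₁ * X (q δ + Real.exp (s φ) * Real.sin φ)) * hchain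
    rw [hDeq]
    simp only [w, σ, planarField, Prod.smul_mk, smul_eq_mul]
    rw [hinv']
    have hqδ : q δ = γ / (m₁ * (k₀ + δ)) * (k₀ + δ - lam) * (a + lam) := rfl
    have hκδ : κ δ = γ / (m₁ * (k₀ + δ)) := rfl
    clear_value D
    have haS : 0 < a + (lam + Real.exp (s φ) * Real.cos φ) := by linarith
    refine Prod.ext ?_ ?_
    · show _ / D φ = _
      rw [hqδ, hκδ]
      generalize Real.exp (s φ) * Real.cos φ = u at *
      generalize Real.exp (s φ) * Real.sin φ = p at *
      field_simp
      rw [hk₀]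
      ring
    · show deriv X _ * (_ / D φ) = _
      have e : deriv X (q δ + Real.exp (s φ) * Real.sin φ) *
          (Ψ (q δ + Real.exp (s φ) * Real.sin φ) * (Real.exp (s φ) * Real.cos φ) /
            (lam + Real.exp (s φ) * Real.cos φ) / D φ) =
          (deriv X (q δ + Real.exp (s φ) * Real.sin φ) * Ψ (q δ + Real.exp (s φ) * Real.sin φ)) *
            (Real.exp (s φ) * Real.cos φ) / (lam + Real.exp (s φ) * Real.cos φ) / D φ := by ring
      rw [e, hXΨ]
      generalize X (q δ + Real.exp (s φ) * Real.sin φ) = x at *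
      generalize Real.exp (s φ) * Real.cos φ = u at *
      field_simp
      ring
  obtain ⟨τ, P, hP, hτ, hz, hzP⟩ := time_change (by positivity : 0 < 2 * Real.pi)
    hσcont hσpos hσper hw hwper
  refine ⟨k₀ + δ, by linarith, by simpa using hδ0.ne', ?_, fun t => w (τ t), P, hP, hz, hzP, ?_, ?_⟩
  · rw [add_sub_cancel_left, abs_of_pos hδ0]; exact hδε'
  · intro hconst
    obtain ⟨t₁, ht₁⟩ := hτ 0
    obtain ⟨t₂, ht₂⟩ := hτ Real.pi
    have h1 := (hconst t₁).trans (hconst t₂).symm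
    simp only [ht₁, ht₂] at h1
    have h2 := congrArg Prod.fst h1
    simp only [w, Real.cos_zero, Real.cos_pi] at h2
    have := Real.exp_pos (s 0)
    have := Real.exp_pos (s Real.pi)
    linarith
  · intro t
    have hdiff : w (τ t) - (lam, ξ) = (Real.exp (s (τ t)) * Real.cos (τ t),
        X (q δ + Real.exp (s (τ t)) * Real.sin (τ t)) - ξ) := by
      simp [w]
    rw [hdiff, Prod.norm_def, max_lt_iff]
    refine ⟨?_, (hgood (τ t)).2.2.2⟩
    have h1 := (hs (τ t)).1.trans_le (min_le_left _ _)
    have h2 := Real.exp_pos (s (τ t))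
    have s1 := Real.neg_one_le_cos (τ t)
    have s2 := Real.cos_le_one (τ t)
    exact abs_lt.mpr ⟨by nlinarith, by nlinarith⟩
end
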